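/- arXiv:math/0512003 — 3 statements merged into one kernel-verified Lean document; each statement's English description precedes it below -/
import Mathlib

section
/- For every p with 1 ≤ p < ∞ and every measurable function f : 𝕋 → ℂ, there exist complex coefficients (c_k)_{k>0} and compact sets K_n ⊆ 𝕋 with m(𝕋 \ K_n) → 0 as n → ∞, such that for every n the partial sums S_N(t) = ∑_{0<k≤N} c_k e^{ikt} converge to f in the norm of L^p(K_n), i.e., ∫_{K_n} |S_N(t) − f(t)|^p dt → 0 as N → ∞. -/
open MeasureTheory Filter Topology Real

instance : Fact (0 < 2 * π) := ⟨by positivity⟩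

/-- The partial sum `S_N(t) = ∑_{0 < k ≤ N} c_k e^{ikt}` of a series with positive
spectrum on the circle `𝕋 = ℝ/2πℤ`. -/
noncomputable def analyticPartialSum (c : ℕ → ℂ) (N : ℕ) (t : AddCircle (2 * π)) : ℂ :=
  ∑ k ∈ Finset.Icc 1 N, c k * fourier (k : ℤ) t

namespace AnalyticMenshov

open scoped ENNReal NNReal

/-- The circle. -/
abbrev Circ := AddCircle (2 * π)

/-- Normalised Haar measure. -/
noncomputable abbrev hm : Measure Circ := AddCircle.haarAddCircle

/-- Trigonometric polynomials with spectrum in `s`. -/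
noncomputable def sp (s : Set ℤ) : Submodule ℂ C(Circ, ℂ) :=
  Submodule.span ℂ ((fun n : ℤ => (fourier n : C(Circ, ℂ))) '' s)

lemma fourier_mem_sp {s : Set ℤ} {n : ℤ} (h : n ∈ s) : (fourier n : C(Circ, ℂ)) ∈ sp s :=
  Submodule.subset_span ⟨n, h, rfl⟩

lemma sp_mono {s t : Set ℤ} (h : s ⊆ t) : sp s ≤ sp t :=
  Submodule.span_mono (Set.image_mono h)

lemma sp_mul {s t u : Set ℤ} (h : ∀ i ∈ s, ∀ j ∈ t, i + j ∈ u) {a b : C(Circ, ℂ)}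
    (ha : a ∈ sp s) (hb : b ∈ sp t) : a * b ∈ sp u := by
  have h1 : a * b ∈ sp s * sp t := Submodule.mul_mem_mul ha hb
  unfold sp at h1
  rw [Submodule.span_mul_span] at h1
  refine Submodule.span_le.2 ?_ h1
  rintro _ ⟨_, ⟨i, hi, rfl⟩, _, ⟨j, hj, rfl⟩, rfl⟩
  have : (fourier i : C(Circ, ℂ)) * fourier j = fourier (i + j) := by
    ext x; simp only [ContinuousMap.mul_apply]; rw [fourier_add]
  simp only [this]
  exact fourier_mem_sp (h i hi j hj)

lemma sp_split {s t : Set ℤ} {a : C(Circ, ℂ)} (ha : a ∈ sp (s ∪ t)) :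
    ∃ b ∈ sp s, ∃ c ∈ sp t, b + c = a := by
  unfold sp at ha
  rw [Set.image_union, Submodule.span_union] at ha
  exact Submodule.mem_sup.1 ha

lemma cm_memLp (a : C(Circ, ℂ)) (q : ℝ≥0∞) : MemLp (a : Circ → ℂ) q hm :=
  (a.continuous.memLp_top_of_hasCompactSupport (HasCompactSupport.of_compactSpace _) hm).mono_exponent le_top

lemma cm_meas (a : C(Circ, ℂ)) : AEStronglyMeasurable (a : Circ → ℂ) hm :=
  a.continuous.aestronglyMeasurable

lemma riesz_two {a b : C(Circ, ℂ)} (ha : a ∈ sp (Set.Ioi 0)) (hb : b ∈ sp (Set.Iic 0)) :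
    eLpNorm a 2 hm ≤ eLpNorm (a + b : C(Circ, ℂ)) 2 hm := by
  have ho : (Submodule.map (ContinuousMap.toLp (E := ℂ) 2 hm ℂ).toLinearMap (sp (Set.Ioi 0))) ⟂
      (Submodule.map (ContinuousMap.toLp (E := ℂ) 2 hm ℂ).toLinearMap (sp (Set.Iic 0))) := by
    unfold sp
    rw [Submodule.map_span, Submodule.map_span, Submodule.isOrtho_span]
    rintro _ ⟨_, ⟨i, hi, rfl⟩, rfl⟩ _ ⟨_, ⟨j, hj, rfl⟩, rfl⟩
    refine (orthonormal_fourier (T := 2 * π)).2 ?_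
    rintro rfl
    exact absurd hi (by simpa using hj)
  have h0 : inner ℂ (ContinuousMap.toLp (E := ℂ) 2 hm ℂ a) (ContinuousMap.toLp (E := ℂ) 2 hm ℂ b) = 0 :=
    Submodule.isOrtho_iff_inner_eq.1 ho _ (Submodule.mem_map_of_mem ha) _ (Submodule.mem_map_of_mem hb)
  have h1 := norm_add_sq_eq_norm_sq_add_norm_sq_of_inner_eq_zero _ _ h0
  rw [← map_add] at h1
  have h2 : ‖ContinuousMap.toLp (E := ℂ) 2 hm ℂ a‖ ≤ ‖ContinuousMap.toLp (E := ℂ) 2 hm ℂ (a + b)‖ := by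
    refine le_of_sq_le_sq ?_ (norm_nonneg _)
    nlinarith [norm_nonneg (ContinuousMap.toLp (E := ℂ) 2 hm ℂ b)]
  have h3 : ∀ c : C(Circ, ℂ), ‖ContinuousMap.toLp (E := ℂ) 2 hm ℂ c‖ₑ = eLpNorm c 2 hm := by
    intro c
    rw [Lp.enorm_def]
    exact eLpNorm_congr_ae (ContinuousMap.coeFn_toLp hm c)
  rw [← h3, ← h3, ← ofReal_norm, ← ofReal_norm]
  exact ENNReal.ofReal_le_ofReal h2

lemma eLpNorm_sq (a : C(Circ, ℂ)) (q : ℝ≥0∞) :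
    eLpNorm (a * a : C(Circ, ℂ)) q hm = eLpNorm a (2 * q) hm ^ 2 := by
  have := eLpNorm_norm_rpow (μ := hm) (p := q) (fun x => a x) (q := 2) (by norm_num)
  rw [mul_comm 2 q]
  have h2 : ENNReal.ofReal 2 = 2 := by norm_num
  rw [h2] at this
  rw [← ENNReal.rpow_natCast]
  push_cast
  rw [← this]
  refine eLpNorm_congr_norm_ae (Eventually.of_forall fun x => ?_)
  simp [pow_two]

lemma eLpNorm_mul (a b : C(Circ, ℂ)) (q : ℝ≥0∞) :
    eLpNorm (a * b : C(Circ, ℂ)) q hm ≤ eLpNorm a (2 * q) hm * eLpNorm b (2 * q) hm := by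
  have : ENNReal.HolderTriple (2 * q) (2 * q) q := ⟨by
    rw [ENNReal.mul_inv (by simp) (by simp), ← add_mul, ENNReal.inv_two_add_inv_two, one_mul]⟩
  have h := eLpNorm_smul_le_mul_eLpNorm (p := 2 * q) (q := 2 * q) (r := q) (cm_meas b) (cm_meas a)
  simpa only [smul_eq_mul, ContinuousMap.coe_mul] using h


/-- M. Riesz's theorem for exponents `2 ^ (m + 1)`, by Cotlar's identity. -/
lemma riesz_zero (m : ℕ) : ∃ C : ℝ≥0, ∀ a ∈ sp (Set.Ioi 0), ∀ b ∈ sp (Set.Iic 0),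
    eLpNorm a (2 ^ (m + 1)) hm ≤ C * eLpNorm (a + b : C(Circ, ℂ)) (2 ^ (m + 1)) hm := by
  induction m with
  | zero =>
    refine ⟨1, fun a ha b hb => ?_⟩
    simpa using riesz_two ha hb
  | succ m ih =>
    obtain ⟨C, hC⟩ := ih
    refine ⟨2 * C + 1, fun a ha b hb => ?_⟩
    rw [pow_succ' 2 (m + 1)]
    set q : ℝ≥0∞ := 2 ^ (m + 1) with hq
    have hq1 : 1 ≤ q := one_le_pow₀ (by norm_num)
    obtain ⟨c, hc, d, hd, hcd⟩ : ∃ c ∈ sp (Set.Ioi 0), ∃ d ∈ sp (Set.Iic 0), c + d = a * b := by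
      apply sp_split
      exact sp_mul (fun i _ j _ => by
        simp only [Set.mem_union, Set.mem_Ioi, Set.mem_Iic]; omega) ha hb
    have haa : a * a ∈ sp (Set.Ioi 0) :=
      sp_mul (fun i hi j hj => by simp only [Set.mem_Ioi] at *; omega) ha ha
    have hbb : b * b ∈ sp (Set.Iic 0) :=
      sp_mul (fun i hi j hj => by simp only [Set.mem_Iic] at *; omega) hb hb
    have h1 := hC (a * a + c) (add_mem haa hc) d hd
    have h2 := hC (a * a + (c + c)) (add_mem haa (add_mem hc hc)) (d + d + b * b)
      (add_mem (add_mem hd hd) hbb)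
    have e1 : a * a + c + d = (a + b) * a := by rw [add_assoc, hcd]; ring
    have e2 : a * a + (c + c) + (d + d + b * b) = (a + b) * (a + b) := by
      have : a * a + (c + c) + (d + d + b * b) = a * a + (c + d) + (c + d) + b * b := by ring
      rw [this, hcd]; ring
    rw [e1] at h1
    rw [e2, eLpNorm_sq] at h2
    have h1' := h1.trans (mul_le_mul_right (eLpNorm_mul (a + b) a q) _)
    have e3 : a * a = (a * a + c) + (a * a + c) - (a * a + (c + c)) := by ring
    have h3 : eLpNorm (a * a : C(Circ, ℂ)) q hm ≤
        eLpNorm (a * a + c : C(Circ, ℂ)) q hm + eLpNorm (a * a + c : C(Circ, ℂ)) q hm +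
          eLpNorm (a * a + (c + c) : C(Circ, ℂ)) q hm := by
      calc eLpNorm (a * a : C(Circ, ℂ)) q hm
          = eLpNorm ((a * a + c) + (a * a + c) - (a * a + (c + c)) : C(Circ, ℂ)) q hm := by
            rw [← e3]
        _ ≤ eLpNorm ((a * a + c) + (a * a + c) : C(Circ, ℂ)) q hm +
            eLpNorm (a * a + (c + c) : C(Circ, ℂ)) q hm :=
          eLpNorm_sub_le (cm_meas _) (cm_meas _) hq1
        _ ≤ _ := by
          gcongr
          exact eLpNorm_add_le (cm_meas _) (cm_meas _) hq1
    rw [eLpNorm_sq] at h3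
    have fx := (cm_memLp a (2 * q)).eLpNorm_ne_top
    have fy := (cm_memLp (a + b) (2 * q)).eLpNorm_ne_top
    have h4 := h3.trans (add_le_add (add_le_add h1' h1') h2)
    generalize eLpNorm a (2 * q) hm = x at *
    generalize eLpNorm (a + b : C(Circ, ℂ)) (2 * q) hm = y at *
    lift x to ℝ≥0 using fx
    lift y to ℝ≥0 using fy
    norm_cast at h4 ⊢
    rw [← NNReal.coe_le_coe] at h4 ⊢
    push_cast at h4 ⊢
    by_contra hcon
    push Not at hcon
    have := x.2; have := y.2; have := C.2
    have hx : (0 : ℝ) ≤ x := x.2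
    have hy : (0 : ℝ) ≤ y := y.2
    have hCC : (0 : ℝ) ≤ C := C.2
    nlinarith [mul_nonneg hCC hy, mul_nonneg hCC (mul_nonneg hy hy), mul_nonneg hCC (mul_nonneg hCC hy),
      mul_nonneg hx hy, mul_nonneg (sub_nonneg.2 hcon.le) hy, mul_nonneg (sub_nonneg.2 hcon.le) hx]

lemma sub_eLpNorm {a b : C(Circ, ℂ)} {q C : ℝ≥0∞} (hq : 1 ≤ q)
    (h : eLpNorm a q hm ≤ C * eLpNorm (a + b : C(Circ, ℂ)) q hm) :
    eLpNorm b q hm ≤ (C + 1) * eLpNorm (a + b : C(Circ, ℂ)) q hm := by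
  have e : b = (a + b) - a := by ring
  calc eLpNorm b q hm = eLpNorm ((a + b) - a : C(Circ, ℂ)) q hm := by rw [← e]
    _ ≤ eLpNorm (a + b : C(Circ, ℂ)) q hm + eLpNorm a q hm :=
      eLpNorm_sub_le (cm_meas _) (cm_meas _) hq
    _ ≤ eLpNorm (a + b : C(Circ, ℂ)) q hm + C * eLpNorm (a + b : C(Circ, ℂ)) q hm := by gcongr
    _ = _ := by ring

lemma eLpNorm_fourier_mul (n : ℤ) (a : C(Circ, ℂ)) (q : ℝ≥0∞) :
    eLpNorm (fourier n * a : C(Circ, ℂ)) q hm = eLpNorm a q hm := by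
  refine eLpNorm_congr_norm_ae (Eventually.of_forall fun x => ?_)
  rw [ContinuousMap.mul_apply, norm_mul, fourier_apply, Circle.norm_coe, one_mul]

/-- Bound for the low-frequency part, arbitrary cut. -/
lemma riesz (m : ℕ) : ∃ C : ℝ≥0, ∀ N : ℤ, ∀ a ∈ sp (Set.Ioi N), ∀ b ∈ sp (Set.Iic N),
    eLpNorm b (2 ^ (m + 1)) hm ≤ C * eLpNorm (a + b : C(Circ, ℂ)) (2 ^ (m + 1)) hm := by
  obtain ⟨C, hC⟩ := riesz_zero m
  refine ⟨C + 1, fun N a ha b hb => ?_⟩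
  have h := hC (fourier (-N) * a) (sp_mul (s := {-N}) (fun i hi j hj => by
      simp only [Set.mem_Ioi, Set.mem_singleton_iff] at *; omega) (fourier_mem_sp rfl) ha)
    (fourier (-N) * b) (sp_mul (s := {-N}) (fun i hi j hj => by
      simp only [Set.mem_Iic, Set.mem_singleton_iff] at *; omega) (fourier_mem_sp rfl) hb)
  rw [← mul_add, eLpNorm_fourier_mul, eLpNorm_fourier_mul] at h
  have := sub_eLpNorm (one_le_pow₀ (by norm_num)) h
  simpa using this

/-- Cesaro means of `∑ z^k`, `k ≥ 1`. -/
noncomputable def psi (m : ℕ) : Polynomial ℂ :=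
  Polynomial.C ((m : ℂ) + 1)⁻¹ * ∑ n ∈ Finset.range (m + 1), ∑ k ∈ Finset.range n, Polynomial.X ^ (k + 1)

lemma psi_zero (m : ℕ) : (psi m).eval 0 = 0 := by
  simp [psi, Polynomial.eval_finsetSum]

lemma psi_eval (m : ℕ) (z : ℂ) (hz : z ≠ 1) :
    (psi m).eval z = z / (1 - z) - ((m : ℂ) + 1)⁻¹ * (z * (1 - z ^ (m + 1)) / (1 - z) ^ 2) := by
  have h1 : (1 - z) ≠ 0 := sub_ne_zero.2 hz.symm
  have hz1 : z - 1 ≠ 0 := sub_ne_zero.2 hz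
  have hm : (m : ℂ) + 1 ≠ 0 := by exact_mod_cast Nat.succ_ne_zero m
  have h2 : ∀ n, ∑ k ∈ Finset.range n, z ^ (k + 1) = z / (1 - z) - z / (1 - z) * z ^ n := by
    intro n
    simp_rw [pow_succ]
    rw [← Finset.sum_mul, geom_sum_eq hz]
    field_simp
    ring
  simp only [psi, Polynomial.eval_mul, Polynomial.eval_C, Polynomial.eval_finsetSum,
    Polynomial.eval_pow, Polynomial.eval_X, h2]
  rw [Finset.sum_sub_distrib, ← Finset.mul_sum, geom_sum_eq hz]
  simp only [Finset.sum_const, Finset.card_range, nsmul_eq_mul]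
  push_cast
  field_simp
  ring

lemma psi_tendsto (z : ℂ) (hz : z ≠ 1) (hn : ‖z‖ = 1) :
    Tendsto (fun m => (psi m).eval z) atTop (𝓝 (z / (1 - z))) := by
  have h : Tendsto (fun m : ℕ => ((m : ℂ) + 1)⁻¹ * (z * (1 - z ^ (m + 1)) / (1 - z) ^ 2)) atTop (𝓝 0) := by
    refine squeeze_zero_norm (a := fun m : ℕ => ((m : ℝ) + 1)⁻¹ * (2 / ‖(1 - z) ^ 2‖)) (fun m => ?_) ?_
    · rw [norm_mul, norm_inv, norm_div, norm_mul, hn, one_mul]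
      have : ‖(m : ℂ) + 1‖ = (m : ℝ) + 1 := by
        have : ((m : ℂ) + 1) = ((m + 1 : ℕ) : ℂ) := by push_cast; ring
        rw [this, Complex.norm_natCast]; push_cast; ring
      rw [this]
      gcongr
      calc ‖1 - z ^ (m + 1)‖ ≤ ‖(1 : ℂ)‖ + ‖z ^ (m + 1)‖ := norm_sub_le _ _
        _ = 2 := by rw [norm_pow, hn]; norm_num
    · have := (tendsto_one_div_add_atTop_nhds_zero_nat (𝕜 := ℝ)).mul_const (2 / ‖(1 - z) ^ 2‖)
      simpa using this
  have := h.const_sub (z / (1 - z))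
  rw [sub_zero] at this
  exact this.congr fun m => (psi_eval m z hz).symm

lemma re_half (z : ℂ) (hz : z ≠ 1) (hn : ‖z‖ = 1) : (z / (1 - z)).re = -1 / 2 := by
  have h1 : (1 - z) ≠ 0 := sub_ne_zero.2 hz.symm
  have h2 : Complex.normSq z = 1 := by rw [Complex.normSq_eq_norm_sq, hn]; norm_num
  have h3 : Complex.normSq (1 - z) ≠ 0 := by simpa using h1
  rw [Complex.normSq_apply] at h2 h3
  rw [Complex.div_re, Complex.normSq_apply]
  simp only [Complex.sub_re, Complex.one_re, Complex.sub_im, Complex.one_im] at *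
  rw [← add_div, div_eq_iff h3]
  nlinarith

lemma circ_norm (x : Circ) : ‖(fourier 1 x : ℂ)‖ = 1 := by
  rw [fourier_apply, Circle.norm_coe]

lemma fourier_ne_one : ∀ᵐ x ∂hm, (fourier 1 x : ℂ) ≠ 1 := by
  have : hm ({0} : Set Circ) = 0 := by
    have h1 : (volume : Measure Circ) {0} = 0 := by
      have := AddCircle.volume_closedBall (T := 2 * π) (x := 0) 0
      simpa using this
    rw [AddCircle.volume_eq_smul_haarAddCircle, Measure.smul_apply, smul_eq_mul, mul_eq_zero] at h1
    rcases h1 with h1 | h1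
    · exfalso
      have : 0 < 2 * π := by positivity
      simp only [ENNReal.ofReal_eq_zero] at h1
      linarith
    · exact h1
  rw [ae_iff]
  refine measure_mono_null ?_ this
  intro x hx
  simp only [ne_eq, not_not, Set.mem_ofPred_eq, fourier_one] at hx
  have h0 : AddCircle.toCircle x = AddCircle.toCircle (0 : Circ) := by
    rw [AddCircle.toCircle_zero]; exact Subtype.ext hx
  have := AddCircle.injective_toCircle (T := 2 * π) (by positivity) h0
  simpa using this

lemma poly_cont (h : Polynomial ℂ) : Continuous (fun x : Circ => h.eval (fourier 1 x : ℂ)) :=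
  h.continuous.comp (fourier 1 : C(Circ, ℂ)).continuous

/-- An analytic polynomial vanishing at `0` which is near `1` off a small subset of the circle. -/
lemma exists_h (ε δ : ℝ) (hε : 0 < ε) (hδ : 0 < δ) : ∃ h : Polynomial ℂ, h.eval 0 = 0 ∧
    hm {x | ε ≤ ‖h.eval (fourier 1 x : ℂ) - 1‖} ≤ ENNReal.ofReal δ := by
  have hT := tendstoInMeasure_of_tendsto_ae (μ := hm) (f := fun m (x : Circ) => (psi m).eval (fourier 1 x : ℂ))
    (g := fun x : Circ => (fourier 1 x : ℂ) / (1 - (fourier 1 x : ℂ)))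
    (fun n => (poly_cont _).aestronglyMeasurable)
    (by filter_upwards [fourier_ne_one] with x hx using psi_tendsto _ hx (circ_norm x))
  have hδ2 : (0 : ℝ≥0∞) < ENNReal.ofReal (δ / 2) := by simpa using hδ
  obtain ⟨m, hm1⟩ := ((hT (ENNReal.ofReal (1 / 4)) (by simp)).eventually_lt_const hδ2).exists
  set ψ := psi m with hψ
  obtain ⟨D, hD⟩ : ∃ D : ℝ, ∀ x : Circ, ‖ψ.eval (fourier 1 x : ℂ)‖ ≤ D := by
    obtain ⟨D, hD⟩ := (isCompact_range (poly_cont ψ)).isBounded.exists_norm_le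
    exact ⟨D, fun x => hD _ ⟨x, rfl⟩⟩
  obtain ⟨n, hn⟩ := exists_nat_gt (max 1 (2 * D ^ 2))
  have hn1 : (1 : ℝ) < n := (le_max_left _ _).trans_lt hn
  have hn2 : 2 * D ^ 2 < n := (le_max_right _ _).trans_lt hn
  set Q : Polynomial ℂ := 1 + Polynomial.C ((n : ℂ)⁻¹) * ψ with hQ
  have hQev : ∀ z, Q.eval z = 1 + (n : ℂ)⁻¹ * ψ.eval z := by intro z; simp [hQ]
  set A : Set Circ := {x | ‖Q.eval (fourier 1 x : ℂ)‖ < 1} with hA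
  have hAc : hm Aᶜ ≤ ENNReal.ofReal (δ / 2) := by
    refine le_trans ?_ hm1.le
    have h0 := fourier_ne_one
    refine measure_mono_ae ?_
    filter_upwards [fourier_ne_one] with x hx hxA
    change ENNReal.ofReal (1 / 4) ≤ edist _ _
    by_contra hcon
    apply hxA
    rw [edist_dist, ENNReal.ofReal_le_ofReal_iff dist_nonneg, not_le, Complex.dist_eq] at hcon
    have hre := (Complex.abs_re_le_norm _).trans hcon.le
    rw [Complex.sub_re, re_half _ hx (circ_norm x), abs_le] at hre
    have hb := hD x
    change ‖_‖ < 1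
    rw [hQev]
    generalize (Polynomial.eval (fourier 1 x : ℂ) ψ) = w at *
    have hsq : ‖1 + (n : ℂ)⁻¹ * w‖ ^ 2 < 1 := by
      rw [← Complex.normSq_eq_norm_sq, Complex.normSq_add]
      have e1 : Complex.normSq ((n : ℂ)⁻¹ * w) = ((n : ℝ)⁻¹) ^ 2 * ‖w‖ ^ 2 := by
        rw [Complex.normSq_eq_norm_sq, norm_mul, norm_inv, Complex.norm_natCast]; ring
      have e2 : (1 * (starRingEnd ℂ) ((n : ℂ)⁻¹ * w)).re = (n : ℝ)⁻¹ * w.re := by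
        have : (n : ℂ)⁻¹ = (((n : ℝ)⁻¹ : ℝ) : ℂ) := by push_cast; rfl
        rw [one_mul, Complex.conj_re, this, Complex.re_ofReal_mul]
      rw [e1, e2, Complex.normSq_one]
      have hw : ‖w‖ ^ 2 ≤ D ^ 2 := by gcongr
      have hi : 0 < (n : ℝ)⁻¹ := by positivity
      have h5 : (n : ℝ)⁻¹ * D ^ 2 < 1 / 2 := by
        rw [inv_mul_lt_iff₀ (by positivity)]; linarith
      have h6 : (n : ℝ)⁻¹ * ((n : ℝ)⁻¹ * ‖w‖ ^ 2) < (n : ℝ)⁻¹ * (1 / 2) := by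
        gcongr
        exact lt_of_le_of_lt (by gcongr) h5
      have h7 : (n : ℝ)⁻¹ * w.re ≤ (n : ℝ)⁻¹ * (-1 / 4) := by
        gcongr; linarith [hre.2]
      nlinarith
    exact (sq_lt_one_iff₀ (norm_nonneg _)).1 hsq
  have hT2 := tendstoInMeasure_of_tendsto_ae (μ := hm.restrict A)
    (f := fun k (x : Circ) => (Q ^ k).eval (fourier 1 x : ℂ)) (g := fun _ => 0)
    (fun n => (poly_cont _).aestronglyMeasurable)
    (by
      refine (ae_restrict_iff' ?_).2 (Eventually.of_forall fun x hx => ?_)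
      · exact measurableSet_lt (poly_cont _).norm.measurable measurable_const
      · simp only [Polynomial.eval_pow]
        exact tendsto_pow_atTop_nhds_zero_of_norm_lt_one hx)
  obtain ⟨k, hk⟩ := ((hT2 (ENNReal.ofReal ε) (by simpa using hε)).eventually_lt_const hδ2).exists
  refine ⟨1 - Q ^ k, ?_, ?_⟩
  · simp [hQev, hψ, psi_zero]
  · have hsub : {x : Circ | ε ≤ ‖(1 - Q ^ k).eval (fourier 1 x : ℂ) - 1‖} ⊆
        ({x | ENNReal.ofReal ε ≤ edist ((Q ^ k).eval (fourier 1 x : ℂ)) 0} ∩ A) ∪ Aᶜ := by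
      intro x hx
      by_cases hxA : x ∈ A
      · refine Or.inl ⟨?_, hxA⟩
        have hx' : ε ≤ ‖(1 - Q ^ k).eval (fourier 1 x : ℂ) - 1‖ := hx
        change ENNReal.ofReal ε ≤ edist _ _
        rw [edist_zero_right, ← ofReal_norm]
        apply ENNReal.ofReal_le_ofReal
        rw [Polynomial.eval_sub, Polynomial.eval_one, sub_sub_cancel_left, norm_neg] at hx'
        exact hx'
      · exact Or.inr hxA
    calc _ ≤ _ := measure_mono hsub
      _ ≤ _ := measure_union_le _ _
      _ ≤ ENNReal.ofReal (δ / 2) + ENNReal.ofReal (δ / 2) := by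
        gcongr
        refine le_trans ?_ hk.le
        exact Measure.le_restrict_apply _ _
      _ = ENNReal.ofReal δ := by
        rw [← ENNReal.ofReal_add (by positivity) (by positivity)]; congr 1; ring

lemma exists_shift (I B : Set Circ) (hI : MeasurableSet I) (hB : MeasurableSet B) (M : ℤ) :
    ∃ s : Circ, hm (I ∩ {t | M • t + s ∈ B}) ≤ hm I * hm B := by
  set S : Set (Circ × Circ) := {p | p.2 ∈ I ∧ M • p.2 + p.1 ∈ B} with hS
  have hSm : MeasurableSet S := by
    refine (measurable_snd hI).inter ?_
    have : Continuous fun p : Circ × Circ => M • p.2 + p.1 := by fun_prop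
    exact this.measurable hB
  have h1 := Measure.prod_apply (μ := hm) (ν := hm) hSm
  have h2 := Measure.prod_apply_symm (μ := hm) (ν := hm) hSm
  have h3 : ∫⁻ t, hm ((fun s => (s, t)) ⁻¹' S) ∂hm = hm I * hm B := by
    have : ∀ t, hm ((fun s => (s, t)) ⁻¹' S) = I.indicator (fun _ => hm B) t := by
      intro t
      by_cases ht : t ∈ I
      · rw [Set.indicator_of_mem ht]
        have : ((fun s => (s, t)) ⁻¹' S) = (fun s => M • t + s) ⁻¹' B := by
          ext s; simp [hS, ht]
        rw [this, measure_preimage_add]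
      · rw [Set.indicator_of_notMem ht]
        have : ((fun s => (s, t)) ⁻¹' S) = ∅ := by
          ext s; simp [hS, ht]
        rw [this, measure_empty]
    simp_rw [this]
    rw [lintegral_indicator hI, setLIntegral_const, mul_comm]
  obtain ⟨s, hs⟩ := exists_le_lintegral (μ := hm) (f := fun s => hm (Prod.mk s ⁻¹' S))
    (measurable_measure_prodMk_left hSm).aemeasurable
  refine ⟨s, ?_⟩
  rw [← h3, ← h2, h1]
  exact hs

lemma exists_approx (q : ℝ≥0∞) (hq : 1 ≤ q) (hq' : q ≠ ∞) (u : Circ → ℂ) (hu : MemLp u q hm)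
    (τ : ℝ) (hτ : 0 < τ) : ∃ g ∈ sp Set.univ,
      eLpNorm (fun t => g t - u t) q hm ≤ ENNReal.ofReal τ := by
  have : Fact (1 ≤ q) := ⟨hq⟩
  have hd := span_fourierLp_closure_eq_top (T := 2 * π) (p := q) hq'
  have hmem : hu.toLp u ∈ closure ((Submodule.span ℂ (Set.range (@fourierLp (2 * π) _ q _)) : Set _)) := by
    rw [← Submodule.topologicalClosure_coe, hd]; trivial
  obtain ⟨v, hv, hdist⟩ := Metric.mem_closure_iff.1 hmem τ hτ
  have hr : Set.range (@fourierLp (2 * π) _ q _) =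
      (ContinuousMap.toLp (E := ℂ) q hm ℂ).toLinearMap ''
        ((fun n : ℤ => (fourier n : C(Circ, ℂ))) '' Set.univ) := by
    rw [Set.image_univ, ← Set.range_comp]; rfl
  rw [SetLike.mem_coe, hr, ← Submodule.map_span] at hv
  obtain ⟨g, hg, rfl⟩ := hv
  refine ⟨g, hg, ?_⟩
  rw [dist_comm, dist_eq_norm] at hdist
  have h1 : ENNReal.ofReal ‖ContinuousMap.toLp (E := ℂ) q hm ℂ g - hu.toLp u‖ ≤ ENNReal.ofReal τ :=
    ENNReal.ofReal_le_ofReal hdist.le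
  rw [ofReal_norm, Lp.enorm_def] at h1
  refine le_trans (le_of_eq ?_) h1
  refine eLpNorm_congr_ae ?_
  filter_upwards [Lp.coeFn_sub (ContinuousMap.toLp (E := ℂ) q hm ℂ g) (hu.toLp u),
    ContinuousMap.coeFn_toLp hm (𝕜 := ℂ) (p := q) g, hu.coeFn_toLp] with t h1 h2 h3
  rw [h1, Pi.sub_apply, h2, h3]

lemma sp_bdd {g : C(Circ, ℂ)} (hg : g ∈ sp Set.univ) : ∃ d : ℕ, g ∈ sp (Set.Ici (-(d : ℤ))) := by
  unfold sp at hg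
  induction hg using Submodule.span_induction with
  | mem x hx =>
    obtain ⟨n, -, rfl⟩ := hx
    exact ⟨n.natAbs, fourier_mem_sp (by simp only [Set.mem_Ici]; omega)⟩
  | zero => exact ⟨0, zero_mem _⟩
  | add x y _ _ hx hy =>
    obtain ⟨d, hd⟩ := hx
    obtain ⟨e, he⟩ := hy
    refine ⟨d + e, add_mem (sp_mono ?_ hd) (sp_mono ?_ he)⟩ <;>
    · intro i hi
      simp only [Set.mem_Ici] at *
      push_cast
      omega
  | smul a x _ hx =>
    obtain ⟨d, hd⟩ := hx
    exact ⟨d, Submodule.smul_mem _ _ hd⟩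

/-- The partial sum as a continuous map. -/
noncomputable def psum (c : ℕ → ℂ) (N : ℕ) : C(Circ, ℂ) :=
  ∑ k ∈ Finset.Icc 1 N, c k • (fourier (k : ℤ) : C(Circ, ℂ))

lemma psum_apply (c : ℕ → ℂ) (N : ℕ) (t : Circ) : psum c N t = analyticPartialSum c N t := by
  simp [psum, analyticPartialSum, ContinuousMap.sum_apply]

lemma psum_mem (c : ℕ → ℂ) (N : ℕ) : psum c N ∈ sp (Set.Iic (N : ℤ)) := by
  refine Submodule.sum_mem _ fun k hk => Submodule.smul_mem _ _ (fourier_mem_sp ?_)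
  have := (Finset.mem_Icc.1 hk).2
  simpa using this

lemma psum_tail (c : ℕ → ℂ) (N N1 : ℕ) (h : N ≤ N1) :
    psum c N1 - psum c N ∈ sp (Set.Ioi (N : ℤ)) := by
  have : psum c N1 - psum c N = ∑ k ∈ Finset.Icc 1 N1 \ Finset.Icc 1 N,
      c k • (fourier (k : ℤ) : C(Circ, ℂ)) := by
    rw [sub_eq_iff_eq_add]
    exact (Finset.sum_sdiff (Finset.Icc_subset_Icc_right h)).symm
  rw [this]
  refine Submodule.sum_mem _ fun k hk => Submodule.smul_mem _ _ (fourier_mem_sp ?_)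
  simp only [Finset.mem_sdiff, Finset.mem_Icc, Set.mem_Ioi] at *
  omega

lemma aps_eq_of_ge {c : ℕ → ℂ} {N1 N : ℕ} (h : ∀ k, N1 < k → c k = 0) (hN : N1 ≤ N) (t : Circ) :
    analyticPartialSum c N t = analyticPartialSum c N1 t := by
  unfold analyticPartialSum
  symm
  apply Finset.sum_subset (Finset.Icc_subset_Icc_right hN)
  intro k hk hk'
  simp only [Finset.mem_Icc] at *
  rw [h k (by omega), zero_mul]

lemma aps_eq_zero {c : ℕ → ℂ} {N0 N : ℕ} (h : ∀ k, k ≤ N0 → c k = 0) (hN : N ≤ N0) (t : Circ) :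
    analyticPartialSum c N t = 0 := by
  unfold analyticPartialSum
  apply Finset.sum_eq_zero
  intro k hk
  simp only [Finset.mem_Icc] at *
  rw [h k (by omega), zero_mul]

lemma aps_add (c d : ℕ → ℂ) (N : ℕ) (t : Circ) :
    analyticPartialSum (c + d) N t = analyticPartialSum c N t + analyticPartialSum d N t := by
  simp only [analyticPartialSum, Pi.add_apply, add_mul, Finset.sum_add_distrib]

lemma exists_coeff (N0 : ℕ) {P : C(Circ, ℂ)} (hP : P ∈ sp (Set.Ioi (N0 : ℤ))) :
    ∃ (c : ℕ → ℂ) (N1 : ℕ), N0 ≤ N1 ∧ (∀ k, k ≤ N0 → c k = 0) ∧ (∀ k, N1 < k → c k = 0) ∧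
      ∀ t, analyticPartialSum c N1 t = P t := by
  unfold sp at hP
  induction hP using Submodule.span_induction with
  | mem x hx =>
    obtain ⟨n, hn, rfl⟩ := hx
    simp only [Set.mem_Ioi] at hn
    lift n to ℕ using by omega
    refine ⟨Pi.single n 1, n, by omega, fun k hk => Pi.single_eq_of_ne (by omega) _,
      fun k hk => Pi.single_eq_of_ne (by omega) _, fun t => ?_⟩
    unfold analyticPartialSum
    rw [Finset.sum_eq_single n]
    · simp
    · intro k _ hk
      rw [Pi.single_eq_of_ne hk, zero_mul]
    · intro h
      simp only [Finset.mem_Icc] at h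
      omega
  | zero => exact ⟨0, N0, le_rfl, fun _ _ => rfl, fun _ _ => rfl, fun t => by simp [analyticPartialSum]⟩
  | add x y _ _ hx hy =>
    obtain ⟨c, N1, h1, h2, h3, h4⟩ := hx
    obtain ⟨d, N2, g1, g2, g3, g4⟩ := hy
    refine ⟨c + d, max N1 N2, by omega, fun k hk => ?_, fun k hk => ?_, fun t => ?_⟩
    · simp [h2 k hk, g2 k hk]
    · simp [h3 k (by omega), g3 k (by omega)]
    · rw [aps_add, aps_eq_of_ge h3 (le_max_left _ _), aps_eq_of_ge g3 (le_max_right _ _), h4, g4]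
      rfl
  | smul a x _ hx =>
    obtain ⟨c, N1, h1, h2, h3, h4⟩ := hx
    refine ⟨a • c, N1, h1, fun k hk => ?_, fun k hk => ?_, fun t => ?_⟩
    · simp [h2 k hk]
    · simp [h3 k hk]
    · rw [ContinuousMap.smul_apply, ← h4]
      simp [analyticPartialSum, Finset.mul_sum, mul_assoc]

/-- The function `t ↦ h (e^{i (M t + s)})`. -/
noncomputable def hcomp (h : Polynomial ℂ) (M : ℕ) (s : Circ) : C(Circ, ℂ) :=
  ⟨fun t => h.eval (fourier 1 ((M : ℤ) • t + s) : ℂ), (poly_cont h).comp (by fun_prop)⟩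

lemma hcomp_mem (h : Polynomial ℂ) (h0 : h.eval 0 = 0) (M : ℕ) (s : Circ) :
    hcomp h M s ∈ sp (Set.Ici (M : ℤ)) := by
  have : hcomp h M s = ∑ j ∈ Finset.range (h.natDegree + 1),
      (h.coeff j * (fourier 1 s : ℂ) ^ j) • (fourier ((j * M : ℕ) : ℤ) : C(Circ, ℂ)) := by
    ext t
    rw [ContinuousMap.sum_apply]
    change h.eval _ = _
    rw [Polynomial.eval_eq_sum_range]
    refine Finset.sum_congr rfl fun j _ => ?_
    rw [ContinuousMap.smul_apply, smul_eq_mul, mul_assoc]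
    congr 1
    simp only [fourier_apply, one_smul]
    rw [AddCircle.toCircle_add, Circle.coe_mul, mul_pow, mul_comm]
    congr 1
    rw [← Circle.coe_pow, ← AddCircle.toCircle_nsmul]
    congr 2
    rw [natCast_zsmul, natCast_zsmul, mul_smul]
  rw [this]
  refine Submodule.sum_mem _ fun j _ => ?_
  rcases Nat.eq_zero_or_pos j with rfl | hj
  · rw [Polynomial.coeff_zero_eq_eval_zero, h0, zero_mul, zero_smul]
    exact zero_mem _
  · refine Submodule.smul_mem _ _ (fourier_mem_sp ?_)
    simp only [Set.mem_Ici]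
    exact_mod_cast Nat.le_mul_of_pos_left M hj

/-- The inductive predicate: `f` can be represented on `I` at a small cost. -/
def Good (q : ℝ≥0∞) (f : Circ → ℂ) (ε δ κ : ℝ) (I : Set Circ) : Prop :=
  ∀ (N0 : ℕ) (τ : ℝ), 0 < τ → ∃ (c : ℕ → ℂ) (N1 : ℕ) (E : Set Circ), N0 ≤ N1 ∧
    (∀ k, k ≤ N0 → c k = 0) ∧ (∀ k, N1 < k → c k = 0) ∧ MeasurableSet E ∧
    hm Eᶜ ≤ ENNReal.ofReal δ * hm I + ENNReal.ofReal τ ∧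
    (∀ t ∈ E, ‖analyticPartialSum c N1 t - I.indicator f t‖ ≤ ε * ‖I.indicator f t‖ + τ) ∧
    ∀ N, ∃ R : Circ → ℂ, AEStronglyMeasurable R hm ∧ eLpNorm R q hm ≤ ENNReal.ofReal κ ∧
      ∀ t ∈ E, ‖analyticPartialSum c N t‖ ≤ (1 + ε) * ‖I.indicator f t‖ + τ + ‖R t‖

lemma good_piece (m : ℕ) (ε δ : ℝ) (hε : 0 < ε) (hδ : 0 < δ) : ∃ D : ℝ, 0 < D ∧
    ∀ (f : Circ → ℂ) (I : Set Circ) (κ : ℝ), Measurable f → MeasurableSet I → 0 < κ →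
      eLpNorm (I.indicator f) (2 ^ (m + 1)) hm ≤ ENNReal.ofReal (κ / (2 * D)) →
      Good (2 ^ (m + 1)) f ε δ κ I := by
  obtain ⟨C, hC⟩ := riesz m
  obtain ⟨h, h0, hB⟩ := exists_h ε δ hε hδ
  set q : ℝ≥0∞ := 2 ^ (m + 1) with hqdef
  have hq1 : 1 ≤ q := one_le_pow₀ (by norm_num)
  have hqt : q ≠ ∞ := ENNReal.pow_ne_top (by norm_num)
  obtain ⟨H, hH⟩ : ∃ H : ℝ, ∀ x : Circ, ‖h.eval (fourier 1 x : ℂ)‖ ≤ H := by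
    obtain ⟨D, hD⟩ := (isCompact_range (poly_cont h)).isBounded.exists_norm_le
    exact ⟨D, fun x => hD _ ⟨x, rfl⟩⟩
  have hH0 : 0 ≤ H := (norm_nonneg _).trans (hH 0)
  set D : ℝ := (C + 1) * (H + 1) with hD
  have hDpos : 0 < D := by positivity
  refine ⟨D, hDpos, fun f I κ hf hI hκ hn N0 τ hτ => ?_⟩
  set u : Circ → ℂ := I.indicator f with hu
  have hum : Measurable u := hf.indicator hI
  have huL : MemLp u q hm := ⟨hum.aestronglyMeasurable, hn.trans_lt ENNReal.ofReal_lt_top⟩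
  set η : ℝ := τ / (1 + ε + H) with hη
  have hηpos : 0 < η := by positivity
  have hητ : η * (1 + ε + H) = τ := by rw [hη]; field_simp
  obtain ⟨g, hg, hgu⟩ := exists_approx q hq1 hqt u huL (min (η * τ) (κ / (2 * D))) (by positivity)
  obtain ⟨d, hd⟩ := sp_bdd hg
  set M : ℕ := d + N0 + 1 with hM
  set B : Set Circ := {x | ε ≤ ‖h.eval (fourier 1 x : ℂ) - 1‖} with hBdef
  have hBm : MeasurableSet B := measurableSet_le measurable_const
    ((poly_cont h).sub continuous_const).norm.measurable
  obtain ⟨s, hs⟩ := exists_shift I B hI hBm M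
  set P : C(Circ, ℂ) := hcomp h M s * g with hP
  have hPmem : P ∈ sp (Set.Ioi (N0 : ℤ)) := by
    refine sp_mul (fun i hi j hj => ?_) (hcomp_mem h h0 M s) hd
    simp only [Set.mem_Ici, Set.mem_Ioi] at *
    omega
  obtain ⟨c, N1, hN1, hc0, hc1, hcP⟩ := exists_coeff N0 hPmem
  have hPn : eLpNorm P q hm ≤ ENNReal.ofReal H * eLpNorm g q hm := by
    refine eLpNorm_le_mul_eLpNorm_of_ae_le_mul (Eventually.of_forall fun t => ?_) q
    rw [hP, ContinuousMap.mul_apply, norm_mul]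
    gcongr
    exact hH _
  have hgn : eLpNorm g q hm ≤ ENNReal.ofReal (κ / D) := by
    have e : (g : Circ → ℂ) = (fun t => g t - u t) + u := by ext t; simp
    calc eLpNorm g q hm = eLpNorm ((fun t => g t - u t) + u) q hm := by rw [← e]
      _ ≤ _ := eLpNorm_add_le ((cm_meas g).sub hum.aestronglyMeasurable) hum.aestronglyMeasurable hq1
      _ ≤ ENNReal.ofReal (κ / (2 * D)) + ENNReal.ofReal (κ / (2 * D)) := by
        gcongr
        exact hgu.trans (ENNReal.ofReal_le_ofReal (min_le_right _ _))
      _ = _ := by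
        rw [← ENNReal.ofReal_add (by positivity) (by positivity)]; congr 1; field_simp; ring
  have hS : ∀ N, eLpNorm (psum c N) q hm ≤ ENNReal.ofReal κ := by
    intro N
    have h1 : eLpNorm (psum c N) q hm ≤ C * eLpNorm P q hm := by
      set N2 := max N N1
      have h2 := hC N _ (psum_tail c N N2 (le_max_left _ _)) _ (psum_mem c N)
      have h3 : psum c N2 - psum c N + psum c N = P := by
        ext t
        rw [sub_add_cancel, psum_apply, aps_eq_of_ge hc1 (le_max_right _ _), hcP]
      rwa [h3] at h2
    calc _ ≤ _ := h1
      _ ≤ C * (ENNReal.ofReal H * ENNReal.ofReal (κ / D)) := by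
        gcongr
        exact hPn.trans (by gcongr)
      _ = ENNReal.ofReal (C * (H * (κ / D))) := by
        rw [ENNReal.ofReal_mul (by positivity), ENNReal.ofReal_mul (by positivity), ENNReal.ofReal_coe_nnreal]
      _ ≤ _ := by
        apply ENNReal.ofReal_le_ofReal
        rw [← mul_assoc, ← mul_div_assoc, div_le_iff₀ hDpos, hD, mul_comm]
        have hC0 : (0 : ℝ) ≤ C := C.2
        gcongr <;> linarith
  set E1 : Set Circ := {t | η ≤ ‖g t - u t‖} with hE1
  have hE1m : MeasurableSet E1 := measurableSet_le measurable_const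
    (g.continuous.measurable.sub hum).norm
  set E2 : Set Circ := I ∩ {t | (M : ℤ) • t + s ∈ B} with hE2
  have hE2m : MeasurableSet E2 := by
    refine hI.inter ?_
    have : Continuous fun t : Circ => (M : ℤ) • t + s := by fun_prop
    exact this.measurable hBm
  have hE1n : hm E1 ≤ ENNReal.ofReal τ := by
    have h1 := mul_meas_ge_le_pow_eLpNorm' hm one_ne_zero ENNReal.one_ne_top
      ((cm_meas g).sub hum.aestronglyMeasurable) (ENNReal.ofReal η)
    have h2 := eLpNorm_le_eLpNorm_of_exponent_le hq1 ((cm_meas g).sub hum.aestronglyMeasurable)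
    simp only [ENNReal.toReal_one, ENNReal.rpow_one] at h1
    have h3 : ENNReal.ofReal η * hm E1 ≤ ENNReal.ofReal η * ENNReal.ofReal τ := by
      rw [← ENNReal.ofReal_mul hηpos.le]
      refine le_trans ?_ ((h1.trans h2).trans (hgu.trans (ENNReal.ofReal_le_ofReal (min_le_left _ _))))
      gcongr
      intro t ht
      have ht' : η ≤ ‖g t - u t‖ := ht
      change ENNReal.ofReal η ≤ ‖g t - u t‖ₑ
      rw [← ofReal_norm]
      exact ENNReal.ofReal_le_ofReal ht'
    rwa [ENNReal.mul_le_mul_iff_right (by simpa using hηpos) ENNReal.ofReal_ne_top] at h3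
  refine ⟨c, N1, (E1 ∪ E2)ᶜ, hN1, hc0, hc1, (hE1m.union hE2m).compl, ?_, ?_, ?_⟩
  · rw [compl_compl]
    refine (measure_union_le _ _).trans ?_
    rw [add_comm]
    gcongr
    refine hs.trans ?_
    rw [mul_comm]
    gcongr
  · intro t ht
    rw [Set.mem_compl_iff, Set.mem_union, not_or] at ht
    obtain ⟨ht1, ht2⟩ := ht
    have hgt : ‖g t - u t‖ < η := not_le.1 ht1
    rw [hcP]
    have hPt : P t = h.eval (fourier 1 ((M : ℤ) • t + s) : ℂ) * g t := rfl
    have hbd := hH ((M : ℤ) • t + s)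
    by_cases htI : t ∈ I
    · have hB' : ‖h.eval (fourier 1 ((M : ℤ) • t + s) : ℂ) - 1‖ < ε := not_le.1 fun hh => ht2 ⟨htI, hh⟩
      rw [hPt]
      generalize h.eval (fourier 1 ((M : ℤ) • t + s) : ℂ) = w at *
      have e : w * g t - u t = (w - 1) * g t + (g t - u t) := by ring
      have hg2 : ‖g t‖ ≤ ‖u t‖ + η := by
        have : g t = u t + (g t - u t) := by ring
        rw [this]
        exact (norm_add_le _ _).trans (by linarith)
      calc ‖w * g t - u t‖ ≤ ‖w - 1‖ * ‖g t‖ + ‖g t - u t‖ := by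
            rw [e, ← norm_mul]; exact norm_add_le _ _
        _ ≤ ε * (‖u t‖ + η) + η := by gcongr
        _ ≤ ε * ‖u t‖ + τ := by nlinarith
    · have hut : u t = 0 := Set.indicator_of_notMem htI _
      rw [hut, sub_zero] at hgt ⊢
      rw [hPt, norm_mul]
      have : ‖h.eval (fourier 1 ((M : ℤ) • t + s) : ℂ)‖ * ‖g t‖ ≤ H * η := by gcongr
      simp only [norm_zero, mul_zero, zero_add]
      nlinarith
  · intro N
    refine ⟨psum c N, cm_meas _, hS N, fun t _ => ?_⟩
    rw [psum_apply]
    have : 0 ≤ (1 + ε) * ‖u t‖ := by positivity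
    linarith

lemma aps_meas (c : ℕ → ℂ) (N : ℕ) : Measurable (analyticPartialSum c N) := by
  have : analyticPartialSum c N = psum c N := by ext t; rw [psum_apply]
  rw [this]
  exact (psum c N).continuous.measurable

lemma good_empty (q : ℝ≥0∞) (f : Circ → ℂ) (ε δ κ : ℝ) : Good q f ε δ κ ∅ := by
  intro N0 τ hτ
  refine ⟨0, N0, Set.univ, le_rfl, fun _ _ => rfl, fun _ _ => rfl, MeasurableSet.univ, by simp,
    fun t _ => ?_, fun N => ⟨0, aestronglyMeasurable_zero, by simp, fun t _ => ?_⟩⟩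
  · simp [analyticPartialSum, hτ.le]
  · simp [analyticPartialSum, hτ.le]

lemma good_union {q : ℝ≥0∞} {f : Circ → ℂ} {ε δ κ : ℝ} (hε : 0 < ε) {I J : Set Circ}
    (hJ : MeasurableSet J) (hd : Disjoint I J) (h1 : Good q f ε δ κ I) (h2 : Good q f ε δ κ J) :
    Good q f ε δ κ (I ∪ J) := by
  intro N0 τ hτ
  obtain ⟨c, N1, E, a1, a2, a3, a4, a5, a6, a7⟩ := h1 N0 (τ / 2) (by positivity)
  obtain ⟨d, N2, F, b1, b2, b3, b4, b5, b6, b7⟩ := h2 N1 (τ / 2) (by positivity)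
  have hind : ∀ t, (I ∪ J).indicator f t = I.indicator f t + J.indicator f t := by
    intro t; rw [Set.indicator_union_of_disjoint hd]
  have hnorm : ∀ t, ‖(I ∪ J).indicator f t‖ = ‖I.indicator f t‖ + ‖J.indicator f t‖ := by
    intro t
    rw [hind]
    by_cases ht : t ∈ I
    · rw [Set.indicator_of_notMem (Set.disjoint_left.1 hd ht)]; simp
    · rw [Set.indicator_of_notMem ht]; simp
  refine ⟨c + d, N2, E ∩ F, a1.trans b1, fun k hk => ?_, fun k hk => ?_, a4.inter b4, ?_, ?_, ?_⟩
  · simp [a2 k hk, b2 k (hk.trans a1)]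
  · simp [a3 k (b1.trans_lt hk), b3 k hk]
  · rw [Set.compl_inter, measure_union hd hJ]
    refine (measure_union_le _ _).trans ((add_le_add a5 b5).trans (le_of_eq ?_))
    have : ENNReal.ofReal τ = ENNReal.ofReal (τ / 2) + ENNReal.ofReal (τ / 2) := by
      rw [← ENNReal.ofReal_add (by positivity) (by positivity)]; congr 1; ring
    rw [this]; ring
  · intro t ht
    rw [aps_add, aps_eq_of_ge a3 b1, hnorm, hind]
    have e1 := a6 t ht.1
    have e2 := b6 t ht.2
    have e3 : analyticPartialSum c N1 t + analyticPartialSum d N2 t -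
        (I.indicator f t + J.indicator f t) = (analyticPartialSum c N1 t - I.indicator f t) +
        (analyticPartialSum d N2 t - J.indicator f t) := by ring
    rw [e3]
    refine (norm_add_le _ _).trans ?_
    linarith
  · intro N
    rcases le_total N N1 with hN | hN
    · obtain ⟨R, r1, r2, r3⟩ := a7 N
      refine ⟨R, r1, r2, fun t ht => ?_⟩
      rw [aps_add, aps_eq_zero b2 hN, add_zero, hnorm]
      have := r3 t ht.1
      have h0 : 0 ≤ (1 + ε) * ‖J.indicator f t‖ := by positivity
      linarith
    · obtain ⟨R, r1, r2, r3⟩ := b7 N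
      refine ⟨R, r1, r2, fun t ht => ?_⟩
      rw [aps_add, aps_eq_of_ge a3 hN, hnorm]
      have e1 := a6 t ht.1
      have e2 := r3 t ht.2
      have e3 : ‖analyticPartialSum c N1 t‖ ≤ ‖I.indicator f t‖ +
          ‖analyticPartialSum c N1 t - I.indicator f t‖ := by
        have := norm_add_le (I.indicator f t) (analyticPartialSum c N1 t - I.indicator f t)
        rwa [add_sub_cancel] at this
      refine (norm_add_le _ _).trans ?_
      linarith

lemma hm_singleton (x : Circ) : hm ({x} : Set Circ) = 0 := by
  have h1 : (volume : Measure Circ) {x} = 0 := by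
    have := AddCircle.volume_closedBall (T := 2 * π) (x := x) 0
    simpa using this
  rw [AddCircle.volume_eq_smul_haarAddCircle, Measure.smul_apply, smul_eq_mul, mul_eq_zero] at h1
  rcases h1 with h1 | h1
  · exfalso
    have : 0 < 2 * π := by positivity
    simp only [ENNReal.ofReal_eq_zero] at h1
    linarith
  · exact h1

lemma exists_level (f : Circ → ℂ) (hf : Measurable f) (ε : ℝ) (hε : 0 < ε) :
    ∃ L : ℕ, hm {t | ‖f t‖ ≤ L}ᶜ ≤ ENNReal.ofReal ε := by
  have h := tendsto_measure_iInter_atTop (μ := hm) (s := fun n : ℕ => {t | ‖f t‖ ≤ n}ᶜ)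
    (fun n => (measurableSet_le hf.norm measurable_const).compl.nullMeasurableSet)
    (fun i j hij t ht => by
      simp only [Set.mem_compl_iff, Set.mem_ofPred_eq, not_le] at *
      exact lt_of_le_of_lt (by exact_mod_cast hij) ht) ⟨0, measure_ne_top _ _⟩
  have he : ⋂ n : ℕ, {t | ‖f t‖ ≤ n}ᶜ = (∅ : Set Circ) := by
    ext t
    obtain ⟨n, hn⟩ := exists_nat_ge ‖f t‖
    simp only [Set.mem_iInter, Set.mem_compl_iff, Set.mem_ofPred_eq, Set.mem_empty_iff_false,
      iff_false, not_forall, not_not]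
    exact ⟨n, hn⟩
  rw [he, measure_empty] at h
  obtain ⟨n, hn⟩ := (h.eventually_lt_const (u := ENNReal.ofReal ε) (by simpa using hε)).exists
  exact ⟨n, hn.le⟩

lemma step (m : ℕ) (f : Circ → ℂ) (hf : Measurable f) (ε : ℝ) (hε : 0 < ε) (N0 : ℕ) :
    ∃ (c : ℕ → ℂ) (N1 : ℕ) (E : Set Circ), N0 < N1 ∧
    (∀ k, k ≤ N0 → c k = 0) ∧ (∀ k, N1 < k → c k = 0) ∧ MeasurableSet E ∧
    hm Eᶜ ≤ ENNReal.ofReal ε ∧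
    (∀ t ∈ E, ‖analyticPartialSum c N1 t - f t‖ ≤ ε) ∧
    ∀ N, ∃ R : Circ → ℂ, AEStronglyMeasurable R hm ∧
      eLpNorm R (2 ^ (m + 1)) hm ≤ ENNReal.ofReal ε ∧
      ∀ t ∈ E, ‖analyticPartialSum c N t‖ ≤ 2 * ‖f t‖ + ε + ‖R t‖ := by
  obtain ⟨L, hL⟩ := exists_level f hf (ε / 4) (by positivity)
  set A : Set Circ := {t | ‖f t‖ ≤ L} with hA
  have hAm : MeasurableSet A := measurableSet_le hf.norm measurable_const
  set ε' : ℝ := min 1 (ε / (2 * (L + 1))) with hε'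
  have hε'pos : 0 < ε' := by positivity
  obtain ⟨D, hD, hpiece⟩ := good_piece m ε' (ε / 4) hε'pos (by positivity)
  set q : ℝ≥0∞ := 2 ^ (m + 1) with hqdef
  have hq1 : 1 ≤ q := one_le_pow₀ (by norm_num)
  have hqt : q ≠ ∞ := ENNReal.pow_ne_top (by norm_num)
  have hAL : MemLp (A.indicator f) q hm := by
    refine MemLp.of_bound (hf.indicator hAm).aestronglyMeasurable (L : ℝ) (Eventually.of_forall fun t => ?_)
    by_cases ht : t ∈ A
    · rw [Set.indicator_of_mem ht]; exact ht
    · rw [Set.indicator_of_notMem ht]; simp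
  obtain ⟨δ0, hδ0, hsmall⟩ := hAL.eLpNorm_indicator_le hq1 hqt (ε := ε / (2 * D)) (by positivity)
  have hgood : Good q f ε' (ε / 4) ε (A ∩ Set.univ) := by
    have key : ∃ S : Set Circ, Set.univ ⊆ S ∧ MeasurableSet S ∧
        ∀ J ⊆ S, MeasurableSet J → Good q f ε' (ε / 4) ε (A ∩ J) := by
      refine isCompact_univ.induction_on (p := fun s => ∃ S : Set Circ, s ⊆ S ∧ MeasurableSet S ∧
        ∀ J ⊆ S, MeasurableSet J → Good q f ε' (ε / 4) ε (A ∩ J)) ?_ ?_ ?_ ?_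
      · refine ⟨∅, Set.Subset.rfl, MeasurableSet.empty, fun J hJ _ => ?_⟩
        rw [Set.subset_empty_iff.1 hJ, Set.inter_empty]
        exact good_empty _ _ _ _ _
      · rintro s t hst ⟨S, hS, h⟩
        exact ⟨S, hst.trans hS, h⟩
      · rintro s t ⟨S, hS, hSm, h⟩ ⟨T, hT, hTm, h'⟩
        refine ⟨S ∪ T, Set.union_subset_union hS hT, hSm.union hTm, fun J hJ hJm => ?_⟩
        have e : A ∩ J = (A ∩ (J ∩ S)) ∪ (A ∩ (J \ S)) := by
          rw [← Set.inter_union_distrib_left, Set.inter_union_sdiff]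
        rw [e]
        refine good_union hε'pos (hAm.inter (hJm.diff hSm)) ?_
          (h _ Set.inter_subset_right (hJm.inter hSm)) (h' _ ?_ (hJm.diff hSm))
        · rw [Set.disjoint_left]
          rintro x ⟨_, _, hx⟩ ⟨_, _, hx'⟩
          exact hx' hx
        · rintro x ⟨hx, hx'⟩
          exact (hJ hx).resolve_left hx'
      · intro x _
        obtain ⟨U, hxU, hU, hUm⟩ := Set.exists_isOpen_lt_of_lt ({x} : Set Circ) (ENNReal.ofReal δ0)
          (μ := hm) (by rw [hm_singleton]; simpa using hδ0)
        refine ⟨U, mem_nhdsWithin_of_mem_nhds (hU.mem_nhds (hxU rfl)), U, Set.Subset.rfl, hU.measurableSet,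
          fun J hJ hJm => ?_⟩
        refine hpiece f (A ∩ J) ε hf (hAm.inter hJm) hε ?_
        rw [Set.inter_comm, ← Set.indicator_indicator]
        exact hsmall J hJm ((measure_mono hJ).trans hUm.le)
    obtain ⟨S, hS, -, h⟩ := key
    exact h _ hS MeasurableSet.univ
  rw [Set.inter_univ] at hgood
  obtain ⟨c, N1, E, a1, a2, a3, a4, a5, a6, a7⟩ := hgood N0 (ε / 2) (by positivity)
  have hmul : ε' * L ≤ ε / 2 := by
    have h1 : ε' ≤ ε / (2 * (L + 1)) := min_le_right _ _
    calc ε' * L ≤ ε / (2 * (L + 1)) * (L + 1) := by gcongr; linarith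
      _ = ε / 2 := by field_simp
  refine ⟨c, N1 + 1, E ∩ A, by omega, a2, fun k hk => a3 k (by omega), a4.inter hAm, ?_, ?_, ?_⟩
  · rw [Set.compl_inter]
    refine (measure_union_le _ _).trans ((add_le_add a5 hL).trans ?_)
    calc _ ≤ ENNReal.ofReal (ε / 4) * 1 + ENNReal.ofReal (ε / 2) + ENNReal.ofReal (ε / 4) := by
          gcongr
          exact prob_le_one
      _ = ENNReal.ofReal ε := by
          rw [mul_one, ← ENNReal.ofReal_add (by positivity) (by positivity),
            ← ENNReal.ofReal_add (by positivity) (by positivity)]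
          congr 1; ring
  · intro t ht
    rw [aps_eq_of_ge a3 (Nat.le_succ _)]
    have := a6 t ht.1
    rw [Set.indicator_of_mem ht.2] at this
    have h2 : ‖f t‖ ≤ L := ht.2
    nlinarith
  · intro N
    obtain ⟨R, r1, r2, r3⟩ := a7 N
    refine ⟨R, r1, r2, fun t ht => ?_⟩
    have := r3 t ht.1
    rw [Set.indicator_of_mem ht.2] at this
    have h1 : ε' ≤ 1 := min_le_left _ _
    nlinarith [norm_nonneg (f t)]

lemma eLpNorm_final {q : ℝ≥0∞} (hq : 1 ≤ q) {K : Set Circ} {F R : Circ → ℂ} {a b : ℝ} (ha : 0 ≤ a) (hb : 0 ≤ b)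
    (hK : MeasurableSet K) (hR : AEStronglyMeasurable R hm)
    (hRn : eLpNorm R q hm ≤ ENNReal.ofReal b) (h : ∀ t ∈ K, ‖F t‖ ≤ a + ‖R t‖) :
    eLpNorm (K.indicator F) q hm ≤ ENNReal.ofReal (a + b) := by
  have h1 : eLpNorm (K.indicator F) q hm ≤ eLpNorm ((fun _ => a) + fun t => ‖R t‖) q hm := by
    refine eLpNorm_mono_real fun t => ?_
    by_cases ht : t ∈ K
    · rw [Set.indicator_of_mem ht]; exact h t ht
    · rw [Set.indicator_of_notMem ht, norm_zero]
      exact add_nonneg ha (norm_nonneg _)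
  refine h1.trans ((eLpNorm_add_le aestronglyMeasurable_const hR.norm hq).trans ?_)
  rw [ENNReal.ofReal_add ha hb, eLpNorm_norm]
  refine add_le_add ?_ hRn
  rw [eLpNorm_const _ (zero_lt_one.trans_le hq).ne' (NeZero.ne _), measure_univ, ENNReal.one_rpow, mul_one,
    Real.enorm_of_nonneg ha]

lemma tendsto_integral_of_eLpNorm {p : ℝ} (hp : 1 ≤ p) {q : ℝ≥0∞} (hpq : ENNReal.ofReal p ≤ q)
    {K : Set Circ} (hK : MeasurableSet K) {F : ℕ → Circ → ℂ} (hF : ∀ N, Measurable (F N))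
    (h : Tendsto (fun N => eLpNorm (K.indicator (F N)) q hm) atTop (𝓝 0)) :
    Tendsto (fun N => ∫ t in K, ‖F N t‖ ^ p ∂volume) atTop (𝓝 0) := by
  have hp0 : 0 < p := by linarith
  have h1 : Tendsto (fun N => eLpNorm (K.indicator (F N)) (ENNReal.ofReal p) hm) atTop (𝓝 0) :=
    tendsto_of_tendsto_of_tendsto_of_le_of_le tendsto_const_nhds h (fun _ => zero_le)
      (fun N => eLpNorm_le_eLpNorm_of_exponent_le hpq ((hF N).indicator hK).aestronglyMeasurable)
  have h2 : Tendsto (fun N => ENNReal.ofReal (2 * π) *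
      (eLpNorm (K.indicator (F N)) (ENNReal.ofReal p) hm) ^ p) atTop (𝓝 0) := by
    have := ENNReal.Tendsto.const_mul (a := ENNReal.ofReal (2 * π)) (h1.ennrpow_const p) (Or.inr ENNReal.ofReal_ne_top)
    simpa [ENNReal.zero_rpow_of_pos hp0] using this
  have h3 := (ENNReal.tendsto_toReal ENNReal.zero_ne_top).comp h2
  rw [ENNReal.toReal_zero] at h3
  refine h3.congr fun N => ?_
  rw [Function.comp_apply, integral_eq_lintegral_of_nonneg_ae
    (Eventually.of_forall fun t => by positivity)
    ((hF N).norm.pow_const p).aestronglyMeasurable]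
  congr 1
  rw [AddCircle.volume_eq_smul_haarAddCircle, Measure.restrict_smul, lintegral_smul_measure, smul_eq_mul]
  congr 1
  rw [eLpNorm_indicator_eq_eLpNorm_restrict hK, eLpNorm_eq_lintegral_rpow_enorm_toReal (by simpa using hp0)
    ENNReal.ofReal_ne_top, ENNReal.toReal_ofReal hp0.le, ← ENNReal.rpow_mul, one_div,
    inv_mul_cancel₀ hp0.ne', ENNReal.rpow_one]
  refine lintegral_congr fun t => ?_
  rw [← ofReal_norm, ENNReal.ofReal_rpow_of_nonneg (norm_nonneg _) hp0.le]

lemma main_aux (m : ℕ) (f : Circ → ℂ) (hf : Measurable f) :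
    ∃ (c : ℕ → ℂ) (E : ℕ → Set Circ), (∀ n, MeasurableSet (E n)) ∧
      (∀ n, hm (E n)ᶜ ≤ ENNReal.ofReal ((1 / 2) ^ n)) ∧
      ∀ n, ∀ K ⊆ ⋂ j ≥ n, E j, MeasurableSet K →
        Tendsto (fun N => eLpNorm (K.indicator fun t => analyticPartialSum c N t - f t) (2 ^ (m + 1)) hm)
          atTop (𝓝 0) := by
  have hstep := fun (C : ℕ → ℂ) (N0 j : ℕ) => step m (fun t => f t - analyticPartialSum C N0 t)
    (hf.sub (aps_meas _ _)) ((1 / 2) ^ j) (by positivity) N0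
  choose d N1 E a1 a2 a3 a4 a5 a6 a7 using hstep
  let s : ℕ → (ℕ → ℂ) × ℕ := fun j => Nat.rec (0, 0)
    (fun j x => (x.1 + d x.1 x.2 j, N1 x.1 x.2 j)) j
  set Cf : ℕ → ℕ → ℂ := fun j => (s j).1 with hCf
  set Nf : ℕ → ℕ := fun j => (s j).2 with hNf
  have hC0 : Cf 0 = 0 := rfl
  have hCs : ∀ j, Cf (j + 1) = Cf j + d (Cf j) (Nf j) j := fun _ => rfl
  have hNs : ∀ j, Nf (j + 1) = N1 (Cf j) (Nf j) j := fun _ => rfl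
  clear_value Cf Nf
  clear hCf hNf s
  have hmono : StrictMono Nf := strictMono_nat_of_lt_succ fun j => by rw [hNs]; exact a1 _ _ _
  have hsupp : ∀ j k, Nf j < k → Cf j k = 0 := by
    intro j
    induction j with
    | zero => intro k _; rw [hC0]; rfl
    | succ j ih =>
      intro k hk
      have h2 := hmono (Nat.lt_succ_self j)
      rw [hCs, Pi.add_apply, ih k (lt_trans h2 hk), a3 _ _ _ k (by rw [← hNs]; exact hk), add_zero]
  have hstab : ∀ j i k, k ≤ Nf j → Cf (j + i) k = Cf j k := by
    intro j i k hk
    induction i with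
    | zero => rfl
    | succ i ih =>
      rw [← add_assoc, hCs, Pi.add_apply, ih,
        a2 _ _ _ k (hk.trans (hmono.monotone (Nat.le_add_right _ _))), add_zero]
  set c : ℕ → ℂ := fun k => Cf k k with hc
  have hcC : ∀ j k, k ≤ Nf j → c k = Cf j k := by
    intro j k hk
    change Cf k k = Cf j k
    rcases le_total j k with h | h
    · obtain ⟨i, rfl⟩ := Nat.exists_eq_add_of_le h
      exact hstab j i _ hk
    · obtain ⟨i, rfl⟩ := Nat.exists_eq_add_of_le h
      exact (hstab k i _ (hmono.le_apply)).symm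
  have hS : ∀ j N t, Nf j ≤ N → N ≤ Nf (j + 1) → analyticPartialSum c N t =
      analyticPartialSum (Cf j) (Nf j) t + analyticPartialSum (d (Cf j) (Nf j) j) N t := by
    intro j N t h1 h2
    have e : analyticPartialSum c N t = analyticPartialSum (Cf (j + 1)) N t := by
      unfold analyticPartialSum
      refine Finset.sum_congr rfl fun k hk => ?_
      rw [hcC (j + 1) k ((Finset.mem_Icc.1 hk).2.trans h2)]
    rw [e, hCs, aps_add, aps_eq_of_ge (hsupp j) h1]
  refine ⟨c, fun j => E (Cf j) (Nf j) j, fun n => a4 _ _ _, fun n => a5 _ _ _, fun n K hK hKm => ?_⟩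
  have hq1 : (1 : ℝ≥0∞) ≤ 2 ^ (m + 1) := one_le_pow₀ (by norm_num)
  have hKE : ∀ t ∈ K, ∀ j, n ≤ j → t ∈ E (Cf j) (Nf j) j := by
    intro t ht j hj
    have := hK ht
    simp only [Set.mem_iInter] at this
    exact this j hj
  have happ : ∀ t ∈ K, ∀ j, n ≤ j →
      ‖f t - analyticPartialSum (Cf (j + 1)) (Nf (j + 1)) t‖ ≤ (1 / 2) ^ j := by
    intro t ht j hj
    have h1 := a6 _ _ _ t (hKE t ht j hj)
    rw [hCs, aps_add, aps_eq_of_ge (hsupp j) (hmono.monotone (Nat.le_succ j)), hNs, norm_sub_rev]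
    refine le_trans (le_of_eq (congrArg norm ?_)) h1
    ring
  have hblock : ∀ j N, n ≤ j → Nf (j + 1) ≤ N → N ≤ Nf (j + 2) →
      eLpNorm (K.indicator fun t => analyticPartialSum c N t - f t) (2 ^ (m + 1)) hm ≤
        ENNReal.ofReal (5 * (1 / 2) ^ j) := by
    intro j N hj h1 h2
    obtain ⟨R, r1, r2, r3⟩ := a7 (Cf (j + 1)) (Nf (j + 1)) (j + 1) N
    have hpos : (0 : ℝ) < (1 / 2) ^ j := by positivity
    have hsucc : ((1 : ℝ) / 2) ^ (j + 1) = (1 / 2) ^ j / 2 := by rw [pow_succ]; ring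
    rw [hsucc] at r2 r3
    refine (eLpNorm_final hq1 (a := 4 * (1 / 2) ^ j) (by positivity) (by positivity) hKm r1 r2
      fun t ht => ?_).trans (ENNReal.ofReal_le_ofReal (by linarith))
    have e1 := happ t ht j hj
    have e2 := r3 t (hKE t ht (j + 1) (by omega))
    rw [hS (j + 1) N t h1 h2]
    have e3 : analyticPartialSum (Cf (j + 1)) (Nf (j + 1)) t +
        analyticPartialSum (d (Cf (j + 1)) (Nf (j + 1)) (j + 1)) N t - f t =
        analyticPartialSum (d (Cf (j + 1)) (Nf (j + 1)) (j + 1)) N t -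
        (f t - analyticPartialSum (Cf (j + 1)) (Nf (j + 1)) t) := by ring
    rw [e3]
    refine (norm_sub_le _ _).trans ?_
    linarith
  have hall : ∀ j N, n ≤ j → Nf (j + 1) ≤ N →
      eLpNorm (K.indicator fun t => analyticPartialSum c N t - f t) (2 ^ (m + 1)) hm ≤
        ENNReal.ofReal (5 * (1 / 2) ^ j) := by
    intro j N hj hN
    have hex : ∃ i, N < Nf i := ⟨N + 1, lt_of_lt_of_le (Nat.lt_succ_self N) hmono.le_apply⟩
    have hi := Nat.find_spec hex
    set i := Nat.find hex with hidef
    have hij : j + 1 < i := hmono.lt_iff_lt.1 (hN.trans_lt hi)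
    obtain ⟨l, hl⟩ : ∃ l, i = l + 2 := ⟨i - 2, by omega⟩
    have hmin : ¬ N < Nf (l + 1) := Nat.find_min hex (by omega)
    rw [hl] at hi
    refine (hblock l N (by omega) (not_lt.1 hmin) hi.le).trans (ENNReal.ofReal_le_ofReal ?_)
    gcongr ?_ * ?_
    exact pow_le_pow_of_le_one (by norm_num) (by norm_num) (by omega)
  rw [ENNReal.tendsto_atTop_zero]
  intro e he
  have hlim : Tendsto (fun j : ℕ => ENNReal.ofReal (5 * (1 / 2) ^ j)) atTop (𝓝 0) := by
    have h1 := (tendsto_pow_atTop_nhds_zero_of_lt_one (r := (1 / 2 : ℝ)) (by norm_num) (by norm_num)).const_mul 5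
    have := ENNReal.tendsto_ofReal h1
    simpa using this
  obtain ⟨j, hj1, hj2⟩ := ((hlim.eventually_lt_const he).and (eventually_ge_atTop n)).exists
  exact ⟨Nf (j + 1), fun N hN => (hall j N hj2 hN).trans hj1.le⟩

end AnalyticMenshov

/-- For every `1 ≤ p < ∞` and every measurable `f : 𝕋 → ℂ` there are coefficients
`(c_k)_{k>0}` and compact sets `K_n ⊆ 𝕋` with `m(𝕋 \ K_n) → 0` such that the partial
sums `S_N = ∑_{0<k≤N} c_k e^{ikt}` converge to `f` in the norm of `L^p(K_n)` for every
`n`. -/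
theorem analytic_menshov_Lp_on_compacts (p : ℝ) (hp : 1 ≤ p)
    (f : AddCircle (2 * π) → ℂ) (hf : Measurable f) :
    ∃ (c : ℕ → ℂ) (K : ℕ → Set (AddCircle (2 * π))),
      (∀ n, IsCompact (K n)) ∧
      Tendsto (fun n => volume (K n)ᶜ) atTop (𝓝 0) ∧
      ∀ n, Tendsto
        (fun N => ∫ t in K n, ‖analyticPartialSum c N t - f t‖ ^ p ∂volume)
        atTop (𝓝 0) := by
  obtain ⟨m, hm'⟩ := pow_unbounded_of_one_lt p (one_lt_two : (1 : ℝ) < 2)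
  have hpq : ENNReal.ofReal p ≤ 2 ^ (m + 1) := by
    have h1 : p ≤ 2 ^ (m + 1) := hm'.le.trans (pow_le_pow_right₀ (by norm_num) (Nat.le_succ m))
    refine (ENNReal.ofReal_le_ofReal h1).trans (le_of_eq ?_)
    rw [ENNReal.ofReal_pow (by norm_num)]; norm_num
  obtain ⟨c, E, hE, hEn, hconv⟩ := AnalyticMenshov.main_aux m f hf
  have hK : ∀ n : ℕ, ∃ K ⊆ ⋂ j ≥ n, E j, IsCompact K ∧
      AnalyticMenshov.hm ((⋂ j ≥ n, E j) \ K) < ENNReal.ofReal ((1 / 2) ^ n) := fun n =>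
    (MeasurableSet.iInter fun j => MeasurableSet.iInter fun _ => hE j).exists_isCompact_sdiff_lt
      (measure_ne_top _ _) (by simp)
  choose K hKs hKc hKm using hK
  refine ⟨c, K, hKc, ?_, fun n => ?_⟩
  · have hb : ∀ n, volume (K n)ᶜ ≤ ENNReal.ofReal (2 * π * (3 * (1 / 2) ^ n)) := by
      intro n
      rw [AddCircle.volume_eq_smul_haarAddCircle, Measure.smul_apply, smul_eq_mul,
        show ENNReal.ofReal (2 * π * (3 * (1 / 2) ^ n)) = ENNReal.ofReal (2 * π) *
          ENNReal.ofReal (3 * (1 / 2) ^ n) from ENNReal.ofReal_mul (by positivity)]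
      refine mul_le_mul_right ?_ _
      have hsub : (K n)ᶜ ⊆ (⋃ i : ℕ, (E (n + i))ᶜ) ∪ ((⋂ j ≥ n, E j) \ K n) := by
        intro t ht
        by_cases h : t ∈ ⋂ j ≥ n, E j
        · exact Or.inr ⟨h, ht⟩
        · left
          simp only [Set.mem_iInter, not_forall] at h
          obtain ⟨j, hj, hjt⟩ := h
          obtain ⟨i, rfl⟩ := Nat.exists_eq_add_of_le hj
          exact Set.mem_iUnion.2 ⟨i, hjt⟩
      have hsum : HasSum (fun i : ℕ => ((1 : ℝ) / 2) ^ (n + i)) ((1 / 2) ^ n * 2) := by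
        simp_rw [pow_add]
        exact hasSum_geometric_two.mul_left _
      calc AnalyticMenshov.hm (K n)ᶜ ≤ _ := measure_mono hsub
        _ ≤ _ := measure_union_le _ _
        _ ≤ ENNReal.ofReal ((1 / 2) ^ n * 2) + ENNReal.ofReal ((1 / 2) ^ n) := by
          refine add_le_add ?_ (hKm n).le
          refine (measure_iUnion_le _).trans ?_
          refine (ENNReal.tsum_le_tsum fun i => hEn (n + i)).trans (le_of_eq ?_)
          rw [← ENNReal.ofReal_tsum_of_nonneg (fun i => by positivity) hsum.summable, hsum.tsum_eq]
        _ = _ := by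
          rw [← ENNReal.ofReal_add (by positivity) (by positivity)]; congr 1; ring
    refine tendsto_of_tendsto_of_tendsto_of_le_of_le tendsto_const_nhds ?_ (fun _ => zero_le) hb
    have h1 := ((tendsto_pow_atTop_nhds_zero_of_lt_one (r := (1 / 2 : ℝ)) (by norm_num)
      (by norm_num)).const_mul 3).const_mul (2 * π)
    have := ENNReal.tendsto_ofReal h1
    simpa using this
  · exact AnalyticMenshov.tendsto_integral_of_eLpNorm hp hpq (hKc n).measurableSet
      (fun N => (AnalyticMenshov.aps_meas c N).sub hf) (hconv n (K n) (hKs n) (hKc n).measurableSet)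
end

section
/- The L^p-representation theorem with positive spectrum fails for p = ∞: there exists a measurable function f : 𝕋 → ℂ such that there are no complex coefficients (c_k)_{k>0} and compact sets K_n ⊆ 𝕋 with m(𝕋 \ K_n) → 0 for which the partial sums S_N(t) = ∑_{0<k≤N} c_k e^{ikt} converge to f uniformly on each K_n. -/
open MeasureTheory Filter Topology Real

/-- The point `e^{it}` of the unit circle. -/
noncomputable def zetaPt (t : AddCircle (2 * π)) : ℂ := (AddCircle.toCircle t : ℂ)

lemma zetaPt_norm (t : AddCircle (2 * π)) : ‖zetaPt t‖ = 1 :=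
  Circle.norm_coe _

lemma zetaPt_continuous : Continuous zetaPt :=
  continuous_subtype_val.comp AddCircle.continuous_toCircle

lemma zetaPt_dist (t s : AddCircle (2 * π)) : ‖zetaPt t - zetaPt s‖ ≤ ‖t - s‖ := by
  obtain ⟨u, rfl⟩ : ∃ u, t = u + s := ⟨t - s, by simp⟩
  have h1 : zetaPt (u + s) = zetaPt u * zetaPt s := by simp [zetaPt, AddCircle.toCircle_add]
  rw [h1, add_sub_cancel_right, ← sub_one_mul, norm_mul, zetaPt_norm, mul_one]
  induction u using QuotientAddGroup.induction_on with
  | H x =>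
    have h2 : zetaPt (x : AddCircle (2 * π))
        = zetaPt ((x - round ((2 * π)⁻¹ * x) * (2 * π) : ℝ) : AddCircle (2 * π)) := by
      congr 1
      rw [AddCircle.coe_sub]
      have : (((round ((2 * π)⁻¹ * x) : ℝ) * (2 * π) : ℝ) : AddCircle (2 * π)) = 0 := by
        rw [AddCircle.coe_eq_zero_iff]
        exact ⟨round ((2 * π)⁻¹ * x), by simp⟩
      rw [this, sub_zero]
    have h3 := AddCircle.norm_eq (2 * π) (x := x)
    change ‖zetaPt (x : AddCircle (2 * π)) - 1‖ ≤ ‖(x : AddCircle (2 * π))‖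
    rw [h2, h3]
    generalize (x - round ((2 * π)⁻¹ * x) * (2 * π) : ℝ) = y
    have h4 : zetaPt (y : AddCircle (2 * π)) = Complex.exp (Complex.I * y) := by
      have : 2 * π / (2 * π) = 1 := div_self (by positivity)
      rw [zetaPt, AddCircle.toCircle_apply_mk, this, one_mul, Circle.coe_exp, mul_comm]
    rw [h4]
    exact Real.norm_exp_I_mul_ofReal_sub_one_le

lemma zetaPt_polar (z : ℂ) : ∃ s : AddCircle (2 * π), z = ‖z‖ * zetaPt s := by
  refine ⟨((Complex.arg z : ℝ) : AddCircle (2 * π)), ?_⟩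
  have : 2 * π / (2 * π) = 1 := div_self (by positivity)
  rw [zetaPt, AddCircle.toCircle_apply_mk, this, one_mul, Circle.coe_exp]
  exact (Complex.norm_mul_exp_arg_mul_I z).symm

/-- Herglotz integral of the indicator function of `E` (unnormalised). -/
noncomputable def herg (E : Set (AddCircle (2 * π))) (z : ℂ) : ℂ :=
  ∫ t in E, (zetaPt t + z) / (zetaPt t - z)

lemma zetaPt_sub_norm {z : ℂ} (t : AddCircle (2 * π)) : 1 - ‖z‖ ≤ ‖zetaPt t - z‖ := by
  have := norm_sub_norm_le (zetaPt t) z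
  rwa [zetaPt_norm] at this

lemma zetaPt_sub_ne {z : ℂ} (hz : ‖z‖ < 1) (t : AddCircle (2 * π)) : zetaPt t - z ≠ 0 := by
  have := zetaPt_sub_norm (z := z) t
  intro h
  rw [h, norm_zero] at this
  linarith

lemma herg_cont {z : ℂ} (hz : ‖z‖ < 1) :
    Continuous (fun t => (zetaPt t + z) / (zetaPt t - z)) :=
  (zetaPt_continuous.add continuous_const).div (zetaPt_continuous.sub continuous_const)
    (zetaPt_sub_ne hz)

lemma herg_integrable {z : ℂ} (hz : ‖z‖ < 1) :
    Integrable (fun t => (zetaPt t + z) / (zetaPt t - z)) :=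
  (herg_cont hz).integrable_of_hasCompactSupport (HasCompactSupport.of_compactSpace _)

lemma herg_diff (E : Set (AddCircle (2 * π))) {z : ℂ} (hz : ‖z‖ < 1) :
    DifferentiableAt ℂ (herg E) z := by
  obtain ⟨r, hr1, hr2⟩ := exists_between hz
  have hs : Metric.ball (0 : ℂ) r ∈ 𝓝 z := Metric.isOpen_ball.mem_nhds (by simpa using hr1)
  have key := hasDerivAt_integral_of_dominated_loc_of_deriv_le (μ := volume.restrict E)
    (F := fun z t => (zetaPt t + z) / (zetaPt t - z))
    (F' := fun z t => 2 * zetaPt t / (zetaPt t - z) ^ 2)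
    (bound := fun _ => 2 / (1 - r) ^ 2) hs ?_ ?_ ?_ ?_ ?_ ?_
  · exact key.2.differentiableAt
  · filter_upwards [hs] with x hx
    exact (herg_cont (lt_trans (by simpa using hx) hr2)).aestronglyMeasurable
  · exact (herg_integrable hz).integrableOn
  · refine Continuous.aestronglyMeasurable ?_
    exact (continuous_const.mul zetaPt_continuous).div
      ((zetaPt_continuous.sub continuous_const).pow 2)
      (fun t => pow_ne_zero _ (zetaPt_sub_ne hz t))
  · refine ae_of_all _ fun t x hx => ?_
    have hx' : ‖x‖ < r := by simpa using hx
    have := zetaPt_sub_norm (z := x) t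
    rw [norm_div, norm_mul, norm_pow, zetaPt_norm]
    have h0 : 0 < 1 - r := by linarith
    simp only [RCLike.norm_ofNat, mul_one]
    gcongr
    linarith
  · exact integrable_const _
  · refine ae_of_all _ fun t x hx => ?_
    have hx' : ‖x‖ < 1 := lt_trans (by simpa using hx) hr2
    have hne := zetaPt_sub_ne hx' t
    have h1 := ((hasDerivAt_id x).const_add (zetaPt t)).div
      ((hasDerivAt_id x).const_sub (zetaPt t)) hne
    have h2 : 2 * zetaPt t / (zetaPt t - x) ^ 2
        = (1 * (zetaPt t - id x) - (zetaPt t + id x) * -1) / (zetaPt t - id x) ^ 2 := by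
      simp only [id]
      congr 1
      ring
    change HasDerivAt _ (2 * zetaPt t / (zetaPt t - x) ^ 2) x
    rw [h2]
    exact h1

lemma herg_re (E : Set (AddCircle (2 * π))) {z : ℂ} (hz : ‖z‖ < 1) :
    (herg E z).re = ∫ t in E, (1 - ‖z‖ ^ 2) / ‖zetaPt t - z‖ ^ 2 := by
  have h := integral_re (𝕜 := ℂ) ((herg_integrable hz).integrableOn (s := E))
  rw [herg]
  refine h.symm.trans ?_
  congr 1
  ext t
  have h1 : (zetaPt t).re ^ 2 + (zetaPt t).im ^ 2 = 1 := by
    have := Complex.sq_norm (zetaPt t)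
    rw [zetaPt_norm, Complex.normSq_apply] at this
    linarith
  rw [Complex.sq_norm, Complex.sq_norm]
  simp only [RCLike.re_to_complex, Complex.div_re]
  rw [← add_div]
  congr 1
  simp only [Complex.normSq_apply, Complex.add_re, Complex.sub_re, Complex.add_im, Complex.sub_im]
  linear_combination h1

lemma pois_integrable {z : ℂ} (hz : ‖z‖ < 1) :
    Integrable (fun t => (1 - ‖z‖ ^ 2) / ‖zetaPt t - z‖ ^ 2) := by
  refine Continuous.integrable_of_hasCompactSupport ?_ (HasCompactSupport.of_compactSpace _)
  exact continuous_const.div ((zetaPt_continuous.sub continuous_const).norm.pow 2)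
      (fun t => pow_ne_zero _ (norm_ne_zero_iff.2 (zetaPt_sub_ne hz t)))

lemma pois_nonneg {z : ℂ} (hz : ‖z‖ < 1) (t : AddCircle (2 * π)) :
    0 ≤ (1 - ‖z‖ ^ 2) / ‖zetaPt t - z‖ ^ 2 := by
  have : 0 ≤ 1 - ‖z‖ ^ 2 := by nlinarith [norm_nonneg z]
  positivity

lemma herg_re_nonneg (E : Set (AddCircle (2 * π))) {z : ℂ} (hz : ‖z‖ < 1) :
    0 ≤ (herg E z).re := by
  rw [herg_re E hz]
  exact integral_nonneg (pois_nonneg hz)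

/-- If `z` is in no Stolz angle over `K`, the Poisson integral of `1_{Kᶜ}` is at least `1/2`. -/
lemma stolz (K : Set (AddCircle (2 * π))) {z : ℂ} (hz : ‖z‖ < 1)
    (h : (herg Kᶜ z).re ≤ 1 / 3) : ∃ t ∈ K, ‖z - zetaPt t‖ ≤ 2 * (1 - ‖z‖) := by
  by_contra hcon
  push Not at hcon
  obtain ⟨s, hs⟩ := zetaPt_polar z
  set η := 1 - ‖z‖ with hη
  have hη0 : 0 < η := by linarith
  have hη1 : η ≤ 1 := by linarith [norm_nonneg z]
  have hd : ∀ t ∈ Metric.closedBall s η, ‖zetaPt t - z‖ ≤ 2 * η := by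
    intro t ht
    have h1 : ‖zetaPt t - zetaPt s‖ ≤ η := by
      refine (zetaPt_dist t s).trans ?_
      rwa [Metric.mem_closedBall, dist_eq_norm] at ht
    have h2 : ‖zetaPt s - z‖ = η := by
      have : zetaPt s - z = (η : ℂ) * zetaPt s := by
        rw [hη]; push_cast; linear_combination - hs
      rw [this, norm_mul, zetaPt_norm, Complex.norm_real, Real.norm_of_nonneg hη0.le, mul_one]
    calc ‖zetaPt t - z‖ = ‖(zetaPt t - zetaPt s) + (zetaPt s - z)‖ := by congr 1; ring
      _ ≤ _ := norm_add_le _ _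
      _ ≤ 2 * η := by linarith
  have hsub : Metric.closedBall s η ⊆ Kᶜ := by
    intro t ht htK
    have := hcon t htK
    rw [norm_sub_rev] at this
    linarith [hd t ht]
  have hvol : volume.real (Metric.closedBall s η) = 2 * η := by
    rw [Measure.real, AddCircle.volume_closedBall, min_eq_right, ENNReal.toReal_ofReal]
    · linarith
    · linarith [Real.pi_gt_three]
  have h1 : (1 / (4 * η)) * (2 * η) ≤
      ∫ t in Metric.closedBall s η, (1 - ‖z‖ ^ 2) / ‖zetaPt t - z‖ ^ 2 := by
    rw [← hvol]
    refine setIntegral_ge_of_const_le_real Metric.isClosed_closedBall.measurableSet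
      (measure_ne_top _ _) ?_ (pois_integrable hz).integrableOn
    intro t ht
    have h3 := hd t ht
    have h4 : 0 < ‖zetaPt t - z‖ := norm_pos_iff.2 (zetaPt_sub_ne hz t)
    rw [hvol] at *
    rw [div_le_div_iff₀ (by positivity) (by positivity)]
    have h5 : ‖zetaPt t - z‖ ^ 2 ≤ (2 * η) ^ 2 := by gcongr
    have h6 : η ≤ 1 - ‖z‖ ^ 2 := by nlinarith [norm_nonneg z]
    nlinarith
  have h2 : ∫ t in Metric.closedBall s η, (1 - ‖z‖ ^ 2) / ‖zetaPt t - z‖ ^ 2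
      ≤ ∫ t in Kᶜ, (1 - ‖z‖ ^ 2) / ‖zetaPt t - z‖ ^ 2 :=
    setIntegral_mono_set (pois_integrable hz).integrableOn
      (ae_of_all _ (pois_nonneg hz)) (LE.le.eventuallyLE hsub)
  rw [← herg_re Kᶜ hz] at h2
  have h7 : (1 / (4 * η)) * (2 * η) = 1 / 2 := by field_simp; norm_num
  linarith

/-- Abel summation bound. -/
lemma abel_bound (a : ℕ → ℂ) (C : ℝ) (hC : ∀ N, ‖∑ k ∈ Finset.range (N + 1), a k‖ ≤ C)
    (x : ℂ) (hx : ‖x‖ < 1) (B : ℝ) (hB : ‖1 - x‖ ≤ B * (1 - ‖x‖)) (N : ℕ) :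
    ‖∑ k ∈ Finset.range (N + 1), a k * x ^ k‖ ≤ C * (1 + B) := by
  have hC0 : 0 ≤ C := (norm_nonneg _).trans (hC 0)
  have hid : ∀ N, ∑ k ∈ Finset.range (N + 1), a k * x ^ k
      = (∑ k ∈ Finset.range (N + 1), a k) * x ^ N
        + ∑ j ∈ Finset.range N, (∑ k ∈ Finset.range (j + 1), a k) * x ^ j * (1 - x) := by
    intro N
    induction N with
    | zero => simp
    | succ n ih =>
      rw [Finset.sum_range_succ, ih, Finset.sum_range_succ _ (n + 1),
        Finset.sum_range_succ (fun j => (∑ k ∈ Finset.range (j + 1), a k) * x ^ j * (1 - x)) n]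
      ring
  have hgeo : ∀ N, (∑ j ∈ Finset.range N, ‖x‖ ^ j) * (1 - ‖x‖) ≤ 1 := by
    intro N
    rw [geom_sum_mul_neg]
    linarith [pow_nonneg (norm_nonneg x) N]
  rw [hid]
  have h1 : ‖(∑ k ∈ Finset.range (N + 1), a k) * x ^ N‖ ≤ C := by
    rw [norm_mul, norm_pow]
    calc _ ≤ C * 1 := mul_le_mul (hC N) (pow_le_one₀ (norm_nonneg _) hx.le) (by positivity) hC0
      _ = C := mul_one C
  have h2 : ‖∑ j ∈ Finset.range N, (∑ k ∈ Finset.range (j + 1), a k) * x ^ j * (1 - x)‖ ≤ C * B := by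
    calc _ ≤ ∑ j ∈ Finset.range N, C * ‖x‖ ^ j * ‖1 - x‖ := by
          refine norm_sum_le_of_le _ fun j _ => ?_
          rw [norm_mul, norm_mul, norm_pow]
          gcongr
          exact hC j
      _ = C * (∑ j ∈ Finset.range N, ‖x‖ ^ j) * ‖1 - x‖ := by
          rw [← Finset.sum_mul, ← Finset.mul_sum]
      _ ≤ C * (∑ j ∈ Finset.range N, ‖x‖ ^ j) * (B * (1 - ‖x‖)) := by gcongr
      _ = C * B * ((∑ j ∈ Finset.range N, ‖x‖ ^ j) * (1 - ‖x‖)) := by ring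
      _ ≤ C * B * 1 := by
          have : 0 ≤ B := by
            by_contra hb
            push Not at hb
            nlinarith [norm_nonneg (1 - x)]
          gcongr
          exact hgeo N
      _ = C * B := mul_one _
  calc _ ≤ _ := norm_add_le _ _
    _ ≤ C * (1 + B) := by linarith

/-- The polynomial `S_N(z) - 1`, extended to the complex plane. -/
noncomputable def polyQ (c : ℕ → ℂ) (N : ℕ) (z : ℂ) : ℂ :=
  ∑ k ∈ Finset.range (N + 1), (if k = 0 then -1 else c k) * z ^ k

lemma polyQ_zetaPt (c : ℕ → ℂ) (N : ℕ) (t : AddCircle (2 * π)) :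
    polyQ c N (zetaPt t) = analyticPartialSum c N t - 1 := by
  induction N with
  | zero => simp [polyQ, analyticPartialSum]
  | succ n ih =>
    rw [polyQ] at ih
    rw [polyQ, Finset.sum_range_succ, ih, analyticPartialSum, analyticPartialSum,
      Finset.sum_Icc_succ_top (by omega), fourier_apply, AddCircle.toCircle_zsmul]
    simp only [zetaPt, Nat.add_eq_zero_iff, one_ne_zero, and_false, if_false]
    rw [zpow_natCast]
    push_cast
    ring

lemma polyQ_zero (c : ℕ → ℂ) (N : ℕ) : polyQ c N 0 = -1 := by
  rw [polyQ, Finset.sum_range_succ']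
  simp

lemma polyQ_diff (c : ℕ → ℂ) (N : ℕ) : Differentiable ℂ (polyQ c N) := by
  unfold polyQ
  fun_prop

lemma polyQ_stolz (c : ℕ → ℂ) (C : ℝ) (t : AddCircle (2 * π))
    (hC : ∀ N, ‖polyQ c N (zetaPt t)‖ ≤ C) (z : ℂ) (hz : ‖z‖ < 1)
    (hzt : ‖z - zetaPt t‖ ≤ 2 * (1 - ‖z‖)) (N : ℕ) : ‖polyQ c N z‖ ≤ 3 * C := by
  have hne : zetaPt t ≠ 0 := norm_ne_zero_iff.1 (by rw [zetaPt_norm]; norm_num)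
  have hx : ‖z / zetaPt t‖ = ‖z‖ := by rw [norm_div, zetaPt_norm, div_one]
  have := abel_bound (fun k => (if k = 0 then -1 else c k) * zetaPt t ^ k) C hC (z / zetaPt t)
    (by rwa [hx]) 2 ?_ N
  · convert this using 1
    · rw [polyQ]
      congr 1
      refine Finset.sum_congr rfl fun k _ => ?_
      rw [div_pow]
      field_simp
    · ring
  · rw [hx]
    refine le_trans (le_of_eq ?_) hzt
    have : z - zetaPt t = -(1 - z / zetaPt t) * zetaPt t := by field_simp; ring
    rw [this, norm_mul, zetaPt_norm, norm_neg, mul_one]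

/-- Core: no analytic series without constant term converges uniformly to `1` on a compact
set of almost full measure. -/
lemma core (c : ℕ → ℂ) (K : Set (AddCircle (2 * π)))
    (hvol : volume.real Kᶜ < 1 / 3)
    (h : TendstoUniformlyOn (fun N => analyticPartialSum c N) (fun _ => 1) atTop K) : False := by
  rw [Metric.tendstoUniformlyOn_iff] at h
  have h' : ∀ ε > 0, ∃ N0, ∀ N ≥ N0, ∀ t ∈ K, ‖polyQ c N (zetaPt t)‖ < ε := by
    intro ε hε
    obtain ⟨N0, hN0⟩ := eventually_atTop.1 (h ε hε)
    refine ⟨N0, fun N hN t ht => ?_⟩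
    have := hN0 N hN t ht
    rwa [dist_eq_norm, norm_sub_rev, ← polyQ_zetaPt] at this
  -- uniform bound
  obtain ⟨C, hC1, hC⟩ : ∃ C : ℝ, 1 ≤ C ∧ ∀ t ∈ K, ∀ N, ‖polyQ c N (zetaPt t)‖ ≤ C := by
    obtain ⟨N0, hN0⟩ := h' 1 one_pos
    refine ⟨1 + ∑ k ∈ Finset.range (N0 + 1), ‖(if k = 0 then -1 else c k)‖, ?_, ?_⟩
    · have : 0 ≤ ∑ k ∈ Finset.range (N0 + 1), ‖(if k = 0 then -1 else c k)‖ := by positivity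
      linarith
    · intro t ht N
      rcases le_total N0 N with hN | hN
      · have := (hN0 N hN t ht).le
        have : 0 ≤ ∑ k ∈ Finset.range (N0 + 1), ‖(if k = 0 then -1 else c k)‖ := by positivity
        linarith
      · have h1 : ‖polyQ c N (zetaPt t)‖
            ≤ ∑ k ∈ Finset.range (N + 1), ‖(if k = 0 then -1 else c k)‖ := by
          refine norm_sum_le_of_le _ fun k _ => ?_
          rw [norm_mul, norm_pow, zetaPt_norm, one_pow, mul_one]
        have h2 : ∑ k ∈ Finset.range (N + 1), ‖(if k = 0 then -1 else c k)‖
            ≤ ∑ k ∈ Finset.range (N0 + 1), ‖(if k = 0 then -1 else c k)‖ :=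
          Finset.sum_le_sum_of_subset_of_nonneg
            (Finset.range_mono (by omega)) (fun _ _ _ => norm_nonneg _)
        linarith
  set w : ℂ → ℝ := fun z => 1 - 3 * (herg Kᶜ z).re with hw
  have hw0 : 0 < w 0 := by
    have : (herg Kᶜ 0).re = volume.real Kᶜ := by
      rw [herg_re _ (by simp)]
      simp [zetaPt_norm]
    simp only [hw, this]
    linarith
  have hw1 : ∀ z : ℂ, ‖z‖ < 1 → w z ≤ 1 := fun z hz => by
    have := herg_re_nonneg Kᶜ hz
    simp only [hw]
    linarith
  have hwst : ∀ z : ℂ, ‖z‖ < 1 → 0 ≤ w z → ∃ t ∈ K, ‖z - zetaPt t‖ ≤ 2 * (1 - ‖z‖) := by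
    intro z hz hwz
    refine stolz K hz ?_
    simp only [hw] at hwz
    linarith
  obtain ⟨M, hM0, hM⟩ : ∃ M : ℝ, 0 < M ∧ 3 * C < Real.exp (M * w 0) := by
    refine ⟨3 * C / w 0, by positivity, ?_⟩
    rw [div_mul_cancel₀ _ hw0.ne']
    linarith [Real.add_one_le_exp (3 * C)]
  set ε := Real.exp (-M) / 2 with hε
  have hε0 : 0 < ε := by positivity
  obtain ⟨N, hN⟩ := h' ε hε0
  replace hN := hN N le_rfl
  have huc := (isCompact_closedBall (0 : ℂ) 1).uniformContinuousOn_of_continuous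
    (polyQ_diff c N).continuous.continuousOn
  rw [Metric.uniformContinuousOn_iff] at huc
  obtain ⟨δ, hδ, huc⟩ := huc ε hε0
  obtain ⟨ρ, hρ0, hρ1, hρδ⟩ : ∃ ρ : ℝ, 0 < ρ ∧ ρ < 1 ∧ 2 * (1 - ρ) < δ := by
    refine ⟨max (1 / 2) (1 - δ / 4), by positivity, ?_, ?_⟩
    · rw [max_lt_iff]; constructor <;> linarith
    · have := le_max_right (1 / 2) (1 - δ / 4)
      linarith
  -- the domain
  have hcont : ContinuousOn w (Metric.closedBall 0 ρ) := by
    have : ContinuousOn (herg Kᶜ) (Metric.closedBall 0 ρ) := fun z hz =>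
      (herg_diff Kᶜ (lt_of_le_of_lt (by simpa using hz) hρ1)).continuousAt.continuousWithinAt
    exact continuousOn_const.sub (continuousOn_const.mul (Complex.continuous_re.comp_continuousOn this))
  set U : Set ℂ := Metric.ball 0 ρ ∩ w ⁻¹' Set.Ioi 0 with hU
  have hUo : IsOpen U :=
    (hcont.mono Metric.ball_subset_closedBall).isOpen_inter_preimage Metric.isOpen_ball isOpen_Ioi
  have hUc : closure U ⊆ Metric.closedBall 0 ρ ∩ w ⁻¹' Set.Ici 0 := by
    refine closure_minimal ?_ (hcont.preimage_isClosed_of_isClosed Metric.isClosed_closedBall isClosed_Ici)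
    exact Set.inter_subset_inter Metric.ball_subset_closedBall
      (Set.preimage_mono Set.Ioi_subset_Ici_self)
  set G : ℂ → ℂ := fun z => polyQ c N z * Complex.exp (M * (1 - 3 * herg Kᶜ z)) with hG
  have hGn : ∀ z, ‖G z‖ = ‖polyQ c N z‖ * Real.exp (M * w z) := by
    intro z
    simp [hG, hw, Complex.norm_exp]
  have hGd : DiffContOnCl ℂ G U := by
    refine DifferentiableOn.diffContOnCl fun z hz => ?_
    have hz1 : ‖z‖ < 1 := lt_of_le_of_lt (by simpa using (hUc hz).1) hρ1
    have := herg_diff Kᶜ hz1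
    have h2 := (polyQ_diff c N) z
    exact (h2.mul (((this.const_mul 3).const_sub 1).const_mul (M : ℂ)).cexp).differentiableWithinAt
  have hfr : ∀ z ∈ frontier U, ‖G z‖ ≤ 3 * C := by
    intro z hz
    rw [hUo.frontier_eq] at hz
    obtain ⟨hzc, hzU⟩ := hz
    obtain ⟨hzb, hwz⟩ := hUc hzc
    have hzρ : ‖z‖ ≤ ρ := by simpa using hzb
    have hz1 : ‖z‖ < 1 := hzρ.trans_lt hρ1
    have hwz : 0 ≤ w z := hwz
    obtain ⟨t, htK, ht⟩ := hwst z hz1 hwz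
    rw [hGn]
    rcases hzρ.lt_or_eq with hlt | heq
    · have : w z = 0 := by
        refine le_antisymm ?_ hwz
        by_contra hpos
        push Not at hpos
        exact hzU ⟨by simpa using hlt, hpos⟩
      rw [this, mul_zero, Real.exp_zero, mul_one]
      exact polyQ_stolz c C t (hC t htK) z hz1 ht N
    · have h1 : ‖polyQ c N z - polyQ c N (zetaPt t)‖ < ε := by
        have := huc z (by simpa using hz1.le) (zetaPt t) (by simp [zetaPt_norm])
          (by rw [dist_eq_norm]; rw [heq] at ht; linarith)
        rwa [dist_eq_norm] at this
      have h2 : ‖polyQ c N z‖ ≤ 2 * ε := by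
        have h3 := norm_add_le (polyQ c N z - polyQ c N (zetaPt t)) (polyQ c N (zetaPt t))
        rw [sub_add_cancel] at h3
        linarith [hN t htK]
      have h4 : Real.exp (M * w z) ≤ Real.exp M := by
        rw [Real.exp_le_exp]
        nlinarith [hw1 z hz1]
      calc ‖polyQ c N z‖ * Real.exp (M * w z) ≤ (2 * ε) * Real.exp M := by gcongr
        _ = 1 := by
          rw [hε, mul_div_cancel₀ _ (by norm_num), ← Real.exp_add]; simp
        _ ≤ 3 * C := by linarith
  have hfin := Complex.norm_le_of_forall_mem_frontier_norm_le
    (Metric.isBounded_ball.subset Set.inter_subset_left) hGd hfr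
    (subset_closure (show (0 : ℂ) ∈ U from ⟨by simpa using hρ0, hw0⟩))
  rw [hGn, polyQ_zero] at hfin
  simp only [norm_neg, norm_one, one_mul] at hfin
  linarith

/-- The representation theorem with positive spectrum fails for `p = ∞`: there is a
measurable `f : 𝕋 → ℂ` for which no coefficients `(c_k)_{k>0}` and compact sets
`K_n ⊆ 𝕋` with `m(𝕋 \ K_n) → 0` exist such that the partial sums
`S_N = ∑_{0<k≤N} c_k e^{ikt}` converge to `f` uniformly on each `K_n`. -/
theorem analytic_menshov_fails_for_Linfty :
    ∃ f : AddCircle (2 * π) → ℂ, Measurable f ∧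
      ¬ ∃ (c : ℕ → ℂ) (K : ℕ → Set (AddCircle (2 * π))),
        (∀ n, IsCompact (K n)) ∧
        Tendsto (fun n => volume (K n)ᶜ) atTop (𝓝 0) ∧
        ∀ n, TendstoUniformlyOn (fun N => analyticPartialSum c N) f atTop (K n) := by
  refine ⟨fun _ => 1, measurable_const, ?_⟩
  rintro ⟨c, K, -, hK, h⟩
  have h1 : ∀ᶠ n in atTop, volume (K n)ᶜ < ENNReal.ofReal (1 / 3) :=
    hK.eventually_lt_const (by simp)
  obtain ⟨n, hn⟩ := h1.exists
  refine core c (K n) ?_ (h n)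
  rw [Measure.real]
  exact (ENNReal.lt_ofReal_iff_toReal_lt (measure_ne_top _ _)).1 hn
end

section
/- For every positive sequence ε(n) with ε(n) → 0 as n → ∞, there exists a set Λ ⊆ ℤ⁺, enumerated in increasing order as Λ = {λ(n) : n ≥ 1} with λ(n+1)/λ(n) > 1 + ε(n) for all n, such that every measurable function f : 𝕋 → ℂ admits a representation f(t) = ∑_{k∈Λ} c_k e^{ikt} converging in measure; that is, the partial sums S_N(t) = ∑_{k∈Λ, k≤N} c_k e^{ikt} converge to f in Lebesgue measure on 𝕋. -/
open MeasureTheory Filter Topology Real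

/-- The partial sum `S_N(t) = ∑_{k ∈ Λ, 0 < k ≤ N} c_k e^{ikt}` of a series with
spectrum in `Λ ⊆ ℤ⁺`, on the circle `𝕋 = ℝ/2πℤ`. -/
noncomputable def lambdaPartialSum (Λ : Set ℤ) (c : ℤ → ℂ) (N : ℕ)
    (t : AddCircle (2 * π)) : ℂ :=
  ∑ k ∈ Finset.Icc (1 : ℤ) (N : ℤ), Λ.indicator c k * fourier k t

/-- The circle. -/
abbrev Tor : Type := AddCircle (2 * π)

/-- Normalised Haar measure on the circle. -/
noncomputable abbrev muT : Measure Tor := AddCircle.haarAddCircle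

/-- `g` is at most `η` in size off a set of measure at most `η`. -/
def SmallM (η : ℝ) (g : Tor → ℂ) : Prop :=
  muT {t | η < ‖g t‖} ≤ ENNReal.ofReal η


section PartOne
open Polynomial

/-- Evaluation of a polynomial on the circle. -/
noncomputable def evT (P : ℂ[X]) (t : Tor) : ℂ := P.eval (fourier 1 t : ℂ)

/-- squared `L²` norm. -/
noncomputable def nrm2 (P : ℂ[X]) : ℝ := ∫ t, ‖evT P t‖ ^ 2 ∂muT

lemma fourier_nat_eq_pow (k : ℕ) (t : Tor) : (fourier (k : ℤ) t : ℂ) = (fourier 1 t : ℂ) ^ k := by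
  induction k with
  | zero => simp
  | succ k ih => rw [pow_succ, ← ih, ← fourier_add]; push_cast; rfl

lemma norm_fourier_apply (k : ℤ) (t : Tor) : ‖(fourier k t : ℂ)‖ = 1 := by
  rw [fourier_apply]; exact Circle.norm_coe _

lemma evT_continuous (P : ℂ[X]) : Continuous (evT P) := by
  unfold evT
  exact P.continuous.comp (fourier 1).continuous

lemma cont_integrable {E : Type*} [NormedAddCommGroup E] {g : Tor → E} (hg : Continuous g) :
    Integrable g muT := by
  exact hg.integrable_of_hasCompactSupport (HasCompactSupport.of_compactSpace g)

lemma integral_fourier_eq (k : ℤ) : ∫ t, (fourier k t : ℂ) ∂muT = if k = 0 then 1 else 0 := by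
  have h := congrFun (fourierCoeff_fourier (T := 2 * π) k) 0
  simp only [fourierCoeff] at h
  simp only [neg_zero, fourier_zero, one_smul] at h
  rw [h]
  simp [Pi.single_apply, eq_comm]

lemma integral_evT (P : ℂ[X]) : ∫ t, evT P t ∂muT = P.coeff 0 := by
  unfold evT
  simp_rw [eval_eq_sum_range, ← fourier_nat_eq_pow]
  rw [integral_finsetSum]
  · simp_rw [integral_const_mul, integral_fourier_eq]
    rw [Finset.sum_eq_single 0]
    · simp
    · intro b _ hb; simp [hb]
    · simp
  · intro i _
    exact cont_integrable (by fun_prop)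

lemma nrm2_nonneg (P : ℂ[X]) : 0 ≤ nrm2 P := integral_nonneg fun _ => by positivity

lemma nsq_add (a b : ℂ) : ‖a + b‖ ^ 2 = ‖a‖ ^ 2 + ‖b‖ ^ 2 + 2 * ((starRingEnd ℂ) a * b).re := by
  rw [← Complex.normSq_eq_norm_sq, ← Complex.normSq_eq_norm_sq, ← Complex.normSq_eq_norm_sq,
    Complex.normSq_add]
  simp [Complex.mul_re]

lemma nrm2_C_add_X_mul (a : ℂ) (Q : ℂ[X]) : nrm2 (C a + X * Q) = ‖a‖ ^ 2 + nrm2 Q := by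
  have h1 : ∀ t, ‖evT (C a + X * Q) t‖ ^ 2 =
      ‖a‖ ^ 2 + ‖evT Q t‖ ^ 2 + 2 * (evT (C ((starRingEnd ℂ) a) * (X * Q)) t).re := by
    intro t
    have : evT (C a + X * Q) t = a + evT (X * Q) t := by simp [evT]
    rw [this, nsq_add]
    simp [evT, Circle.norm_coe]
  unfold nrm2
  simp_rw [h1]
  have hQ := evT_continuous Q
  have hR := evT_continuous (C ((starRingEnd ℂ) a) * (X * Q))
  rw [integral_add (cont_integrable (by fun_prop)) (cont_integrable (by fun_prop)),
    integral_add (cont_integrable (by fun_prop)) (cont_integrable (by fun_prop)),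
    integral_const_mul]
  have : ∫ t, (evT (C ((starRingEnd ℂ) a) * (X * Q)) t).re ∂muT = 0 := by
    have h2 := integral_re (𝕜 := ℂ) (cont_integrable hR)
    simp only [RCLike.re_to_complex] at h2
    rw [h2, integral_evT]
    simp
  rw [this]
  simp

/-- polynomial from a coefficient sequence -/
noncomputable def polyOf (n : ℕ) (a : ℕ → ℂ) : ℂ[X] := ∑ k ∈ Finset.range n, C (a k) * X ^ k

lemma polyOf_succ (n : ℕ) (a : ℕ → ℂ) :
    polyOf (n + 1) a = C (a 0) + X * polyOf n (fun k => a (k + 1)) := by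
  unfold polyOf
  rw [Finset.sum_range_succ', Finset.mul_sum, add_comm]
  congr 1
  · simp
  · apply Finset.sum_congr rfl; intro i _; ring

lemma nrm2_polyOf (n : ℕ) (a : ℕ → ℂ) : nrm2 (polyOf n a) = ∑ k ∈ Finset.range n, ‖a k‖ ^ 2 := by
  induction n generalizing a with
  | zero => simp [polyOf, nrm2, evT]
  | succ n ih => rw [polyOf_succ, nrm2_C_add_X_mul, ih, Finset.sum_range_succ', add_comm]

/-- truncation -/
noncomputable def truncP (K : ℕ) (P : ℂ[X]) : ℂ[X] := polyOf K P.coeff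

lemma truncP_of_lt {K : ℕ} {P : ℂ[X]} (h : P.natDegree < K) : truncP K P = P := by
  unfold truncP polyOf
  exact (P.as_sum_range_C_mul_X_pow' h).symm

lemma coeff_polyOf (n : ℕ) (a : ℕ → ℂ) (k : ℕ) :
    (polyOf n a).coeff k = if k < n then a k else 0 := by
  unfold polyOf
  simp [coeff_X_pow]

lemma coeff_truncP (K : ℕ) (P : ℂ[X]) (k : ℕ) :
    (truncP K P).coeff k = if k < K then P.coeff k else 0 := coeff_polyOf _ _ _

lemma nrm2_eq_sum {K : ℕ} {P : ℂ[X]} (h : P.natDegree < K) :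
    nrm2 P = ∑ k ∈ Finset.range K, ‖P.coeff k‖ ^ 2 := by
  rw [← nrm2_polyOf]; congr 1; exact (truncP_of_lt h).symm

lemma nrm2_truncP_le (K : ℕ) (P : ℂ[X]) : nrm2 (truncP K P) ≤ nrm2 P := by
  rw [nrm2_eq_sum (K := max K (P.natDegree + 1)) (P := P) (by omega)]
  unfold truncP
  rw [nrm2_polyOf]
  apply Finset.sum_le_sum_of_subset_of_nonneg
  · intro k; simp; omega
  · intros; positivity

lemma nrm2_C_mul (b : ℂ) (A : ℂ[X]) : nrm2 (C b * A) = ‖b‖ ^ 2 * nrm2 A := by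
  unfold nrm2
  rw [← integral_const_mul]
  congr 1; ext t; simp [evT, mul_pow]

lemma nrm2_add_X_pow_mul {N : ℕ} {A : ℂ[X]} (hA : A.natDegree < N) (B : ℂ[X]) :
    nrm2 (A + X ^ N * B) = nrm2 A + nrm2 B := by
  have hc : ∀ k, (A + X ^ N * B).coeff k = if k < N then A.coeff k else B.coeff (k - N) := by
    intro k
    rw [coeff_add, coeff_X_pow_mul']
    split_ifs with h1 h2 h2
    · omega
    · rw [coeff_eq_zero_of_natDegree_lt (by omega), zero_add]
    · simp
    · omega
  have hd : (A + X ^ N * B).natDegree < N + (B.natDegree + 1) := by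
    have h1 := natDegree_add_le A (X ^ N * B)
    have h2 := natDegree_mul_le (p := (X : ℂ[X]) ^ N) (q := B)
    rw [natDegree_X_pow] at h2
    have := max_le (a := A.natDegree) (c := N + B.natDegree) (by omega) h2
    omega
  rw [nrm2_eq_sum hd, nrm2_eq_sum hA, nrm2_eq_sum (Nat.lt_succ_self B.natDegree),
    Finset.sum_range_add]
  congr 1
  · apply Finset.sum_congr rfl
    intro k hk
    rw [hc, if_pos (Finset.mem_range.1 hk)]
  · apply Finset.sum_congr rfl
    intro k hk
    rw [hc, if_neg (by omega)]
    simp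

lemma exists_polyOf (B : ℂ[X]) : ∃ n a, B = polyOf n a :=
  ⟨B.natDegree + 1, B.coeff, (truncP_of_lt (Nat.lt_succ_self _)).symm⟩

lemma nrm2_mul_expand {N : ℕ} {A : ℂ[X]} (hA : A.natDegree < N) (B : ℂ[X]) :
    nrm2 (A * expand ℂ N B) = nrm2 A * nrm2 B := by
  obtain ⟨n, b, rfl⟩ := exists_polyOf B
  rw [nrm2_polyOf]
  induction n generalizing b with
  | zero => simp [polyOf, nrm2, evT]
  | succ n ih =>
    have h1 : A * expand ℂ N (polyOf (n + 1) b) =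
        C (b 0) * A + X ^ N * (A * expand ℂ N (polyOf n (fun k => b (k + 1)))) := by
      rw [polyOf_succ, map_add, map_mul, expand_C, expand_X]; ring
    rw [h1, nrm2_add_X_pow_mul, ih, nrm2_C_mul, Finset.sum_range_succ']
    · ring
    · exact lt_of_le_of_lt (natDegree_C_mul_le _ _) hA

lemma evT_expand (N : ℕ) (B : ℂ[X]) (t : Tor) : evT (expand ℂ N B) t = evT B (N • t) := by
  unfold evT
  rw [expand_eval, ← fourier_nat_eq_pow]
  simp [fourier_apply]

lemma mp_nsmul {N : ℕ} (hN : N ≠ 0) : MeasurePreserving (fun t : Tor => N • t) muT muT := by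
  have := MeasureTheory.Measure.measurePreserving_zsmul muT (n := (N : ℤ)) (by exact_mod_cast hN)
  simpa using this

lemma integral_nsmul {N : ℕ} (hN : N ≠ 0) {g : Tor → ℝ} (hg : Continuous g) :
    ∫ t, g (N • t) ∂muT = ∫ t, g t ∂muT := by
  have h := mp_nsmul hN
  conv_rhs => rw [← h.map_eq]
  rw [integral_map h.measurable.aemeasurable]
  exact hg.aestronglyMeasurable

lemma integral_re_evT (P : ℂ[X]) : ∫ t, (evT P t).re ∂muT = (P.coeff 0).re := by
  have h2 := integral_re (𝕜 := ℂ) (cont_integrable (evT_continuous P))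
  simp only [RCLike.re_to_complex] at h2
  rw [h2, integral_evT]

lemma exists_completion (P : ℂ[X]) : ∃ H : ℂ[X], H.coeff 0 = 0 ∧
    ∀ t, (evT H t).re = ‖evT P t‖ ^ 2 - nrm2 P := by
  obtain ⟨n, b, rfl⟩ := exists_polyOf P
  induction n generalizing b with
  | zero => exact ⟨0, by simp, by simp [polyOf, evT, nrm2]⟩
  | succ n ih =>
    obtain ⟨H, h0, h1⟩ := ih (fun k => b (k + 1))
    set Q := polyOf n (fun k => b (k + 1)) with hQ
    refine ⟨H + C (2 * (starRingEnd ℂ) (b 0)) * (X * Q), by simp [h0], fun t => ?_⟩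
    rw [polyOf_succ, ← hQ, nrm2_C_add_X_mul]
    have e1 : evT (C (b 0) + X * Q) t = b 0 + evT (X * Q) t := by simp [evT]
    have e2 : ‖evT (X * Q) t‖ = ‖evT Q t‖ := by simp [evT, Circle.norm_coe]
    have e3 : evT (H + C (2 * (starRingEnd ℂ) (b 0)) * (X * Q)) t =
        evT H t + 2 * ((starRingEnd ℂ) (b 0) * evT (X * Q) t) := by simp [evT]; ring
    have e4 : ∀ w : ℂ, (2 * w).re = 2 * w.re := by intro w; simp
    rw [e1, nsq_add, e2, e3, Complex.add_re, h1, e4]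
    ring

lemma kernel (m : ℕ) (hm : 1 ≤ m) : ∃ (H : ℂ[X]) (K : Tor → ℝ), H.coeff 0 = 0 ∧ Continuous K ∧
    (∀ t, 0 ≤ K t) ∧ (∀ t, K t ≤ 2 * m) ∧ (∀ t, (evT H t).re = K t - 1) ∧
    (∫ t, √(K t) ∂muT) ≤ √(2 / m) ∧ nrm2 H ≤ 4 * m := by
  have hmpos : (0 : ℝ) < m := by exact_mod_cast hm
  set D : ℂ[X] := polyOf m (fun _ => 1) with hD
  have hDc : Continuous (evT D) := evT_continuous D
  have hDn : nrm2 D = m := by rw [hD, nrm2_polyOf]; simp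
  have hDdeg : D.natDegree < m := by
    rw [hD]; unfold polyOf
    apply lt_of_le_of_lt (natDegree_sum_le_of_forall_le (n := m - 1) _ _ ?_) (by omega)
    intro i hi
    have := Finset.mem_range.1 hi
    exact (natDegree_C_mul_X_pow_le _ _).trans (by omega)
  have hDb : ∀ t, ‖evT D t‖ ≤ m := by
    intro t
    have : evT D t = ∑ k ∈ Finset.range m, (fourier 1 t : ℂ) ^ k := by
      rw [hD]; simp [evT, polyOf, eval_finsetSum]
    rw [this]
    refine (norm_sum_le _ _).trans ?_
    simp only [norm_pow, norm_fourier_apply]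
    simp
  set c := nrm2 (D ^ 2) with hc
  have hcl : (m : ℝ) ^ 3 / 2 ≤ c := by
    have hdeg : (D ^ 2).natDegree < 2 * m := by
      have := natDegree_pow_le (p := D) (n := 2)
      omega
    have h1 : (D ^ 2).eval 1 = (m : ℂ) ^ 2 := by
      rw [hD]; simp [polyOf, eval_finsetSum]
    rw [eval_eq_sum_range' hdeg] at h1
    simp only [one_pow, mul_one] at h1
    have h2 : ((m : ℝ) ^ 2) ≤ ∑ k ∈ Finset.range (2 * m), ‖(D ^ 2).coeff k‖ := by
      have := norm_sum_le (Finset.range (2 * m)) (fun k => (D ^ 2).coeff k)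
      rw [h1] at this
      simpa using this
    have h3 := sq_sum_le_card_mul_sum_sq (s := Finset.range (2 * m))
      (f := fun k => ‖(D ^ 2).coeff k‖)
    rw [← nrm2_eq_sum hdeg, ← hc, Finset.card_range] at h3
    have h4 : ((m : ℝ) ^ 2) ^ 2 ≤ 2 * m * c := by
      refine (pow_le_pow_left₀ (by positivity) h2 2).trans ?_
      push_cast at h3
      exact h3
    have h5 : (m : ℝ) * (m ^ 3 / 2) ≤ m * c := by nlinarith
    exact le_of_mul_le_mul_left h5 hmpos
  have hcpos : 0 < c := lt_of_lt_of_le (by positivity) hcl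
  obtain ⟨H, hH0, hH⟩ := exists_completion (D ^ 2)
  rw [← hc] at hH
  have hev : ∀ t, ‖evT (D ^ 2) t‖ = ‖evT D t‖ ^ 2 := by intro t; simp [evT]
  set K : Tor → ℝ := fun t => ‖evT (D ^ 2) t‖ ^ 2 / c with hK
  have hKc : Continuous K := by
    have := evT_continuous (D ^ 2)
    fun_prop
  have hK0 : ∀ t, 0 ≤ K t := fun t => by positivity
  have hKb : ∀ t, K t ≤ 2 * m := by
    intro t
    rw [hK]; simp only
    rw [div_le_iff₀ hcpos, hev]
    have h1 : (‖evT D t‖ ^ 2) ^ 2 ≤ ((m : ℝ) ^ 2) ^ 2 := by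
      gcongr; exact hDb t
    nlinarith
  have hKi : ∫ t, K t ∂muT = 1 := by
    rw [hK]; simp only
    rw [integral_div]
    exact div_self hcpos.ne'
  have hre : ∀ t, (evT (C ((1 / c : ℝ) : ℂ) * H) t).re = K t - 1 := by
    intro t
    have : evT (C ((1 / c : ℝ) : ℂ) * H) t = ((1 / c : ℝ) : ℂ) * evT H t := by simp [evT]
    rw [this, Complex.re_ofReal_mul, hH, hK]
    field_simp
  refine ⟨C ((1 / c : ℝ) : ℂ) * H, K, by simp [hH0], hKc, hK0, hKb, hre, ?_, ?_⟩
  · have h1 : ∀ t, √(K t) = ‖evT D t‖ ^ 2 / √c := by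
      intro t
      rw [hK]; simp only
      rw [Real.sqrt_div (by positivity), Real.sqrt_sq (by positivity), hev]
    simp_rw [h1]
    rw [integral_div]
    change nrm2 D / √c ≤ _
    rw [hDn]
    apply Real.le_sqrt_of_sq_le
    rw [div_pow, Real.sq_sqrt hcpos.le, div_le_div_iff₀ hcpos hmpos]
    nlinarith
  · set G := C ((1 / c : ℝ) : ℂ) * H with hG
    have hGc := evT_continuous G
    have h1 : ∀ t, ‖evT G t‖ ^ 2 = 2 * (K t - 1) ^ 2 - (evT (G ^ 2) t).re := by
      intro t
      rw [← hre t]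
      have : evT (G ^ 2) t = evT G t ^ 2 := by simp [evT]
      rw [this, ← Complex.normSq_eq_norm_sq, Complex.normSq_apply, pow_two (evT G t), Complex.mul_re]
      ring
    unfold nrm2
    simp_rw [h1]
    have hGc2 := evT_continuous (G ^ 2)
    rw [integral_sub (cont_integrable (by fun_prop)) (cont_integrable (by fun_prop)),
      integral_re_evT]
    have h2 : ((G ^ 2).coeff 0).re = 0 := by
      have : G.coeff 0 = 0 := by simp [hG, hH0]
      rw [pow_two, mul_coeff_zero, this]; simp
    rw [h2, sub_zero]
    have h3 : ∫ t, 2 * (K t - 1) ^ 2 ∂muT ≤ ∫ t, (2 * (2 * m) * K t - 4 * K t + 2) ∂muT := by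
      apply integral_mono (cont_integrable (by fun_prop)) (cont_integrable (by fun_prop))
      intro t
      simp only
      nlinarith [hK0 t, hKb t, mul_le_mul_of_nonneg_left (hKb t) (hK0 t)]
    refine h3.trans ?_
    rw [integral_add (cont_integrable (by fun_prop)) (cont_integrable (by fun_prop)),
      integral_sub (cont_integrable (by fun_prop)) (cont_integrable (by fun_prop)),
      integral_const_mul, integral_const_mul, hKi]
    simp
    linarith

end PartOne


section PartTwo
open Polynomial

lemma norm_one_add_le (x : ℂ) : ‖1 + x‖ ≤ Real.exp (x.re + ‖x‖ ^ 2 / 2) := by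
  have h : ‖1 + x‖ ^ 2 ≤ (Real.exp (x.re + ‖x‖ ^ 2 / 2)) ^ 2 := by
    rw [nsq_add, ← Real.exp_nat_mul]
    have := Real.add_one_le_exp (2 * x.re + ‖x‖ ^ 2)
    simp only [norm_one, map_one, one_mul]
    have e : ((2 : ℕ) : ℝ) * (x.re + ‖x‖ ^ 2 / 2) = 2 * x.re + ‖x‖ ^ 2 := by push_cast; ring
    rw [e]
    linarith
  exact le_of_sq_le_sq h (Real.exp_pos _).le

lemma exists_phi (l T n' : ℕ) (hl : 1 ≤ l) (hT : 1 ≤ T) (hn : 1 ≤ n') :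
    ∃ (φ : ℂ[X]) (K : Tor → ℝ), φ.coeff 0 = 1 ∧ Continuous K ∧ (∀ t, 0 ≤ K t) ∧
    (∀ t, ‖evT φ t‖ ≤ Real.exp (-(1 / (n' : ℝ)) + K t + 1 / ((l : ℝ) * n'))) ∧
    (∫ t, √(K t) ∂muT) ≤ √(2 / T) / n' ∧
    nrm2 (φ - 1) ≤ 4 * T / n' * Real.exp (4 * T + 2) := by
  have hlp : (0 : ℝ) < l := by exact_mod_cast hl
  have hTp : (0 : ℝ) < T := by exact_mod_cast hT
  have hnp : (0 : ℝ) < n' := by exact_mod_cast hn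
  obtain ⟨H, K, hH0, hKc, hK0, hKb, hre, hsq, hnrm⟩ := kernel (T * n') (Nat.mul_pos hT hn)
  push_cast at hKb hsq hnrm
  have hHc := evT_continuous H
  obtain ⟨R, hR⟩ : ∃ R : ℝ, ∀ t, ‖evT H t‖ ≤ R := by
    obtain ⟨R, hR⟩ := isCompact_univ.exists_bound_of_continuousOn hHc.continuousOn
    exact ⟨R, fun t => hR t trivial⟩
  set u : ℝ := 1 / n' with hu
  have hup : 0 < u := by positivity
  obtain ⟨M, hM⟩ := exists_nat_ge (max 1 ((u * R) ^ 2 * (l * n')))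
  have hM1 : (1 : ℝ) ≤ M := (le_max_left _ _).trans hM
  have hM2 : (u * R) ^ 2 * (l * n') ≤ M := (le_max_right _ _).trans hM
  have hMp : (0 : ℝ) < M := by linarith
  set w : Tor → ℂ := fun t => (u : ℂ) * evT H t with hw
  have hwn : ∀ t, ‖w t‖ ≤ u * R := by
    intro t; rw [hw]; simp only [norm_mul, Complex.norm_real, Real.norm_eq_abs, abs_of_pos hup]
    exact mul_le_mul_of_nonneg_left (hR t) hup.le
  have hwre : ∀ t, (w t).re = u * K t - u := by
    intro t; rw [hw]; simp only; rw [Complex.re_ofReal_mul, hre]; ring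
  have hwM : ∀ t, ‖w t‖ ^ 2 / M ≤ 1 / (l * n') := by
    intro t
    rw [div_le_div_iff₀ hMp (by positivity)]
    have : ‖w t‖ ^ 2 ≤ (u * R) ^ 2 := pow_le_pow_left₀ (norm_nonneg _) (hwn t) 2
    nlinarith [mul_le_mul_of_nonneg_right this (by positivity : (0 : ℝ) ≤ l * n')]
  have hln1 : 1 / ((l : ℝ) * n') ≤ 1 := by
    rw [div_le_one (by positivity)]
    have : 1 ≤ l * n' := Nat.mul_pos hl hn
    exact_mod_cast this
  set φ : ℂ[X] := (1 + C ((u / M : ℝ) : ℂ) * H) ^ M with hφ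
  have hev : ∀ t, evT φ t = (1 + w t / M) ^ M := by
    intro t; rw [hφ, hw]; simp [evT]; ring
  have hbase : ∀ t, ‖1 + w t / M‖ ≤ Real.exp ((w t).re / M + ‖w t‖ ^ 2 / (2 * M ^ 2)) := by
    intro t
    refine (norm_one_add_le _).trans (le_of_eq ?_)
    congr 1
    have e1 : (w t / (M : ℂ)).re = (w t).re / M := by
      rw [← Complex.ofReal_natCast, Complex.div_ofReal_re]
    rw [e1, norm_div, Complex.norm_natCast, div_pow]
    field_simp
  refine ⟨φ, fun t => u * K t, ?_, by fun_prop, fun t => mul_nonneg hup.le (hK0 t), ?_, ?_, ?_⟩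
  · rw [hφ, coeff_zero_eq_eval_zero]
    rw [coeff_zero_eq_eval_zero] at hH0
    simp [hH0]
  · intro t
    rw [hev, norm_pow]
    refine (pow_le_pow_left₀ (norm_nonneg _) (hbase t) M).trans ?_
    rw [← Real.exp_nat_mul]
    apply Real.exp_le_exp.2
    have e : (M : ℝ) * ((w t).re / M + ‖w t‖ ^ 2 / (2 * M ^ 2)) = (w t).re + ‖w t‖ ^ 2 / M / 2 := by
      field_simp
    rw [e, hwre]
    have := hwM t
    have h0 : 0 ≤ 1 / ((l : ℝ) * n') := by positivity
    linarith
  · have : ∀ t, √(u * K t) = √u * √(K t) := fun t => Real.sqrt_mul hup.le _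
    simp_rw [this]
    rw [integral_const_mul]
    refine (mul_le_mul_of_nonneg_left hsq (Real.sqrt_nonneg _)).trans (le_of_eq ?_)
    rw [← Real.sqrt_mul hup.le, hu]
    have : 1 / (n' : ℝ) * (2 / (T * n')) = (2 / T) / (n' ^ 2) := by field_simp
    rw [this, Real.sqrt_div (by positivity), Real.sqrt_sq hnp.le]
  · have hpt : ∀ t, ‖evT (φ - 1) t‖ ^ 2 ≤ ‖evT H t‖ ^ 2 * (u ^ 2 * Real.exp (4 * T + 2)) := by
      intro t
      have h1 : evT (φ - 1) t = (1 + w t / M) ^ M - 1 := by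
        rw [← hev]; simp [evT]
      have ha : ‖1 + w t / M‖ ≤ Real.exp ((2 * T + 1) / M) := by
        refine (hbase t).trans (Real.exp_le_exp.2 ?_)
        have e : (w t).re / M + ‖w t‖ ^ 2 / (2 * M ^ 2) = ((w t).re + ‖w t‖ ^ 2 / M / 2) / M := by
          field_simp
        rw [e]
        apply div_le_div_of_nonneg_right _ hMp.le
        rw [hwre]
        have h3 : u * K t ≤ 2 * T := by
          have := mul_le_mul_of_nonneg_left (hKb t) hup.le
          refine this.trans (le_of_eq ?_)
          rw [hu]; field_simp
        have := hwM t
        linarith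
      have h2 : ‖(1 + w t / M) ^ M - 1‖ ≤ ‖w t‖ * Real.exp (2 * T + 1) := by
        have hg := mul_geom_sum (1 + w t / (M : ℂ)) M
        rw [← hg, norm_mul, add_sub_cancel_left, norm_div, Complex.norm_natCast]
        have hs : ‖∑ i ∈ Finset.range M, (1 + w t / (M : ℂ)) ^ i‖ ≤ M * Real.exp (2 * T + 1) := by
          refine (norm_sum_le _ _).trans ?_
          have : ∀ i ∈ Finset.range M, ‖(1 + w t / (M : ℂ)) ^ i‖ ≤ Real.exp (2 * T + 1) := by
            intro i hi
            rw [norm_pow]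
            refine (pow_le_pow_left₀ (norm_nonneg _) ha i).trans ?_
            rw [← Real.exp_nat_mul]
            apply Real.exp_le_exp.2
            have hi' : (i : ℝ) ≤ M := by exact_mod_cast (Finset.mem_range.1 hi).le
            rw [mul_div_assoc', div_le_iff₀ hMp]
            nlinarith
          refine (Finset.sum_le_card_nsmul _ _ _ this).trans ?_
          simp
        calc ‖w t‖ / M * _ ≤ ‖w t‖ / M * (M * Real.exp (2 * T + 1)) :=
              mul_le_mul_of_nonneg_left hs (by positivity)
          _ = _ := by field_simp
      rw [h1]
      refine (pow_le_pow_left₀ (norm_nonneg _) h2 2).trans (le_of_eq ?_)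
      have hwt : ‖w t‖ = u * ‖evT H t‖ := by
        rw [hw]; simp only [norm_mul, Complex.norm_real, Real.norm_eq_abs, abs_of_pos hup]
      rw [mul_pow, ← Real.exp_nat_mul, hwt, mul_pow]
      have : ((2 : ℕ) : ℝ) * (2 * T + 1) = 4 * T + 2 := by push_cast; ring
      rw [this]; ring
    have hc1 := evT_continuous (φ - 1)
    have h4 : nrm2 (φ - 1) ≤ nrm2 H * (u ^ 2 * Real.exp (4 * T + 2)) := by
      unfold nrm2
      rw [← integral_mul_const]
      exact integral_mono (cont_integrable (by fun_prop)) (cont_integrable (by fun_prop)) hpt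
    refine h4.trans ((mul_le_mul_of_nonneg_right hnrm (by positivity)).trans (le_of_eq ?_))
    rw [hu]; field_simp

/-- dilation factors -/
def dilN (φ : ℂ[X]) (j : ℕ) : ℕ := (φ.natDegree + 1) ^ j

/-- lacunary product -/
noncomputable def prodF (φ : ℂ[X]) : ℕ → ℂ[X]
  | 0 => 1
  | j + 1 => prodF φ j * expand ℂ (dilN φ j) φ

lemma dilN_pos (φ : ℂ[X]) (j : ℕ) : 0 < dilN φ j := by unfold dilN; positivity

lemma prodF_natDegree (φ : ℂ[X]) (j : ℕ) : (prodF φ j).natDegree < dilN φ j := by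
  induction j with
  | zero => simp [prodF, dilN]
  | succ j ih =>
    have h1 := natDegree_mul_le (p := prodF φ j) (q := expand ℂ (dilN φ j) φ)
    rw [natDegree_expand] at h1
    have h2 : dilN φ (j + 1) = dilN φ j + φ.natDegree * dilN φ j := by
      unfold dilN; ring
    rw [h2]
    exact lt_of_le_of_lt h1 (by omega)

lemma nrm2_X_mul (Q : ℂ[X]) : nrm2 (X * Q) = nrm2 Q := by
  have := nrm2_C_add_X_mul 0 Q
  simpa using this

lemma exists_Q {φ : ℂ[X]} (h : φ.coeff 0 = 1) : ∃ Q, φ - 1 = X * Q := by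
  have : X ∣ φ - 1 := by rw [X_dvd_iff]; simp [h]
  exact this

lemma nrm2_phi {φ : ℂ[X]} (h : φ.coeff 0 = 1) : nrm2 φ = 1 + nrm2 (φ - 1) := by
  obtain ⟨Q, hQ⟩ := exists_Q h
  have : φ = C 1 + X * Q := by rw [← hQ]; simp
  rw [hQ, nrm2_X_mul]
  conv_lhs => rw [this]
  rw [nrm2_C_add_X_mul]; simp

lemma nrm2_prodF {φ : ℂ[X]} (h : φ.coeff 0 = 1) (j : ℕ) :
    nrm2 (prodF φ j) = (1 + nrm2 (φ - 1)) ^ j := by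
  induction j with
  | zero => have := nrm2_C_mul 1 1; simp [prodF, nrm2, evT]
  | succ j ih =>
    rw [prodF, nrm2_mul_expand (prodF_natDegree φ j), ih, nrm2_phi h, pow_succ]

lemma truncP_add (K : ℕ) (P Q : ℂ[X]) : truncP K (P + Q) = truncP K P + truncP K Q := by
  ext k; simp only [coeff_add, coeff_truncP]; split_ifs <;> simp

lemma prodF_succ (φ : ℂ[X]) (j : ℕ) :
    prodF φ (j + 1) = prodF φ j + prodF φ j * expand ℂ (dilN φ j) (φ - 1) := by
  rw [prodF, map_sub, map_one]; ring

lemma prodF_coeff_zero {φ : ℂ[X]} (h : φ.coeff 0 = 1) (j : ℕ) : (prodF φ j).coeff 0 = 1 := by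
  induction j with
  | zero => simp [prodF]
  | succ j ih =>
    rw [prodF, mul_coeff_zero, ih, coeff_expand (dilN_pos φ j)]; simp [h]

lemma trunc_prodF {φ : ℂ[X]} (h : φ.coeff 0 = 1) (n : ℕ) (K : ℕ) (hK : 1 ≤ K) (j : ℕ) (hj : j ≤ n) :
    ∃ i ≤ j, nrm2 (truncP K (prodF φ j) - prodF φ i) ≤ (1 + nrm2 (φ - 1)) ^ n * nrm2 (φ - 1) := by
  have hnn := nrm2_nonneg (φ - 1)
  induction j with
  | zero =>
    refine ⟨0, le_rfl, ?_⟩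
    rw [truncP_of_lt (by simp [prodF]; omega), sub_self]
    have : nrm2 0 = 0 := by simp [nrm2, evT]
    rw [this]; positivity
  | succ j ih =>
    by_cases hKN : K ≤ dilN φ j
    · obtain ⟨i, hi, hb⟩ := ih (by omega)
      refine ⟨i, by omega, ?_⟩
      have : truncP K (prodF φ (j + 1)) = truncP K (prodF φ j) := by
        rw [prodF_succ, truncP_add]
        have : truncP K (prodF φ j * expand ℂ (dilN φ j) (φ - 1)) = 0 := by
          obtain ⟨Q, hQ⟩ := exists_Q h
          have e : prodF φ j * expand ℂ (dilN φ j) (φ - 1) =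
              X ^ (dilN φ j) * (prodF φ j * expand ℂ (dilN φ j) Q) := by
            rw [hQ, map_mul, expand_X]; ring
          rw [e]
          ext k
          rw [coeff_truncP]
          split_ifs with hk
          · rw [coeff_X_pow_mul', if_neg (by omega)]; simp
          · simp
        rw [this, add_zero]
      rw [this]; exact hb
    · refine ⟨j, by omega, ?_⟩
      have hdeg := prodF_natDegree φ j
      rw [prodF_succ, truncP_add, truncP_of_lt (P := prodF φ j) (by omega), add_sub_cancel_left]
      refine (nrm2_truncP_le _ _).trans ?_
      rw [nrm2_mul_expand hdeg, nrm2_prodF h]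
      apply mul_le_mul_of_nonneg_right _ hnn
      exact pow_le_pow_right₀ (by linarith) (by omega)

lemma norm_prodF_le {φ : ℂ[X]} {g : Tor → ℝ} (hg : ∀ t, ‖evT φ t‖ ≤ Real.exp (g t)) (j : ℕ) (t : Tor) :
    ‖evT (prodF φ j) t‖ ≤ Real.exp (∑ i ∈ Finset.range j, g (dilN φ i • t)) := by
  induction j with
  | zero => simp [prodF, evT]
  | succ j ih =>
    have : evT (prodF φ (j + 1)) t = evT (prodF φ j) t * evT φ (dilN φ j • t) := by
      rw [← evT_expand]; simp [prodF, evT]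
    rw [this, norm_mul, Finset.sum_range_succ, Real.exp_add]
    exact mul_le_mul ih (hg _) (norm_nonneg _) (Real.exp_pos _).le

lemma markov {g : Tor → ℝ} (hg : Continuous g) (h0 : ∀ t, 0 ≤ g t) {b : ℝ} (hb : ∫ t, g t ∂muT ≤ b) :
    muT {t | 1 ≤ g t} ≤ ENNReal.ofReal b := by
  have := mul_meas_ge_le_integral_of_nonneg (μ := muT) (Eventually.of_forall h0) (cont_integrable hg) 1
  rw [one_mul] at this
  rw [← ofReal_measureReal]
  exact ENNReal.ofReal_le_ofReal (this.trans hb)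

theorem exists_F (δ : ℝ) (hδ : 0 < δ) : ∃ F : ℂ[X], F.coeff 0 = 1 ∧
    muT {t | δ < ‖evT F t‖} ≤ ENNReal.ofReal δ ∧
    ∀ K, muT {t | 9 < ‖evT (truncP K F) t‖} ≤ ENNReal.ofReal δ := by
  obtain ⟨l, hl⟩ : ∃ l : ℕ, 1 ≤ l ∧ Real.exp (2 - l) ≤ δ := by
    have h1 : Tendsto (fun l : ℕ => Real.exp (2 - (l : ℝ))) atTop (𝓝 0) := by
      apply Real.tendsto_exp_atBot.comp
      exact tendsto_atBot_add_const_left _ 2 (tendsto_neg_atTop_atBot.comp tendsto_natCast_atTop_atTop)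
    obtain ⟨l, h2, h3⟩ := ((h1.eventually_le_const hδ).and (eventually_ge_atTop 1)).exists
    exact ⟨l, h3, h2⟩
  obtain ⟨hl1, hle⟩ := hl
  obtain ⟨T, hT1, hTe⟩ : ∃ T : ℕ, 1 ≤ T ∧ l * √(2 / (T : ℝ)) ≤ δ / 2 := by
    have h1 : Tendsto (fun T : ℕ => l * √(2 / (T : ℝ))) atTop (𝓝 (l * √0)) := by
      apply Tendsto.const_mul
      exact (Real.continuous_sqrt.tendsto 0).comp (tendsto_const_div_atTop_nhds_zero_nat 2)
    rw [Real.sqrt_zero, mul_zero] at h1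
    obtain ⟨l, h2, h3⟩ := ((h1.eventually_le_const (half_pos hδ)).and (eventually_ge_atTop 1)).exists
    exact ⟨l, h3, h2⟩
  set C' : ℝ := 4 * T * Real.exp (4 * T + 2) with hC'
  obtain ⟨n', hn1, hne⟩ : ∃ n' : ℕ, 1 ≤ n' ∧ Real.exp (l * C') * C' / n' ≤ δ / 2 := by
    have h1 := tendsto_const_div_atTop_nhds_zero_nat (Real.exp (l * C') * C')
    obtain ⟨l, h2, h3⟩ := ((h1.eventually_le_const (half_pos hδ)).and (eventually_ge_atTop 1)).exists
    exact ⟨l, h3, h2⟩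
  have hlp : (0 : ℝ) < l := by exact_mod_cast hl1
  have hTp : (0 : ℝ) < T := by exact_mod_cast hT1
  have hnp : (0 : ℝ) < n' := by exact_mod_cast hn1
  obtain ⟨φ, K, hφ0, hKc, hK0, hb, hsq, hnrm⟩ := exists_phi l T n' hl1 hT1 hn1
  set n := l * n' with hn
  have hκ : nrm2 (φ - 1) ≤ C' / n' := by
    refine hnrm.trans (le_of_eq ?_); rw [hC']; ring
  have hκ0 := nrm2_nonneg (φ - 1)
  have hη : (1 + nrm2 (φ - 1)) ^ n * nrm2 (φ - 1) ≤ δ / 2 := by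
    refine le_trans ?_ hne
    rw [mul_div_assoc]
    apply mul_le_mul _ hκ hκ0 (Real.exp_pos _).le
    have h1 : 1 + nrm2 (φ - 1) ≤ Real.exp (C' / n') := by
      have := Real.add_one_le_exp (C' / n'); linarith
    refine (pow_le_pow_left₀ (by linarith) h1 n).trans (le_of_eq ?_)
    rw [← Real.exp_nat_mul, hn]; push_cast
    congr 1; field_simp
  set Y : Tor → ℝ := fun t => ∑ i ∈ Finset.range n, √(K (dilN φ i • t)) with hY
  have hYc : Continuous Y := by fun_prop
  have hYi : ∫ t, Y t ∂muT ≤ δ / 2 := by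
    rw [hY, integral_finsetSum _ (fun i _ => cont_integrable (by fun_prop))]
    have : ∀ i ∈ Finset.range n, ∫ t, √(K (dilN φ i • t)) ∂muT ≤ √(2 / T) / n' := by
      intro i _
      rw [integral_nsmul (dilN_pos φ i).ne' (g := fun t => √(K t)) (by fun_prop)]
      exact hsq
    refine (Finset.sum_le_card_nsmul _ _ _ this).trans (le_trans (le_of_eq ?_) hTe)
    rw [Finset.card_range, hn, nsmul_eq_mul]; push_cast; field_simp
  have hYm := markov hYc (fun t => Finset.sum_nonneg fun i _ => Real.sqrt_nonneg _) hYi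
  have hgood : ∀ t, Y t < 1 → ∀ j ≤ n, ‖evT (prodF φ j) t‖ ≤ Real.exp (2 - j / n') := by
    intro t ht j hj
    refine (norm_prodF_le hb j t).trans (Real.exp_le_exp.2 ?_)
    rw [Finset.sum_add_distrib, Finset.sum_add_distrib]
    simp only [Finset.sum_const, Finset.card_range, nsmul_eq_mul]
    have h1 : ∑ i ∈ Finset.range j, K (dilN φ i • t) ≤ Y t := by
      refine (Finset.sum_le_sum_of_subset_of_nonneg (Finset.range_mono hj)
        (fun i _ _ => hK0 _)).trans ?_
      apply Finset.sum_le_sum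
      intro i hi
      have hs : √(K (dilN φ i • t)) ≤ 1 := by
        refine le_trans ?_ ht.le
        exact Finset.single_le_sum (f := fun i => √(K (dilN φ i • t)))
          (fun i _ => Real.sqrt_nonneg _) hi
      have h2 := Real.sq_sqrt (hK0 (dilN φ i • t))
      nlinarith [Real.sqrt_nonneg (K (dilN φ i • t))]
    have h3 : (j : ℝ) * (1 / (l * n')) ≤ 1 := by
      rw [mul_one_div, div_le_one (by positivity)]
      have : (j : ℝ) ≤ n := by exact_mod_cast hj
      rw [hn] at this; push_cast at this; exact this
    have h4 : (j : ℝ) * -(1 / n') = - (j / n') := by ring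
    rw [h4]; linarith
  refine ⟨prodF φ n, prodF_coeff_zero hφ0 n, ?_, ?_⟩
  · refine le_trans (measure_mono ?_) (hYm.trans (ENNReal.ofReal_le_ofReal (by linarith)))
    intro t ht
    simp only [Set.mem_ofPred_eq] at ht ⊢
    by_contra hc
    have := hgood t (not_le.1 hc) n le_rfl
    have e : (2 : ℝ) - (n : ℝ) / n' = 2 - l := by rw [hn]; push_cast; field_simp
    rw [e] at this
    linarith
  · intro k
    rcases Nat.eq_zero_or_pos k with rfl | hk
    · have : {t | (9 : ℝ) < ‖evT (truncP 0 (prodF φ n)) t‖} = ∅ := by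
        ext t; simp [truncP, polyOf, evT]
      rw [this]; simp
    · obtain ⟨i, hi, hbi⟩ := trunc_prodF hφ0 n k hk n le_rfl
      set g := truncP k (prodF φ n) - prodF φ i with hg
      have hgc := evT_continuous g
      have hm2 := markov (g := fun t => ‖evT g t‖ ^ 2) (by fun_prop) (fun t => by positivity)
        (hbi.trans hη)
      have hsub : {t | (9 : ℝ) < ‖evT (truncP k (prodF φ n)) t‖} ⊆
          {t | 1 ≤ Y t} ∪ {t | 1 ≤ ‖evT g t‖ ^ 2} := by
        intro t ht
        simp only [Set.mem_ofPred_eq, Set.mem_union] at ht ⊢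
        by_contra hc
        push Not at hc
        have h1 := hgood t hc.1 i hi
        have h2 : ‖evT g t‖ ≤ 1 := by
          by_contra h; push Not at h; nlinarith [hc.2]
        have h3 : evT (truncP k (prodF φ n)) t = evT (prodF φ i) t + evT g t := by
          rw [hg]; simp [evT]
        have h4 : Real.exp (2 - i / n') ≤ 8 := by
          have h5 : Real.exp (2 - i / n') ≤ Real.exp 2 := Real.exp_le_exp.2 (by
            have : 0 ≤ (i : ℝ) / n' := by positivity
            linarith)
          have h6 : Real.exp 2 = Real.exp 1 * Real.exp 1 := by rw [← Real.exp_add]; norm_num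
          have := Real.exp_one_lt_d9
          nlinarith [Real.exp_pos 1]
        rw [h3] at ht
        have := norm_add_le (evT (prodF φ i) t) (evT g t)
        linarith
      refine (measure_mono hsub).trans ((measure_union_le _ _).trans ((add_le_add hYm hm2).trans ?_))
      rw [← ENNReal.ofReal_add (by linarith) (by linarith), add_halves]

end PartTwo


section PartThree

/-- `l` is an admissible sequence up to index `n`. -/
def GoodUpTo (ε : ℕ → ℝ) (n : ℕ) (l : ℕ → ℤ) : Prop :=
  1 ≤ n ∧ (∀ i, 1 ≤ i → i ≤ n → 0 < l i) ∧
    ∀ i, 1 ≤ i → i < n → (1 + ε i) * (l i : ℝ) < (l (i + 1) : ℝ)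

lemma good_pad {ε : ℕ → ℝ} (hε : ∀ n, 0 < ε n) {n : ℕ} {l : ℕ → ℤ} (h : GoodUpTo ε n l)
    (k : ℕ) : ∃ l', GoodUpTo ε (n + k) l' ∧ ∀ i ≤ n, l' i = l i := by
  induction k with
  | zero => exact ⟨l, h, fun _ _ => rfl⟩
  | succ k ih =>
    obtain ⟨l', ⟨h1, h2, h3⟩, h4⟩ := ih
    obtain ⟨x, hx⟩ := exists_int_gt ((1 + ε (n + k)) * (l' (n + k) : ℝ))
    refine ⟨Function.update l' (n + k + 1) x, ⟨by omega, ?_, ?_⟩, ?_⟩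
    · intro i hi hi'
      rcases Nat.lt_or_ge i (n + k + 1) with hlt | hge
      · rw [Function.update_of_ne (by omega)]; exact h2 i hi (by omega)
      · have : i = n + k + 1 := by omega
        subst this
        rw [Function.update_self]
        have hp : (0 : ℝ) < l' (n + k) := by exact_mod_cast h2 (n + k) h1 le_rfl
        have : (0 : ℝ) < x := lt_trans (mul_pos (by linarith [hε (n + k)]) hp) hx
        exact_mod_cast this
    · intro i hi hi'
      rw [Function.update_of_ne (by omega)]
      rcases Nat.lt_or_ge i (n + k) with hlt | hge
      · rw [Function.update_of_ne (by omega)]; exact h3 i hi hlt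
      · have : i = n + k := by omega
        subst this
        rw [Function.update_self]; exact hx
    · intro i hi
      rw [Function.update_of_ne (by omega)]; exact h4 i hi

lemma good_block {ε : ℕ → ℝ} (hε : ∀ n, 0 < ε n) {n : ℕ} {l : ℕ → ℤ} (h : GoodUpTo ε n l)
    (D : ℤ) (d m : ℕ) (hs : ∀ i ≥ n, ε i < 1 / (2 * ((d : ℝ) + 1))) :
    ∃ l', GoodUpTo ε (n + d) l' ∧ (∀ i ≤ n, l' i = l i) ∧
      ∃ S : ℕ, 0 < S ∧ ∀ b : ℕ, 1 ≤ b → b ≤ d →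
        ((m : ℤ) < S * b + D ∧ l' (n + b) = S * b + D) := by
  obtain ⟨h1, h2, h3⟩ := h
  obtain ⟨S, hS⟩ := exists_nat_gt (2 * |(D : ℝ)| + m + (1 + ε n) * (l n : ℝ))
  have hln : (0 : ℝ) < l n := by exact_mod_cast h2 n h1 le_rfl
  have hp : 0 < (1 + ε n) * (l n : ℝ) := mul_pos (by linarith [hε n]) hln
  have hm0 : (0 : ℝ) ≤ m := by positivity
  have hD0 := abs_nonneg (D : ℝ)
  have hD1 := neg_abs_le (D : ℝ)
  have hD2 := le_abs_self (D : ℝ)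
  have hSp : (0 : ℝ) < S := by linarith
  have hblk : ∀ b : ℕ, 1 ≤ b → (m : ℝ) + (1 + ε n) * (l n : ℝ) < S * b + D := by
    intro b hb
    have : (1 : ℝ) ≤ b := by exact_mod_cast hb
    nlinarith
  have hblkm : ∀ b : ℕ, 1 ≤ b → (m : ℤ) < S * b + D := by
    intro b hb
    have := hblk b hb
    have h' : (m : ℝ) < S * b + D := by linarith
    exact_mod_cast h'
  refine ⟨fun i => if i ≤ n then l i else S * ((i - n : ℕ) : ℤ) + D, ⟨by omega, ?_, ?_⟩, ?_, S,
    by exact_mod_cast hSp, ?_⟩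
  · intro i hi hi'
    by_cases hin : i ≤ n
    · simp only [hin, if_true]; exact h2 i hi hin
    · simp only [hin, if_false]
      have := hblkm (i - n) (by omega)
      omega
  · intro i hi hi'
    beta_reduce
    rcases lt_trichotomy i n with hin | hin | hin
    · rw [if_pos hin.le, if_pos (by omega)]; exact h3 i hi hin
    · subst hin
      rw [if_pos le_rfl, if_neg (by omega)]
      have := hblk 1 le_rfl
      rw [Nat.add_sub_cancel_left]
      push_cast at this ⊢
      linarith
    · rw [if_neg (by omega), if_neg (by omega)]
      obtain ⟨b, rfl⟩ : ∃ b, i = n + b := ⟨i - n, by omega⟩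
      have e1 : n + b - n = b := by omega
      have e2 : n + b + 1 - n = b + 1 := by omega
      rw [e1, e2]
      push_cast
      have hb : (b : ℝ) ≤ d := by
        have : b ≤ d := by omega
        exact_mod_cast this
      have hb0 : (0 : ℝ) ≤ b := by positivity
      have he := hs (n + b) (by omega)
      have he0 := hε (n + b)
      rw [lt_div_iff₀ (by positivity)] at he
      have k1 : ε (n + b) * (2 * b) ≤ 1 := by nlinarith
      have k2 : ε (n + b) ≤ 1 := by nlinarith
      have k3 : ε (n + b) * D ≤ |(D : ℝ)| := by nlinarith
      have k4 : ε (n + b) * b * S ≤ S / 2 := by nlinarith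
      nlinarith
  · intro i hi; simp [hi]
  · intro b hb hbd
    refine ⟨hblkm b hb, ?_⟩
    simp only
    rw [if_neg (by omega), Nat.add_sub_cancel_left]

lemma good_step {ε : ℕ → ℝ} (hε : ∀ n, 0 < ε n) (hlim : Tendsto ε atTop (𝓝 0))
    {n : ℕ} {l : ℕ → ℤ} (h : GoodUpTo ε n l) (D : ℤ) (d m : ℕ) :
    ∃ n' l', GoodUpTo ε n' l' ∧ n < n' ∧ (∀ i ≤ n, l' i = l i) ∧
      ∃ S : ℕ, 0 < S ∧ ∀ b : ℕ, 1 ≤ b → b ≤ d →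
        ((m : ℤ) < S * b + D ∧ ∃ i, 1 ≤ i ∧ i ≤ n' ∧ l' i = S * b + D) := by
  have hev := (hlim.eventually_lt_const (u := 1 / (2 * ((d : ℝ) + 1))) (by positivity))
  obtain ⟨k, hk⟩ := eventually_atTop.1 hev
  obtain ⟨l1, g1, a1⟩ := good_pad hε h (k + 1)
  obtain ⟨l2, g2, a2, S, hS, hb⟩ := good_block hε g1 D d m (fun i hi => hk i (by omega))
  refine ⟨n + (k + 1) + d, l2, g2, by omega, fun i hi => by rw [a2 i (by omega), a1 i hi], S, hS, ?_⟩
  intro b hb1 hbd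
  exact ⟨(hb b hb1 hbd).1, n + (k + 1) + b, by omega, by omega, (hb b hb1 hbd).2⟩

theorem exists_lambda {ε : ℕ → ℝ} (hε : ∀ n, 0 < ε n) (hlim : Tendsto ε atTop (𝓝 0))
    (D : ℕ → ℤ) (d m : ℕ → ℕ) :
    ∃ l : ℕ → ℤ, (∀ n, 1 ≤ n → 0 < l n) ∧
      (∀ n, 1 ≤ n → (1 + ε n) * (l n : ℝ) < (l (n + 1) : ℝ)) ∧
      ∀ j, ∃ S : ℕ, 0 < S ∧ ∀ b : ℕ, 1 ≤ b → b ≤ d j →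
        ((m j : ℤ) < S * b + D j ∧ ∃ i, 1 ≤ i ∧ l i = S * b + D j) := by
  let State := {p : ℕ × (ℕ → ℤ) // GoodUpTo ε p.1 p.2}
  have hstep : ∀ (j : ℕ) (s : State), ∃ s' : State, s.1.1 < s'.1.1 ∧
      (∀ i ≤ s.1.1, s'.1.2 i = s.1.2 i) ∧
      ∃ S : ℕ, 0 < S ∧ ∀ b : ℕ, 1 ≤ b → b ≤ d j →
        ((m j : ℤ) < S * b + D j ∧ ∃ i, 1 ≤ i ∧ i ≤ s'.1.1 ∧ s'.1.2 i = S * b + D j) := by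
    intro j s
    obtain ⟨n', l', h1, h2, h3, h4⟩ := good_step hε hlim s.2 (D j) (d j) (m j)
    exact ⟨⟨(n', l'), h1⟩, h2, h3, h4⟩
  choose next hn1 hn2 hn3 using hstep
  let s0 : State := ⟨(1, fun _ => 1), le_rfl, fun _ _ _ => by norm_num, fun i h1 h2 => by omega⟩
  let sq : ℕ → State := fun k => Nat.rec s0 (fun j s => next j s) k
  have hsq : ∀ k, sq (k + 1) = next k (sq k) := fun k => rfl
  have hlen : ∀ k, k + 1 ≤ (sq k).1.1 := by
    intro k
    induction k with
    | zero => exact le_rfl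
    | succ k ih => rw [hsq]; have := hn1 k (sq k); omega
  have hmono : ∀ k j, (sq k).1.1 ≤ (sq (k + j)).1.1 ∧
      ∀ i ≤ (sq k).1.1, (sq (k + j)).1.2 i = (sq k).1.2 i := by
    intro k j
    induction j with
    | zero => exact ⟨le_rfl, fun _ _ => rfl⟩
    | succ j ih =>
      rw [← add_assoc, hsq]
      refine ⟨ih.1.trans (hn1 _ _).le, fun i hi => ?_⟩
      rw [hn2 _ _ i (hi.trans ih.1), ih.2 i hi]
  have hval : ∀ k i, i ≤ (sq k).1.1 → (sq i).1.2 i = (sq k).1.2 i := by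
    intro k i hi
    rcases le_total k i with h | h
    · obtain ⟨j, rfl⟩ := Nat.exists_eq_add_of_le h
      exact (hmono k j).2 _ hi
    · obtain ⟨j, rfl⟩ := Nat.exists_eq_add_of_le h
      exact ((hmono i j).2 _ (by have := hlen i; omega)).symm
  refine ⟨fun i => (sq i).1.2 i, ?_, ?_, ?_⟩
  · intro n hn
    exact (sq n).2.2.1 n hn (by have := hlen n; omega)
  · intro n hn
    simp only
    have h1 := hlen (n + 1)
    rw [hval (n + 1) n (by omega)]
    exact (sq (n + 1)).2.2.2 n hn (by omega)
  · intro j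
    obtain ⟨S, hS, hb⟩ := hn3 j (sq j)
    refine ⟨S, hS, fun b hb1 hbd => ?_⟩
    obtain ⟨h1, i, hi1, hi2, hi3⟩ := hb b hb1 hbd
    refine ⟨h1, i, hi1, ?_⟩
    simp only
    rw [hval (j + 1) i (by rw [hsq]; exact hi2), hsq]
    exact hi3

end PartThree


section PartFour
open Polynomial

lemma SmallM.mono {η η' : ℝ} {g g' : Tor → ℂ} (h : SmallM η g) (hη : η ≤ η')
    (hg : ∀ t, ‖g' t‖ ≤ ‖g t‖) : SmallM η' g' := by
  unfold SmallM at *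
  refine (measure_mono ?_).trans (h.trans (ENNReal.ofReal_le_ofReal hη))
  intro t ht
  simp only [Set.mem_ofPred_eq] at ht ⊢
  linarith [hg t]

lemma SmallM.mono_left {η η' : ℝ} {g : Tor → ℂ} (h : SmallM η g) (hη : η ≤ η') : SmallM η' g :=
  h.mono hη fun _ => le_rfl

lemma SmallM.add {η η' : ℝ} {g g' : Tor → ℂ} (h : SmallM η g) (h' : SmallM η' g')
    (h0 : 0 ≤ η) (h0' : 0 ≤ η') : SmallM (η + η') (fun t => g t + g' t) := by
  unfold SmallM at *
  rw [ENNReal.ofReal_add h0 h0']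
  refine le_trans ?_ (add_le_add h h')
  refine le_trans (measure_mono ?_) (measure_union_le _ _)
  intro t ht
  simp only [Set.mem_ofPred_eq, Set.mem_union] at ht ⊢
  by_contra hcon
  push Not at hcon
  linarith [norm_add_le (g t) (g' t), hcon.1, hcon.2]

lemma smallM_of_le {η : ℝ} {g : Tor → ℂ} (h : ∀ t, ‖g t‖ ≤ η) : SmallM η g := by
  unfold SmallM
  have : {t | η < ‖g t‖} = ∅ := by
    ext t; simp [h t]
  rw [this]; simp

lemma smallM_of_one_le {η : ℝ} (g : Tor → ℂ) (h : 1 ≤ η) : SmallM η g := by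
  unfold SmallM
  refine prob_le_one.trans ?_
  rw [← ENNReal.ofReal_one]
  exact ENNReal.ofReal_le_ofReal h

/-- Partial sums over positive frequencies. -/
noncomputable def TS (c : ℤ → ℂ) (N : ℕ) (t : Tor) : ℂ :=
  ∑ k ∈ Finset.Icc (1 : ℤ) (N : ℤ), c k * (fourier k t : ℂ)

/-- Coefficients supported on `Λ` in a window. -/
def Blk (Λ : Set ℤ) (M M' : ℕ) (c : ℤ → ℂ) : Prop :=
  ∀ k, c k ≠ 0 → k ∈ Λ ∧ (M : ℤ) < k ∧ k ≤ (M' : ℤ)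

lemma TS_add (c c' : ℤ → ℂ) (N : ℕ) (t : Tor) : TS (c + c') N t = TS c N t + TS c' N t := by
  simp [TS, add_mul, Finset.sum_add_distrib]

lemma TS_smul (a : ℂ) (c : ℤ → ℂ) (N : ℕ) (t : Tor) : TS (a • c) N t = a * TS c N t := by
  simp [TS, Finset.mul_sum, mul_assoc]

lemma TS_sum {ι : Type*} (s : Finset ι) (c : ι → ℤ → ℂ) (N : ℕ) (t : Tor) :
    TS (∑ i ∈ s, c i) N t = ∑ i ∈ s, TS (c i) N t := by
  classical
  induction s using Finset.induction_on with
  | empty => simp [TS]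
  | insert a s ha ih => rw [Finset.sum_insert ha, Finset.sum_insert ha, TS_add, ih]

lemma TS_single (k : ℤ) (hk : 0 < k) (a : ℂ) (N : ℕ) (t : Tor) :
    TS (Pi.single k a) N t = if k ≤ N then a * (fourier k t : ℂ) else 0 := by
  unfold TS
  split_ifs with h
  · rw [Finset.sum_eq_single k]
    · simp
    · intro b _ hb; simp [hb]
    · intro hn; exact absurd (Finset.mem_Icc.2 ⟨by omega, h⟩) hn
  · refine Finset.sum_eq_zero fun b hb => ?_
    have : b ≠ k := by rintro rfl; exact h (Finset.mem_Icc.1 hb).2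
    simp [this]

lemma TS_eq_zero {Λ : Set ℤ} {M M' : ℕ} {c : ℤ → ℂ} (h : Blk Λ M M' c) {N : ℕ} (hN : N ≤ M)
    (t : Tor) : TS c N t = 0 := by
  refine Finset.sum_eq_zero fun k hk => ?_
  have hk2 := (Finset.mem_Icc.1 hk).2
  by_cases hc : c k = 0
  · simp [hc]
  · have := (h k hc).2.1
    omega

lemma TS_stable {Λ : Set ℤ} {M M' : ℕ} {c : ℤ → ℂ} (h : Blk Λ M M' c) {N : ℕ} (hN : M' ≤ N)
    (t : Tor) : TS c N t = TS c M' t := by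
  symm
  refine Finset.sum_subset ?_ fun k hk hk' => ?_
  · intro k hk
    have := Finset.mem_Icc.1 hk
    exact Finset.mem_Icc.2 ⟨this.1, by omega⟩
  · by_cases hc : c k = 0
    · simp [hc]
    · have h1 := (h k hc).2.2
      have h2 := Finset.mem_Icc.1 hk
      exact absurd (Finset.mem_Icc.2 ⟨h2.1, h1⟩) hk'

lemma Blk.mono {Λ : Set ℤ} {M M' L L' : ℕ} {c : ℤ → ℂ} (h : Blk Λ M M' c) (h1 : L ≤ M)
    (h2 : M' ≤ L') : Blk Λ L L' c := fun k hk => by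
  obtain ⟨a, b, d⟩ := h k hk
  exact ⟨a, by omega, by omega⟩

lemma Blk.add {Λ : Set ℤ} {M M' : ℕ} {c c' : ℤ → ℂ} (h : Blk Λ M M' c) (h' : Blk Λ M M' c') :
    Blk Λ M M' (c + c') := fun k hk => by
  by_cases hc : c k = 0
  · by_cases hc' : c' k = 0
    · simp [hc, hc'] at hk
    · exact h' k hc'
  · exact h k hc

lemma Blk.smul {Λ : Set ℤ} {M M' : ℕ} {c : ℤ → ℂ} (h : Blk Λ M M' c) (a : ℂ) :
    Blk Λ M M' (a • c) := fun k hk => h k fun hc => hk (by simp [hc])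

lemma evT_truncP (F : ℂ[X]) (K S : ℕ) (t : Tor) :
    evT (truncP K F) (S • t) = ∑ b ∈ Finset.range (F.natDegree + 1),
      if b < K then F.coeff b * (fourier ((S : ℤ) * b) t : ℂ) else 0 := by
  rw [← evT_expand]
  have e : evT (expand ℂ S (truncP K F)) t
      = ∑ b ∈ Finset.range K, F.coeff b * (fourier ((S : ℤ) * b) t : ℂ) := by
    unfold evT truncP polyOf
    rw [expand_eval, eval_finsetSum]
    refine Finset.sum_congr rfl fun b _ => ?_
    have := fourier_nat_eq_pow (S * b) t
    push_cast at this
    rw [this, pow_mul]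
    simp
  rw [e, ← Finset.sum_filter]
  symm
  refine Finset.sum_subset (fun b hb => ?_) fun b hb hb' => ?_
  · simp at hb ⊢; exact hb.2
  · simp at hb hb'
    have : F.coeff b = 0 := coeff_eq_zero_of_natDegree_lt (by
      by_contra hcon
      exact absurd (hb' (by omega)) (by omega))
    simp [this]

/-- Block polynomial. -/
lemma block_sum {Λ : Set ℤ} {F : ℂ[X]} (hF : F.coeff 0 = 1) (D : ℤ) (S M : ℕ) (hS : 0 < S)
    (hb : ∀ b : ℕ, 1 ≤ b → b ≤ F.natDegree → ((M : ℤ) < S * b + D ∧ (S * b + D : ℤ) ∈ Λ)) :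
    ∃ (M' : ℕ) (c : ℤ → ℂ), M ≤ M' ∧ Blk Λ M M' c ∧
      (∀ t, TS c M' t = (fourier D t : ℂ) * (1 - evT F (S • t))) ∧
      ∀ N, ∃ K, ∀ t, TS c N t = (fourier D t : ℂ) * (1 - evT (truncP K F) (S • t)) := by
  set d := F.natDegree with hd
  set c : ℤ → ℂ := ∑ b ∈ Finset.range d,
    Pi.single ((S : ℤ) * ((b + 1 : ℕ) : ℤ) + D) (-(F.coeff (b + 1))) with hc
  have key : ∀ N : ℕ, ∃ K, 1 ≤ K ∧ (∀ b : ℕ, 1 ≤ b → (S * b + D : ℤ) ≤ N → b < K) ∧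
      ∀ t, TS c N t = (fourier D t : ℂ) * (1 - evT (truncP K F) (S • t)) := by
    intro N
    have hex : ∃ b : ℕ, 1 ≤ b ∧ (N : ℤ) < S * b + D := by
      refine ⟨N + D.natAbs + 1, by omega, ?_⟩
      have : (1 : ℤ) ≤ S := by exact_mod_cast hS
      have h2 : ((N + D.natAbs + 1 : ℕ) : ℤ) ≤ S * ((N + D.natAbs + 1 : ℕ) : ℤ) := by nlinarith
      push_cast at h2 ⊢
      have := neg_abs_le D
      linarith
    classical
    set K := Nat.find hex with hK
    have hK1 := Nat.find_spec hex
    rw [← hK] at hK1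
    have hiff : ∀ b : ℕ, 1 ≤ b → ((S * b + D : ℤ) ≤ N ↔ b < K) := by
      intro b hb1
      constructor
      · intro h
        by_contra hcon
        push Not at hcon
        have : (S : ℤ) * K ≤ S * b := by
          have : (K : ℤ) ≤ b := by exact_mod_cast hcon
          gcongr
        linarith [hK1.2]
      · intro h
        have := Nat.find_min hex h
        push Not at this
        exact this hb1
    refine ⟨K, hK1.1, fun b h1 h2 => (hiff b h1).1 h2, fun t => ?_⟩
    rw [evT_truncP, Finset.sum_range_succ', hc, TS_sum, if_pos (by omega), hF]
    have : ∀ b ∈ Finset.range d, TS (Pi.single ((S : ℤ) * ((b + 1 : ℕ) : ℤ) + D) (-(F.coeff (b + 1)))) N t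
        = - ((fourier D t : ℂ) * if b + 1 < K then F.coeff (b + 1) * (fourier ((S : ℤ) * ((b + 1 : ℕ) : ℤ)) t : ℂ) else 0) := by
      intro b hbd
      have hbd' : b < d := Finset.mem_range.1 hbd
      have := (hb (b + 1) (by omega) (by omega)).1
      rw [TS_single _ (by omega)]
      by_cases h : b + 1 < K
      · rw [if_pos ((hiff (b + 1) (by omega)).2 h), if_pos h, fourier_add]
        ring
      · rw [if_neg (fun h' => h ((hiff (b + 1) (by omega)).1 h')), if_neg h]
        simp
    rw [Finset.sum_congr rfl this, Finset.sum_neg_distrib, ← Finset.mul_sum]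
    simp only [Nat.cast_zero, mul_zero, fourier_zero]
    ring
  have hM' : ∃ M' : ℕ, M ≤ M' ∧ (S * d + D : ℤ) ≤ M' :=
    ⟨max M (S * d + D : ℤ).toNat, le_max_left _ _, by
      have := Int.self_le_toNat (S * d + D : ℤ)
      push_cast
      exact le_max_of_le_right (by simp)⟩
  obtain ⟨M', h1, h2⟩ := hM'
  refine ⟨M', c, h1, ?_, ?_, fun N => ?_⟩
  · intro k hk
    rw [hc, Finset.sum_apply] at hk
    obtain ⟨b, hbd, hne⟩ := Finset.exists_ne_zero_of_sum_ne_zero hk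
    have hk' : k = (S : ℤ) * ((b + 1 : ℕ) : ℤ) + D := by
      by_contra hcon
      exact hne (by simp only [Pi.single_apply, if_neg hcon])
    have hbd' : b < d := Finset.mem_range.1 hbd
    have h3 := hb (b + 1) (by omega) (by omega)
    rw [← hk'] at h3
    refine ⟨h3.2, h3.1, ?_⟩
    have : (S : ℤ) * ((b + 1 : ℕ) : ℤ) ≤ S * d := by
      have : ((b + 1 : ℕ) : ℤ) ≤ d := by exact_mod_cast hbd'
      gcongr
    linarith
  · obtain ⟨K, hK1, hK2, hK3⟩ := key M'
    have : F.natDegree < K := by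
      rcases Nat.eq_zero_or_pos d with h | h
      · omega
      · exact hK2 d h h2
    intro t
    rw [hK3, truncP_of_lt this]
  · obtain ⟨K, hK1, hK2, hK3⟩ := key N
    exact ⟨K, hK3⟩

/-- The basic approximation property of the spectrum. -/
def StarP (Λ : Set ℤ) : Prop := ∀ (D : ℤ) (η : ℝ) (M : ℕ), 0 < η →
  ∃ (M' : ℕ) (c : ℤ → ℂ), M ≤ M' ∧ Blk Λ M M' c ∧
    SmallM η (fun t => TS c M' t - (fourier D t : ℂ)) ∧
    ∀ N, muT {t | 10 < ‖TS c N t‖} ≤ ENNReal.ofReal η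

lemma measure_comp_le {S : ℕ} (hS : 0 < S) (P : ℂ[X]) (a δ : ℝ)
    (h : muT {t | a < ‖evT P t‖} ≤ ENNReal.ofReal δ) :
    muT {t | a < ‖evT P (S • t)‖} ≤ ENNReal.ofReal δ := by
  have hm : MeasurableSet {t | a < ‖evT P t‖} :=
    (isOpen_lt continuous_const (evT_continuous P).norm).measurableSet
  have := (mp_nsmul (N := S) (by omega)).measure_preimage hm.nullMeasurableSet
  rw [← this] at h
  exact h

theorem exists_star {ε : ℕ → ℝ} (hε : ∀ n, 0 < ε n) (hlim : Tendsto ε atTop (𝓝 0)) :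
    ∃ l : ℕ → ℤ, (∀ n, 1 ≤ n → 0 < l n) ∧
      (∀ n, 1 ≤ n → (1 + ε n) * (l n : ℝ) < (l (n + 1) : ℝ)) ∧
      StarP (l '' {n : ℕ | 1 ≤ n}) := by
  choose F hF0 hF1 hF2 using fun n : ℕ => exists_F (1 / ((n : ℝ) + 1)) (by positivity)
  let e : ℤ × ℕ × ℕ ≃ ℕ := Denumerable.eqv _
  obtain ⟨l, h1, h2, h3⟩ := exists_lambda hε hlim (fun j => (e.symm j).1)
    (fun j => (F (e.symm j).2.1).natDegree) (fun j => (e.symm j).2.2)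
  refine ⟨l, h1, h2, ?_⟩
  intro D η M hη
  obtain ⟨n, hn⟩ := exists_nat_one_div_lt hη
  obtain ⟨S, hS, hb⟩ := h3 (e (D, n, M))
  simp only [Equiv.symm_apply_apply] at hb
  obtain ⟨M', c, hM, hB, hT, hN⟩ := block_sum (Λ := l '' {n : ℕ | 1 ≤ n}) (hF0 n) D S M hS (fun b hb1 hb2 => by
    obtain ⟨a1, i, hi, hli⟩ := hb b hb1 hb2
    exact ⟨a1, i, hi, hli⟩)
  refine ⟨M', c, hM, hB, ?_, fun N => ?_⟩
  · unfold SmallM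
    refine le_trans (measure_mono ?_) ((measure_comp_le hS _ _ _ (hF1 n)).trans
      (ENNReal.ofReal_le_ofReal hn.le))
    intro t ht
    simp only [Set.mem_ofPred_eq] at ht ⊢
    have : TS c M' t - (fourier D t : ℂ) = - ((fourier D t : ℂ) * evT (F n) (S • t)) := by
      rw [hT]; ring
    rw [this, norm_neg, norm_mul, norm_fourier_apply, one_mul] at ht
    linarith
  · obtain ⟨K, hK⟩ := hN N
    refine le_trans (measure_mono ?_) ((measure_comp_le hS _ _ _ (hF2 n K)).trans
      (ENNReal.ofReal_le_ofReal hn.le))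
    intro t ht
    simp only [Set.mem_ofPred_eq] at ht ⊢
    rw [hK, norm_mul, norm_fourier_apply, one_mul] at ht
    have := norm_sub_le (1 : ℂ) (evT (truncP K (F n)) (S • t))
    rw [norm_one] at this
    linarith

end PartFour


section PartFive

/-- `p` can be attained by arbitrarily late blocks with partial sums of size about `β`. -/
def Att (Λ : Set ℤ) (p : Tor → ℂ) (β : ℝ) : Prop := ∀ (η : ℝ) (M : ℕ), 0 < η →
  ∃ (M' : ℕ) (c : ℤ → ℂ), M ≤ M' ∧ Blk Λ M M' c ∧
    SmallM η (fun t => TS c M' t - p t) ∧ ∀ N, SmallM (β + η) (TS c N)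

lemma Att.mono {Λ : Set ℤ} {p : Tor → ℂ} {β β' : ℝ} (h : Att Λ p β) (hb : β ≤ β') :
    Att Λ p β' := fun η M hη => by
  obtain ⟨M', c, h1, h2, h3, h4⟩ := h η M hη
  exact ⟨M', c, h1, h2, h3, fun N => (h4 N).mono_left (by linarith)⟩

lemma att_zero (Λ : Set ℤ) : Att Λ (fun _ => 0) 0 := fun η M hη =>
  ⟨M, 0, le_rfl, fun k hk => by simp at hk, smallM_of_le fun t => by simp [TS, hη.le],
    fun N => smallM_of_le fun t => by simp [TS, hη.le]⟩

lemma att_single {Λ : Set ℤ} (h : StarP Λ) (a : ℂ) (D : ℤ) :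
    Att Λ (fun t => a * (fourier D t : ℂ)) (10 * ‖a‖) := by
  intro η M hη
  have ha := norm_nonneg a
  have hle : η / (‖a‖ + 1) ≤ η := div_le_self hη.le (by linarith)
  have hle2 : ‖a‖ * (η / (‖a‖ + 1)) ≤ η := by
    rw [mul_div_assoc', div_le_iff₀ (by positivity)]; nlinarith
  obtain ⟨M', c, h1, h2, h3, h4⟩ := h D (η / (‖a‖ + 1)) M (by positivity)
  refine ⟨M', a • c, h1, h2.smul a, ?_, fun N => ?_⟩
  · refine (measure_mono ?_).trans (h3.trans (ENNReal.ofReal_le_ofReal hle))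
    intro t ht
    simp only [Set.mem_ofPred_eq] at ht ⊢
    rw [TS_smul, ← mul_sub, norm_mul] at ht
    by_contra hcon
    push Not at hcon
    have := mul_le_mul_of_nonneg_left hcon ha
    linarith
  · refine (measure_mono ?_).trans ((h4 N).trans (ENNReal.ofReal_le_ofReal (by linarith)))
    intro t ht
    simp only [Set.mem_ofPred_eq] at ht ⊢
    rw [TS_smul, norm_mul] at ht
    by_contra hcon
    push Not at hcon
    have := mul_le_mul_of_nonneg_left hcon ha
    linarith

lemma Att.add {Λ : Set ℤ} {p p' : Tor → ℂ} {β β' γ : ℝ} (h : Att Λ p β) (h' : Att Λ p' β')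
    (hp : SmallM γ p) (hγ : 0 ≤ γ) (hβ' : 0 ≤ β') :
    Att Λ (fun t => p t + p' t) (max β (γ + β')) := by
  intro η M hη
  obtain ⟨M', c, h1, h2, h3, h4⟩ := h (η / 2) M (by positivity)
  obtain ⟨M'', c', h1', h2', h3', h4'⟩ := h' (η / 2) M' (by positivity)
  refine ⟨M'', c + c', h1.trans h1', (h2.mono le_rfl h1').add (h2'.mono h1 le_rfl), ?_, fun N => ?_⟩
  · refine (h3.add h3' (by positivity) (by positivity)).mono (by linarith) fun t => le_of_eq ?_
    rw [TS_add, TS_stable h2 h1']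
    congr 1
    ring
  · rcases le_total N M' with hN | hN
    · refine (h4 N).mono (by linarith [le_max_left β (γ + β')]) fun t => ?_
      rw [TS_add, TS_eq_zero h2' hN, add_zero]
    · refine ((h3.add hp (by positivity) hγ).add (h4' N) (by positivity) (by positivity)).mono
        (by linarith [le_max_right β (γ + β')]) fun t => le_of_eq ?_
      rw [TS_add, TS_stable h2 hN]
      congr 1
      ring

/-- A finite trigonometric sum. -/
noncomputable def trig (s : Finset ℤ) (b : ℤ → ℂ) (t : Tor) : ℂ :=
  ∑ k ∈ s, b k * (fourier k t : ℂ)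

lemma att_trig {Λ : Set ℤ} (h : StarP Λ) (s : Finset ℤ) (b : ℤ → ℂ) :
    Att Λ (trig s b) (11 * ∑ k ∈ s, ‖b k‖) := by
  classical
  induction s using Finset.induction_on with
  | empty =>
    have : trig ∅ b = fun _ => 0 := by ext t; simp [trig]
    rw [this]
    simpa using att_zero Λ
  | insert a s ha ih =>
    have e : trig (insert a s) b = fun t => b a * (fourier a t : ℂ) + trig s b t := by
      ext t; simp [trig, Finset.sum_insert ha]
    rw [e, Finset.sum_insert ha]
    have hs : 0 ≤ ∑ k ∈ s, ‖b k‖ := Finset.sum_nonneg fun _ _ => norm_nonneg _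
    refine ((att_single h (b a) a).add ih (γ := ‖b a‖) (smallM_of_le fun t => ?_)
      (norm_nonneg _) (by positivity)).mono ?_
    · rw [norm_mul, norm_fourier_apply, mul_one]
    · have := norm_nonneg (b a)
      exact max_le (by linarith) (by linarith)

lemma att_trig_small {Λ : Set ℤ} (h : StarP Λ) (s : Finset ℤ) (b : ℤ → ℂ) {γ : ℝ} (hγ : 0 ≤ γ)
    (hs : SmallM γ (trig s b)) : Att Λ (trig s b) γ := by
  set W := 11 * ∑ k ∈ s, ‖b k‖ with hW
  have hW0 : 0 ≤ W := by
    have : 0 ≤ ∑ k ∈ s, ‖b k‖ := Finset.sum_nonneg fun _ _ => norm_nonneg _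
    positivity
  have key : ∀ m : ℕ, 1 ≤ m → Att Λ (trig s b) (γ + W / m) := by
    intro m hm
    have hm0 : (0 : ℝ) < m := by exact_mod_cast hm
    have hmc : (m : ℂ) ≠ 0 := by exact_mod_cast hm0.ne'
    have h1 : Att Λ (fun t => trig s b t / m) (W / m) := by
      have := att_trig h s (fun k => b k / m)
      have e1 : trig s (fun k => b k / m) = fun t => trig s b t / m := by
        ext t
        simp only [trig, Finset.sum_div]
        exact Finset.sum_congr rfl fun k _ => by ring
      have e2 : 11 * ∑ k ∈ s, ‖b k / (m : ℂ)‖ = W / m := by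
        simp only [norm_div, Complex.norm_natCast, ← Finset.sum_div, hW]
        ring
      rwa [e1, e2] at this
    have h2 : ∀ i : ℕ, i ≤ m → Att Λ (fun t => (i / m : ℂ) * trig s b t) (γ + W / m) := by
      intro i
      induction i with
      | zero =>
        intro _
        have := (att_zero Λ).mono (β' := γ + W / m) (by positivity)
        simpa using this
      | succ i ih =>
        intro hi
        have h3 : SmallM γ (fun t => (i / m : ℂ) * trig s b t) := by
          refine hs.mono le_rfl fun t => ?_
          rw [norm_mul, norm_div, Complex.norm_natCast, Complex.norm_natCast]
          refine mul_le_of_le_one_left (norm_nonneg _) ?_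
          rw [div_le_one hm0]
          exact_mod_cast (by omega : i ≤ m)
        have h4 := (ih (by omega)).add h1 h3 hγ (by positivity)
        rw [max_self] at h4
        convert h4 using 2 with t
        push_cast
        ring
    have := h2 m le_rfl
    simpa [div_self hmc] using this
  intro η M hη
  obtain ⟨m, hm⟩ := exists_nat_gt (W / (η / 2))
  have hm0 : (0 : ℝ) < m := lt_of_le_of_lt (by positivity) hm
  have hm1 : 1 ≤ m := by exact_mod_cast hm0
  obtain ⟨M', c, h1, h2, h3, h4⟩ := key m hm1 (η / 2) M (by positivity)
  refine ⟨M', c, h1, h2, h3.mono_left (by linarith), fun N => (h4 N).mono_left ?_⟩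
  have : W / m ≤ η / 2 := by
    rw [div_lt_iff₀ (by positivity)] at hm
    rw [div_le_iff₀ hm0]
    linarith
  linarith

lemma density {r : Tor → ℂ} (hr : Measurable r) {η : ℝ} (hη : 0 < η) :
    ∃ s b, SmallM η (fun t => r t - trig s b t) := by
  -- truncation
  obtain ⟨n, hn⟩ : ∃ n : ℕ, muT {t | (n : ℝ) < ‖r t‖} ≤ ENNReal.ofReal (η / 2) := by
    have hanti : Antitone fun n : ℕ => {t | (n : ℝ) < ‖r t‖} := by
      intro i j hij t ht
      simp only [Set.mem_ofPred_eq] at ht ⊢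
      have : (i : ℝ) ≤ j := by exact_mod_cast hij
      linarith
    have ht := tendsto_measure_iInter_atTop (μ := muT) (s := fun n : ℕ => {t | (n : ℝ) < ‖r t‖})
      (fun n => (measurableSet_lt measurable_const hr.norm).nullMeasurableSet) hanti
      ⟨0, measure_ne_top _ _⟩
    have hemp : (⋂ n : ℕ, {t | (n : ℝ) < ‖r t‖}) = ∅ := by
      ext t
      simp only [Set.mem_iInter, Set.mem_ofPred_eq, Set.mem_empty_iff_false, iff_false, not_forall]
      obtain ⟨n, hn⟩ := exists_nat_gt ‖r t‖
      exact ⟨n, by linarith⟩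
    rw [hemp, measure_empty] at ht
    have := ht.eventually_lt_const (u := ENNReal.ofReal (η / 2)) (by simpa using hη)
    obtain ⟨n, hn⟩ := this.exists
    exact ⟨n, hn.le⟩
  set A : Set Tor := {t | ‖r t‖ ≤ (n : ℝ)} with hA
  have hAm : MeasurableSet A := measurableSet_le hr.norm measurable_const
  set r' : Tor → ℂ := A.indicator r with hr'
  have hr'm : Measurable r' := hr.indicator hAm
  have h1 : SmallM (η / 2) (fun t => r t - r' t) := by
    refine (measure_mono ?_).trans hn
    intro t ht
    simp only [Set.mem_ofPred_eq] at ht ⊢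
    by_contra hcon
    push Not at hcon
    have : r' t = r t := Set.indicator_of_mem (show t ∈ A from hcon) r
    rw [this] at ht
    simp at ht
    linarith
  have hmem : MemLp r' 1 muT := by
    refine MemLp.of_bound hr'm.aestronglyMeasurable n (ae_of_all _ fun t => ?_)
    by_cases ht : t ∈ A
    · rw [hr', Set.indicator_of_mem ht]; exact ht
    · rw [hr', Set.indicator_of_notMem ht]; simp
  obtain ⟨g, hg, hgm⟩ := hmem.exists_boundedContinuous_eLpNorm_sub_le (by simp)
    (ε := ENNReal.ofReal (η / 4 * (η / 4))) (by simp; positivity)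
  have h2 : SmallM (η / 4) (fun t => r' t - g t) := by
    rw [eLpNorm_one_eq_lintegral_enorm] at hg
    have hm := mul_meas_ge_le_lintegral (μ := muT) (f := fun t => ‖(r' - ⇑g) t‖ₑ)
      ((hr'm.sub g.continuous.measurable).enorm) (ENNReal.ofReal (η / 4))
    have hq : 0 < η / 4 := by positivity
    rw [ENNReal.ofReal_mul hq.le] at hg
    have h3 := hm.trans hg
    rw [ENNReal.mul_le_mul_iff_right (by simpa using hη) ENNReal.ofReal_ne_top] at h3
    refine (measure_mono ?_).trans h3
    intro t ht
    simp only [Set.mem_ofPred_eq] at ht ⊢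
    rw [← ofReal_norm]
    exact ENNReal.ofReal_le_ofReal ht.le
  have hcl : g.toContinuousMap ∈ (Submodule.span ℂ (Set.range (@fourier (2 * π)))).topologicalClosure := by
    rw [span_fourier_closure_eq_top]; trivial
  obtain ⟨q, hq, hqd⟩ := Metric.mem_closure_iff.1 hcl (η / 4) (by positivity)
  obtain ⟨b, hb⟩ := Finsupp.mem_span_range_iff_exists_finsupp.1 hq
  refine ⟨b.support, b, ?_⟩
  have hqt : ∀ t, q t = trig b.support b t := by
    intro t
    rw [← hb, Finsupp.sum, ContinuousMap.sum_apply]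
    simp [trig]
  have h3 : SmallM (η / 4) (fun t => g t - trig b.support b t) := by
    refine smallM_of_le fun t => ?_
    rw [← hqt, ← dist_eq_norm]
    exact (ContinuousMap.dist_apply_le_dist (f := g.toContinuousMap) (g := q) t).trans hqd.le
  refine ((h1.add h2 (by positivity) (by positivity)).add h3 (by positivity) (by positivity)).mono
    (by linarith) fun t => le_of_eq ?_
  congr 1
  ring

lemma TS_measurable (c : ℤ → ℂ) (N : ℕ) : Measurable (TS c N) := by
  unfold TS
  refine Continuous.measurable ?_
  refine continuous_finsetSum _ fun k _ => ?_
  exact continuous_const.mul (fourier k).continuous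

lemma stage {Λ : Set ℤ} (h : StarP Λ) {f : Tor → ℂ} (hf : Measurable f) {M : ℕ} {C : ℤ → ℂ}
    (hC : Blk Λ 0 M C) {a b : ℝ} (hb : 0 < b) (hba : b ≤ a)
    (ha : SmallM a (fun t => f t - TS C M t)) :
    ∃ (M' : ℕ) (C' : ℤ → ℂ), M < M' ∧ Blk Λ 0 M' C' ∧ (∀ k, k ≤ (M : ℤ) → C' k = C k) ∧
      SmallM b (fun t => f t - TS C' M' t) ∧
      ∀ N, M ≤ N → SmallM (4 * a) (fun t => TS C' N t - f t) := by
  have ha0 : 0 < a := hb.trans_le hba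
  obtain ⟨s, e, he⟩ := density (hf.sub (TS_measurable C M)) (η := b / 2) (by positivity)
  have hp : SmallM (2 * a) (trig s e) := by
    refine (ha.add (he.mono (η' := b / 2) (g' := fun t => - (f t - TS C M t - trig s e t)) le_rfl fun t => by rw [norm_neg]; rfl) ha0.le (by positivity)).mono
      (by linarith) fun t => le_of_eq ?_
    congr 1
    ring
  obtain ⟨M', c, h1, h2, h3, h4⟩ := att_trig_small h s e (by positivity) hp (b / 2) (M + 1)
    (by positivity)
  have hM : M ≤ M' := by omega
  refine ⟨M', C + c, by omega, (hC.mono le_rfl hM).add (h2.mono (Nat.zero_le _) le_rfl), ?_, ?_, ?_⟩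
  · intro k hk
    have : c k = 0 := by
      by_contra hcon
      have := (h2 k hcon).2.1
      push_cast at this
      omega
    simp [this]
  · refine (he.add (h3.mono (η' := b / 2) (g' := fun t => - (TS c M' t - trig s e t)) le_rfl fun t => by rw [norm_neg]) (by positivity) (by positivity)).mono
      (by linarith) fun t => le_of_eq ?_
    rw [TS_add, TS_stable hC hM]
    simp only [Pi.sub_apply]
    congr 1
    ring
  · intro N hN
    refine ((ha.mono (η' := a) (g' := fun t => - (f t - TS C M t)) le_rfl fun t => by rw [norm_neg]).add (h4 N) ha0.le (by positivity)).mono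
      (by linarith) fun t => le_of_eq ?_
    rw [TS_add, TS_stable hC hN]
    congr 1
    ring

theorem representation {Λ : Set ℤ} (h : StarP Λ) {f : Tor → ℂ} (hf : Measurable f) :
    ∃ c : ℤ → ℂ, (∀ k, c k ≠ 0 → k ∈ Λ) ∧
      ∀ η : ℝ, 0 < η → ∃ N₀ : ℕ, ∀ N, N₀ ≤ N → SmallM η (fun t => TS c N t - f t) := by
  let Inv : ℕ → ℕ × (ℤ → ℂ) → Prop := fun s x => s ≤ x.1 ∧ Blk Λ 0 x.1 x.2 ∧
    SmallM ((1 / 2 : ℝ) ^ s) (fun t => f t - TS x.2 x.1 t)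
  let R : ℕ → ℕ × (ℤ → ℂ) → ℕ × (ℤ → ℂ) → Prop := fun s x y => x.1 < y.1 ∧
    (∀ k, k ≤ (x.1 : ℤ) → y.2 k = x.2 k) ∧
    ∀ N, x.1 ≤ N → SmallM (4 * (1 / 2 : ℝ) ^ s) (fun t => TS y.2 N t - f t)
  have step : ∀ s x, ∃ y, Inv s x → Inv (s + 1) y ∧ R s x y := by
    intro s x
    by_cases hx : Inv s x
    · obtain ⟨hx1, hx2, hx3⟩ := hx
      obtain ⟨M', C', a1, a2, a3, a4, a5⟩ := stage h hf hx2 (b := (1 / 2 : ℝ) ^ (s + 1))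
        (by positivity) (by rw [pow_succ]; linarith [show (0 : ℝ) < (1 / 2) ^ s by positivity]) hx3
      exact ⟨(M', C'), fun _ => ⟨⟨by simp only; omega, a2, a4⟩, a1, a3, a5⟩⟩
    · exact ⟨x, fun hh => absurd hh hx⟩
  choose g hg using step
  let seq : ℕ → ℕ × (ℤ → ℂ) := fun n => Nat.rec (0, 0) (fun s x => g s x) n
  have hI : ∀ s, Inv s (seq s) := by
    intro s
    induction s with
    | zero =>
      refine ⟨le_rfl, fun k hk => by simp [seq] at hk, smallM_of_one_le _ (by simp)⟩
    | succ s ih => exact (hg s (seq s) ih).1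
  have hR : ∀ s, R s (seq s) (seq (s + 1)) := fun s => (hg s (seq s) (hI s)).2
  have hmono : StrictMono fun s => (seq s).1 := strictMono_nat_of_lt_succ fun s => (hR s).1
  have hagree : ∀ s i (k : ℤ), k ≤ ((seq s).1 : ℤ) → (seq (s + i)).2 k = (seq s).2 k := by
    intro s i k hk
    induction i with
    | zero => rfl
    | succ i ih =>
      rw [← ih]
      refine (hR (s + i)).2.1 k (hk.trans ?_)
      have : (seq s).1 ≤ (seq (s + i)).1 := hmono.monotone (by omega)
      exact_mod_cast this
  let c : ℤ → ℂ := fun k => (seq k.toNat).2 k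
  have hc : ∀ s (k : ℤ), k ≤ ((seq s).1 : ℤ) → c k = (seq s).2 k := by
    intro s k hk
    have hk' : k ≤ ((seq k.toNat).1 : ℤ) := by
      have := (hI k.toNat).1
      have h2 := Int.self_le_toNat k
      omega
    rw [← hagree s k.toNat k hk, add_comm, hagree k.toNat s k hk']
  refine ⟨c, fun k hk => ((hI k.toNat).2.1 k hk).1, ?_⟩
  intro η hη
  obtain ⟨S, hS⟩ := exists_pow_lt_of_lt_one (show 0 < η / 4 by positivity)
    (show (1 / 2 : ℝ) < 1 by norm_num)
  refine ⟨(seq S).1, fun N hN => ?_⟩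
  classical
  have hex : ∃ s, N < (seq s).1 := ⟨N + 1, (hI (N + 1)).1⟩
  have hs0 := Nat.find_spec hex
  have hs1 : S < Nat.find hex := by
    by_contra hcon
    push Not at hcon
    have : (seq (Nat.find hex)).1 ≤ (seq S).1 := hmono.monotone hcon
    omega
  obtain ⟨s, hs⟩ : ∃ s, Nat.find hex = s + 1 := ⟨Nat.find hex - 1, by omega⟩
  have hs2 := Nat.find_min hex (m := s) (by omega)
  rw [hs] at hs0 hs1
  push Not at hs2
  refine ((hR s).2.2 N hs2).mono ?_ fun t => le_of_eq ?_
  · have : (1 / 2 : ℝ) ^ s ≤ (1 / 2) ^ S :=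
      pow_le_pow_of_le_one (by norm_num) (by norm_num) (by omega)
    linarith
  · have : TS c N t = TS (seq (s + 1)).2 N t := by
      refine Finset.sum_congr rfl fun k hk => ?_
      rw [hc (s + 1) k]
      have := (Finset.mem_Icc.1 hk).2
      omega
    rw [this]

lemma tendsto_of_small {g : ℕ → Tor → ℂ} {f : Tor → ℂ}
    (h : ∀ η : ℝ, 0 < η → ∃ N₀ : ℕ, ∀ N, N₀ ≤ N → SmallM η (fun t => g N t - f t)) :
    TendstoInMeasure (volume : Measure (AddCircle (2 * π))) g atTop f := by
  rw [tendstoInMeasure_iff_norm]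
  intro δ hδ
  rw [ENNReal.tendsto_atTop_zero]
  intro ν hν
  obtain ⟨ν', hν', hνle⟩ : ∃ ν' : ℝ, 0 < ν' ∧ ENNReal.ofReal ν' ≤ ν := by
    rcases eq_or_ne ν ⊤ with rfl | hne
    · exact ⟨1, one_pos, le_top⟩
    · exact ⟨ν.toReal, ENNReal.toReal_pos hν.ne' hne, by rw [ENNReal.ofReal_toReal hne]⟩
  obtain ⟨N₀, hN₀⟩ := h (min (δ / 2) (ν' / (2 * π))) (by positivity)
  refine ⟨N₀, fun N hN => le_trans ?_ hνle⟩
  have h1 := hN₀ N hN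
  unfold SmallM at h1
  rw [AddCircle.volume_eq_smul_haarAddCircle, Measure.smul_apply, smul_eq_mul]
  calc ENNReal.ofReal (2 * π) * muT {x | δ ≤ ‖g N x - f x‖}
      ≤ ENNReal.ofReal (2 * π) * ENNReal.ofReal (ν' / (2 * π)) := by
        gcongr
        refine le_trans (measure_mono ?_) (h1.trans (ENNReal.ofReal_le_ofReal (min_le_right _ _)))
        intro t ht
        simp only [Set.mem_ofPred_eq] at ht ⊢
        have := min_le_left (δ / 2) (ν' / (2 * π))
        linarith
    _ = ENNReal.ofReal ν' := by
        rw [← ENNReal.ofReal_mul (by positivity)]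
        congr 1
        field_simp

end PartFive

/-- **Theorem 5**: for every positive `ε(n) → 0` there is a lacunary set
`Λ = {λ(n) : n ≥ 1} ⊆ ℤ⁺`, enumerated in increasing order with
`λ(n+1)/λ(n) > 1 + ε(n)`, such that every measurable `f : 𝕋 → ℂ` admits a
representation `f(t) = ∑_{k ∈ Λ} c_k e^{ikt}` converging in measure. -/
theorem lacunary_analytic_representation_in_measure (ε : ℕ → ℝ)
    (hεpos : ∀ n, 0 < ε n) (hεlim : Tendsto ε atTop (𝓝 0)) :
    ∃ (Λ : Set ℤ) (l : ℕ → ℤ),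
      Λ = l '' {n : ℕ | 1 ≤ n} ∧
      (∀ n : ℕ, 1 ≤ n → 0 < l n) ∧
      (∀ m n : ℕ, 1 ≤ m → m < n → l m < l n) ∧
      (∀ n : ℕ, 1 ≤ n → ((l (n + 1) : ℝ)) / ((l n : ℝ)) > 1 + ε n) ∧
      ∀ f : AddCircle (2 * π) → ℂ, Measurable f →
        ∃ c : ℤ → ℂ,
          TendstoInMeasure volume (fun N => lambdaPartialSum Λ c N) atTop f := by
  obtain ⟨l, h1, h2, h3⟩ := exists_star hεpos hεlim
  have hstep : ∀ n, 1 ≤ n → l n < l (n + 1) := by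
    intro n hn
    have a1 : (0 : ℝ) < l n := by exact_mod_cast h1 n hn
    have a2 := h2 n hn
    have a3 := mul_pos (hεpos n) a1
    have : (l n : ℝ) < l (n + 1) := by linarith
    exact_mod_cast this
  refine ⟨l '' {n : ℕ | 1 ≤ n}, l, rfl, h1, ?_, ?_, ?_⟩
  · intro m n hm hmn
    induction n, hmn using Nat.le_induction with
    | base => exact hstep m hm
    | succ n hn ih => exact ih.trans (hstep n (by omega))
  · intro n hn
    have a1 : (0 : ℝ) < l n := by exact_mod_cast h1 n hn
    rw [gt_iff_lt, lt_div_iff₀ a1]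
    exact h2 n hn
  · intro f hf
    obtain ⟨c, hc, hN⟩ := representation h3 hf
    refine ⟨c, tendsto_of_small fun η hη => ?_⟩
    obtain ⟨N₀, h4⟩ := hN η hη
    refine ⟨N₀, fun N hN' => (h4 N hN').mono le_rfl fun t => le_of_eq ?_⟩
    have hi : (l '' {n : ℕ | 1 ≤ n}).indicator c = c := by
      rw [Set.indicator_eq_self]
      intro k hk
      exact hc k hk
    unfold lambdaPartialSum TS
    rw [hi]
end
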